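/- arXiv:math/0611928 — 5 statements merged into one kernel-verified Lean document; each statement's English description precedes it below -/
import Mathlib

section
/- Let f be holomorphic on the unit disk with Taylor series ∑ f_k z^k, let 0 < r < 1, and suppose the function f - P_n has N zeros (with multiplicity) in the closed disk of radius r, where P_n is a polynomial of degree at most n. Then there exist positive constants A ≥ 1, a < 1 and δ > 0 depending only on r such that: if N ≥ A(n+1), then |f_k| ≤ (M(R,f)/max(R,1)^{n+1})·a^N for every k with n < k ≤ δN and every R ≥ (r+2)/3 such that f extends holomorphically past the closed disk of radius R. -/
open Metric

lemma maxp (F : ℂ → ℂ) (V : Set ℂ) (R M : ℝ) (hR : 0 < R)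
    (hV : closedBall (0:ℂ) R ⊆ V) (hF : DifferentiableOn ℂ F V)
    (hM : ∀ ζ ∈ sphere (0:ℂ) R, ‖F ζ‖ ≤ M) : ∀ w ∈ closedBall (0:ℂ) R, ‖F w‖ ≤ M := by
  intro w hw
  have hcl : closure (ball (0:ℂ) R) = closedBall 0 R := closure_ball _ hR.ne'
  refine Complex.norm_le_of_forall_mem_frontier_norm_le (U := ball (0:ℂ) R) isBounded_ball ?_ ?_ ?_
  · apply DifferentiableOn.diffContOnCl
    rw [hcl]; exact hF.mono hV
  · rw [frontier_ball _ hR.ne']; exact hM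
  · rw [hcl]; exact hw

lemma interp (r R : ℝ) (hr0 : 0 < r) (hr1 : r < 1) (hR : r < R) (V : Set ℂ) (hVo : IsOpen V)
    (hV : closedBall (0:ℂ) R ⊆ V) (h : ℂ → ℂ) (hh : DifferentiableOn ℂ h (ball (0:ℂ) 1)) :
    ∀ (m : ℕ) (F : ℂ → ℂ) (P : Polynomial ℂ) (z : Fin m → ℂ) (M : ℝ),
      DifferentiableOn ℂ F V → P.degree < (m : ℕ) → (∀ i, z i ∈ closedBall (0:ℂ) r) →
      (∀ w ∈ ball (0 : ℂ) 1, w ∈ closedBall (0:ℂ) R → F w - P.eval w = (∏ i, (w - z i)) * h w) →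
      (∀ ζ ∈ sphere (0:ℂ) R, ‖F ζ‖ ≤ M) →
      ∀ w ∈ ball (0 : ℂ) 1, w ∈ closedBall (0:ℂ) R → ‖h w‖ ≤ (2 / (R - r)) ^ m * M := by
  intro m
  induction m with
  | zero =>
    intro F P z M hF hP hz hid hM w hw hwR
    have hP0 : P = 0 := by
      rw [← Polynomial.degree_eq_bot]
      by_contra hne
      have : P ≠ 0 := by intro h0; exact hne (by simp [h0])
      rw [Polynomial.degree_eq_natDegree this] at hP
      exact absurd hP (by simp)
    have := hid w hw hwR
    simp [hP0] at this
    rw [← this]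
    simpa using maxp F V R M (hr0.trans hR) hV hF hM w hwR
  | succ m ih =>
    intro F P z M hF hP hz hid hM w hw hwR
    have hz0r : ‖z 0‖ ≤ r := by simpa using hz 0
    have hz0R : z 0 ∈ closedBall (0:ℂ) R := by simp; linarith
    have hz01 : z 0 ∈ ball (0:ℂ) 1 := by simp; linarith
    have hFz : F (z 0) = P.eval (z 0) := by
      have := hid (z 0) hz01 hz0R
      rw [Fin.prod_univ_succ] at this
      simpa [sub_eq_zero] using this
    have hMz : ‖F (z 0)‖ ≤ M := maxp F V R M (hr0.trans hR) hV hF hM _ hz0R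
    obtain ⟨P₁, hP₁⟩ : (Polynomial.X - Polynomial.C (z 0)) ∣ P - Polynomial.C (P.eval (z 0)) := by
      rw [Polynomial.dvd_iff_isRoot]; simp
    have hdeg : P₁.degree < (m : ℕ) := by
      by_cases h0 : P₁ = 0
      · simp [h0]
      have h1 : (P - Polynomial.C (P.eval (z 0))).degree < ((m + 1 : ℕ) : WithBot ℕ) := by
        refine lt_of_le_of_lt (Polynomial.degree_sub_le _ _) (max_lt hP ?_)
        refine lt_of_le_of_lt Polynomial.degree_C_le ?_
        exact_mod_cast Nat.succ_pos m
      rw [hP₁, Polynomial.degree_mul, Polynomial.degree_X_sub_C,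
        Polynomial.degree_eq_natDegree h0] at h1
      rw [Polynomial.degree_eq_natDegree h0]
      have h2 : 1 + P₁.natDegree < m + 1 := by exact_mod_cast h1
      exact_mod_cast (by omega : P₁.natDegree < m)
    have hVn : V ∈ nhds (z 0) := hVo.mem_nhds (hV hz0R)
    have hF1 : DifferentiableOn ℂ (dslope F (z 0)) V :=
      (Complex.differentiableOn_dslope hVn).2 hF
    have hPe : ∀ w, P.eval w - P.eval (z 0) = (w - z 0) * P₁.eval w := by
      intro w
      have := congrArg (Polynomial.eval w) hP₁
      simpa using this
    have hne : ∀ w ∈ ball (0 : ℂ) 1, w ∈ closedBall (0:ℂ) R → w ≠ z 0 →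
        dslope F (z 0) w - P₁.eval w = (∏ i : Fin m, (w - z i.succ)) * h w := by
      intro w hw hwR hwz
      have hs : w - z 0 ≠ 0 := sub_ne_zero.2 hwz
      rw [dslope_of_ne _ hwz, slope_def_field]
      have h1 := hid w hw hwR
      rw [Fin.prod_univ_succ] at h1
      have h2 := hPe w
      rw [← hFz] at h2
      field_simp
      linear_combination h1 + h2
    have hid1 : ∀ w ∈ ball (0 : ℂ) 1, w ∈ closedBall (0:ℂ) R →
        dslope F (z 0) w - P₁.eval w = (∏ i : Fin m, (w - z i.succ)) * h w := by
      intro w hw hwR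
      by_cases hwz : w = z 0
      · subst hwz
        have c1 : ContinuousAt (fun w => dslope F (z 0) w - P₁.eval w) (z 0) :=
          (hF1.differentiableAt hVn).continuousAt.sub P₁.continuous.continuousAt
        have c2 : ContinuousAt (fun w => (∏ i : Fin m, (w - z i.succ)) * h w) (z 0) := by
          refine ContinuousAt.mul (by fun_prop) ?_
          exact (hh.differentiableAt (isOpen_ball.mem_nhds hz01)).continuousAt
        refine tendsto_nhds_unique_of_eventuallyEq (l := nhdsWithin (z 0) {z 0}ᶜ)
          (c1.tendsto.mono_left nhdsWithin_le_nhds) (c2.tendsto.mono_left nhdsWithin_le_nhds) ?_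
        have hb : ball (0:ℂ) R ∈ nhds (z 0) := isOpen_ball.mem_nhds (by simp; linarith)
        filter_upwards [self_mem_nhdsWithin, nhdsWithin_le_nhds hb,
          nhdsWithin_le_nhds (isOpen_ball.mem_nhds hz01)] with y hy1 hy2 hy3
        exact hne y hy3 (ball_subset_closedBall hy2) hy1
      · exact hne w hw hwR hwz
    have hM1 : ∀ ζ ∈ sphere (0:ℂ) R, ‖dslope F (z 0) ζ‖ ≤ 2 / (R - r) * M := by
      intro ζ hζ
      have hn : ‖ζ‖ = R := by simpa using hζ
      have hd : R - r ≤ ‖ζ - z 0‖ := by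
        have := norm_sub_norm_le ζ (z 0); linarith
      have hwz : ζ ≠ z 0 := by
        rintro rfl; linarith
      rw [dslope_of_ne _ hwz, slope_def_field, norm_div]
      have hRr : 0 < R - r := by linarith
      have : ‖F ζ - F (z 0)‖ ≤ 2 * M := (norm_sub_le _ _).trans (by linarith [hM ζ hζ])
      calc _ ≤ 2 * M / (R - r) := div_le_div₀ ((norm_nonneg _).trans this) this hRr hd
        _ = _ := by ring
    have := ih (dslope F (z 0)) P₁ (fun i => z i.succ) _ hF1 hdeg (fun i => hz _) hid1 hM1 w hw hwR
    rw [pow_succ, mul_assoc]; exact this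

lemma blaschke (r s t K : ℝ) (hr0 : 0 < r) (hrs : r < s) (hs1 : s < 1) (ht0 : 0 < t)
    (hts : t < s) (N : ℕ) (z : Fin N → ℂ) (hz : ∀ i, z i ∈ closedBall (0:ℂ) r)
    (h : ℂ → ℂ) (hh : DifferentiableOn ℂ h (ball (0:ℂ) 1))
    (hK : ∀ w ∈ sphere (0:ℂ) s, ‖(∏ i, (w - z i)) * h w‖ ≤ K) :
    ∀ w ∈ sphere (0:ℂ) t, ‖(∏ i, (w - z i)) * h w‖ ≤ K * (s * (t + r) / (s^2 - r * t)) ^ N := by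
  intro w hw
  have hs0 : 0 < s := hr0.trans hrs
  have hwt : ‖w‖ = t := by simpa using hw
  have hzr : ∀ i, ‖z i‖ ≤ r := fun i => by simpa using hz i
  have hD : DifferentiableOn ℂ
      (fun w => (∏ i, (((s:ℂ)^2 - (starRingEnd ℂ) (z i) * w) / s)) * h w) (ball (0:ℂ) 1) := by
    refine DifferentiableOn.mul ?_ hh
    fun_prop
  have key := maxp _ _ s K hs0 (closedBall_subset_ball hs1) hD (by
    intro ζ hζ
    refine le_trans (le_of_eq ?_) (hK ζ hζ)
    have hn : ‖ζ‖ = s := by simpa using hζ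
    rw [norm_mul, norm_mul, norm_prod, norm_prod]
    congr 1
    refine Finset.prod_congr rfl fun i _ => ?_
    have : (s:ℂ)^2 = ζ * (starRingEnd ℂ) ζ := by
      rw [Complex.mul_conj, Complex.normSq_eq_norm_sq, hn]; norm_cast
    rw [this, show ζ * (starRingEnd ℂ) ζ - (starRingEnd ℂ) (z i) * ζ
      = ζ * (starRingEnd ℂ) (ζ - z i) by rw [map_sub]; ring, norm_div, norm_mul,
      Complex.norm_conj, hn, Complex.norm_real, Real.norm_of_nonneg hs0.le]
    field_simp) w (by simp [hwt, hts.le])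
  have hden : 0 < s^2 - r * t := by nlinarith
  have hpt : ∀ i, ‖w - z i‖ ≤ (s * (t + r) / (s^2 - r * t)) *
      ‖((s:ℂ)^2 - (starRingEnd ℂ) (z i) * w) / s‖ := by
    intro i
    have h1 : ‖w - z i‖ ≤ t + r := (norm_sub_le _ _).trans (by linarith [hzr i])
    have h2 : s^2 - r * t ≤ ‖(s:ℂ)^2 - (starRingEnd ℂ) (z i) * w‖ := by
      have := norm_sub_norm_le ((s:ℂ)^2) ((starRingEnd ℂ) (z i) * w)
      rw [norm_pow, norm_mul, Complex.norm_conj, hwt, Complex.norm_real,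
        Real.norm_of_nonneg hs0.le] at this
      have := mul_le_mul_of_nonneg_right (hzr i) ht0.le
      linarith
    rw [norm_div, Complex.norm_real, Real.norm_of_nonneg hs0.le]
    refine h1.trans ?_
    rw [div_mul_div_comm, le_div_iff₀ (by positivity)]
    nlinarith [mul_le_mul_of_nonneg_left h2 (by positivity : 0 ≤ s * (t + r))]
  rw [norm_mul, norm_prod] at key ⊢
  calc (∏ i, ‖w - z i‖) * ‖h w‖
      ≤ (∏ i, ((s * (t + r) / (s^2 - r * t)) *
      ‖((s:ℂ)^2 - (starRingEnd ℂ) (z i) * w) / s‖)) * ‖h w‖ := by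
        gcongr with i; exact hpt i
    _ = (s * (t + r) / (s^2 - r * t)) ^ N * ((∏ i,
      ‖((s:ℂ)^2 - (starRingEnd ℂ) (z i) * w) / s‖) * ‖h w‖) := by
        rw [Finset.prod_mul_distrib, Finset.prod_const, Finset.card_univ, Fintype.card_fin, mul_assoc]
    _ ≤ _ := by
        rw [mul_comm K]; gcongr

lemma coeffb (f : ℂ → ℂ) (c : ℕ → ℂ) (P : Polynomial ℂ) (n : ℕ) (t K : ℝ) (ht0 : 0 < t) (ht1 : t < 1)
    (hf : DifferentiableOn ℂ f (ball (0 : ℂ) 1))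
    (hc : ∀ w ∈ ball (0 : ℂ) 1, HasSum (fun k : ℕ => c k * w ^ k) (f w))
    (hP : P.degree ≤ (n : ℕ))
    (hK : ∀ w ∈ sphere (0:ℂ) t, ‖f w - P.eval w‖ ≤ K) (k : ℕ) (hk : n < k) :
    ‖c k‖ ≤ K / t ^ k := by
  set g : ℂ → ℂ := fun w => f w - P.eval w with hg
  have hgd : DifferentiableOn ℂ g (ball (0:ℂ) 1) := hf.sub P.differentiable.differentiableOn
  have hsum : ∀ w ∈ ball (0 : ℂ) 1, HasSum (fun k : ℕ => (c k - P.coeff k) * w ^ k) (g w) := by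
    intro w hw
    have h1 : HasSum (fun k : ℕ => P.coeff k * w ^ k) (P.eval w) := by
      rw [Polynomial.eval_eq_sum_range]
      apply hasSum_sum_of_ne_finset_zero
      intro b hb
      rw [Polynomial.coeff_eq_zero_of_natDegree_lt (by simpa [Nat.lt_succ_iff] using hb), zero_mul]
    simpa [sub_mul] using (hc w hw).sub h1
  have hps : HasFPowerSeriesAt g
      (FormalMultilinearSeries.ofScalars ℂ (fun k => c k - P.coeff k)) 0 := by
    rw [hasFPowerSeriesAt_iff]
    filter_upwards [isOpen_ball.mem_nhds (mem_ball_self (x := (0:ℂ)) one_pos)] with w hw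
    simpa [FormalMultilinearSeries.coeff_ofScalars, mul_comm] using hsum w hw
  have han : AnalyticAt ℂ g 0 := hps.analyticAt
  have heq := hps.eq_formalMultilinearSeries han.hasFPowerSeriesAt
  have hck : c k = iteratedDeriv k g 0 / k.factorial := by
    have h2 := congrArg (fun p => FormalMultilinearSeries.coeff p k) heq
    simp only [FormalMultilinearSeries.coeff_ofScalars] at h2
    rw [Polynomial.coeff_eq_zero_of_degree_lt (lt_of_le_of_lt hP (by exact_mod_cast hk)),
      sub_zero] at h2
    exact h2
  have hC := Complex.norm_iteratedDeriv_le_of_forall_mem_sphere_norm_le k ht0 (f := g) (c := 0)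
    (C := K) (by
      apply DifferentiableOn.diffContOnCl
      rw [closure_ball _ ht0.ne']
      exact hgd.mono (closedBall_subset_ball ht1)) hK
  have hfac : (0:ℝ) < k.factorial := by exact_mod_cast k.factorial_pos
  rw [hck, norm_div, Complex.norm_natCast, div_le_iff₀ hfac]
  refine hC.trans (le_of_eq (by ring))

lemma consts (C θ t : ℝ) (hC : 1 < C) (hθ0 : 0 < θ) (hθ1 : θ < 1) (ht0 : 0 < t) (ht1 : t < 1) :
    ∃ A a δ : ℝ, 1 ≤ A ∧ 0 < a ∧ a < 1 ∧ 0 < δ ∧ ∀ n N k : ℕ, A * (n + 1) ≤ (N : ℝ) →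
      (k : ℝ) ≤ δ * N → C ^ (n + 1) * θ ^ N / t ^ k ≤ a ^ N := by
  have hL : Real.log θ < 0 := Real.log_neg hθ0 hθ1
  have hT : Real.log t < 0 := Real.log_neg ht0 ht1
  have hlC : 0 < Real.log C := Real.log_pos hC
  refine ⟨max 1 (4 * Real.log C / (-Real.log θ)), Real.exp (Real.log θ / 2),
    (Real.log θ / 4) / Real.log t, le_max_left _ _, Real.exp_pos _, ?_, ?_, ?_⟩
  · rw [Real.exp_lt_one_iff]; linarith
  · exact div_pos_of_neg_of_neg (by linarith) hT
  intro n N k hA hk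
  have h1 : ((n:ℝ) + 1) * Real.log C ≤ N * (-Real.log θ) / 4 := by
    have : 4 * Real.log C / (-Real.log θ) * (n + 1) ≤ N :=
      (mul_le_mul_of_nonneg_right (le_max_right _ _) (by positivity)).trans hA
    rw [div_mul_eq_mul_div, div_le_iff₀ (by linarith)] at this
    linarith
  have h2 : (k:ℝ) * (-Real.log t) ≤ N * (-Real.log θ) / 4 := by
    have := mul_le_mul_of_nonneg_right hk (by linarith : 0 ≤ -Real.log t)
    refine this.trans (le_of_eq ?_)
    have hT0 : Real.log t ≠ 0 := hT.ne
    field_simp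
  have e : ∀ (x : ℝ) (m : ℕ), 0 < x → x ^ m = Real.exp (m * Real.log x) := by
    intro x m hx
    rw [Real.exp_nat_mul, Real.exp_log hx]
  rw [e C _ (by linarith), e θ _ hθ0, e t _ ht0, ← Real.exp_nat_mul, ← Real.exp_add, ← Real.exp_sub,
    Real.exp_le_exp]
  push_cast
  linarith

theorem stmt_8 (r : ℝ) (hr0 : 0 < r) (hr1 : r < 1) :
    ∃ A a δ : ℝ, 1 ≤ A ∧ 0 < a ∧ a < 1 ∧ 0 < δ ∧
      ∀ (f : ℂ → ℂ) (c : ℕ → ℂ) (P : Polynomial ℂ) (n N : ℕ),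
        DifferentiableOn ℂ f (ball (0 : ℂ) 1) →
        (∀ w ∈ ball (0 : ℂ) 1, HasSum (fun k : ℕ => c k * w ^ k) (f w)) →
        P.degree ≤ (n : ℕ) →
        (∃ z : Fin N → ℂ, (∀ i, z i ∈ closedBall (0 : ℂ) r) ∧
          ∃ h : ℂ → ℂ, DifferentiableOn ℂ h (ball (0 : ℂ) 1) ∧
            ∀ w ∈ ball (0 : ℂ) 1, f w - P.eval w = (∏ i, (w - z i)) * h w) →
        A * (n + 1) ≤ (N : ℝ) →
        ∀ R : ℝ, (r + 2) / 3 ≤ R →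
          (∃ U : Set ℂ, IsOpen U ∧ closedBall (0 : ℂ) R ⊆ U ∧ DifferentiableOn ℂ f U) →
          ∀ k : ℕ, n < k → (k : ℝ) ≤ δ * N →
            ‖c k‖ ≤ sSup ((fun ζ => ‖f ζ‖) '' sphere (0 : ℂ) R) /
              (max R 1) ^ (n + 1) * a ^ N := by
  obtain ⟨s, hs⟩ : ∃ s, s = (1 + r) / 2 := ⟨_, rfl⟩
  have hrs : r < s := by linarith
  have hs1 : s < 1 := by linarith
  have hs0 : 0 < s := by linarith
  obtain ⟨t, ht⟩ : ∃ t, t = s * (s - r) / (2 * (s + r)) := ⟨_, rfl⟩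
  have ht0 : 0 < t := by rw [ht]; exact div_pos (mul_pos hs0 (by linarith)) (by linarith)
  have ht' : t * (2 * (s + r)) = s * (s - r) := by rw [ht]; field_simp
  have hts : t < s := by nlinarith
  have hden : 0 < s^2 - r * t := by nlinarith
  obtain ⟨θ, hθ⟩ : ∃ θ, θ = s * (t + r) / (s^2 - r * t) := ⟨_, rfl⟩
  have hθ0 : 0 < θ := by rw [hθ]; positivity
  have hθ1 : θ < 1 := by
    rw [hθ, div_lt_one hden]; nlinarith
  have hκ : 0 < 2 * (1 - r) / 3 := by linarith
  obtain ⟨A, a, δ, hA, ha0, ha1, hδ, hall⟩ := consts (4 / (2 * (1 - r) / 3)) θ t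
    (by rw [lt_div_iff₀ hκ]; linarith) hθ0 hθ1 ht0 (hts.trans hs1)
  refine ⟨A, a, δ, hA, ha0, ha1, hδ, ?_⟩
  rintro f c P n N hf hc hP ⟨z, hz, h, hh, hid⟩ hAN R hR ⟨U, hUo, hU, hfU⟩ k hk hkN
  have hrR : r < R := by linarith
  have hsR : s < R := by linarith
  have hall' := hall n N k hAN hkN
  set M := sSup ((fun ζ => ‖f ζ‖) '' sphere (0 : ℂ) R) with hMdef
  have hbdd : BddAbove ((fun ζ => ‖f ζ‖) '' sphere (0 : ℂ) R) :=
    ((isCompact_sphere _ _).image_of_continuousOn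
      ((hfU.continuousOn.mono (sphere_subset_closedBall.trans hU)).norm)).bddAbove
  have hM : ∀ ζ ∈ sphere (0:ℂ) R, ‖f ζ‖ ≤ M := fun ζ hζ => le_csSup hbdd ⟨ζ, hζ, rfl⟩
  have hM0 : 0 ≤ M := Real.sSup_nonneg (by rintro _ ⟨ζ, _, rfl⟩; exact norm_nonneg _)
  have hnN : n + 1 ≤ N := by
    have : ((n:ℝ) + 1) ≤ N := by nlinarith
    exact_mod_cast this
  obtain ⟨d, rfl⟩ := Nat.exists_eq_add_of_le hnN
  have hi := interp r R hr0 hr1 hrR U hUo hU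
    (fun w => (∏ i : Fin d, (w - z (Fin.natAdd (n+1) i))) * h w)
    (DifferentiableOn.mul (by fun_prop) hh) (n + 1) f P (fun i => z (Fin.castAdd d i)) M hfU
    (lt_of_le_of_lt hP (by exact_mod_cast Nat.lt_succ_self n)) (fun i => hz _)
    (by intro w hw _; rw [hid w hw, Fin.prod_univ_add, mul_assoc]) hM
  have hRr : 0 < R - r := by linarith
  have hK : ∀ w ∈ sphere (0:ℂ) s, ‖(∏ i, (w - z i)) * h w‖ ≤ (4 / (R - r)) ^ (n+1) * M := by
    intro w hw
    have hn : ‖w‖ = s := by simpa using hw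
    have := hi w (by simp [hn, hs1]) (by simp [hn, hsR.le])
    rw [Fin.prod_univ_add, mul_assoc, norm_mul, norm_prod]
    have hp : ∏ i : Fin (n+1), ‖w - z (Fin.castAdd d i)‖ ≤ 2 ^ (n+1) := by
      calc _ ≤ ∏ i : Fin (n+1), (2:ℝ) := by
            gcongr with i
            have h1 : ‖z (Fin.castAdd d i)‖ ≤ r := by simpa using hz (Fin.castAdd d i)
            have := norm_sub_le w (z (Fin.castAdd d i))
            linarith
        _ = _ := by simp
    calc _ ≤ 2 ^ (n+1) * ((2 / (R - r)) ^ (n + 1) * M) :=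
          mul_le_mul hp this (norm_nonneg _) (by positivity)
      _ = _ := by rw [← mul_assoc, ← mul_pow]; congr 2; ring
  have hb := blaschke r s t _ hr0 hrs hs1 ht0 hts _ z hz h hh hK
  rw [← hθ] at hb
  have hcb := coeffb f c P n t _ ht0 (hts.trans hs1) hf hc hP (by
    intro w hw
    have hn : ‖w‖ = t := by simpa using hw
    rw [hid w (by simp [hn]; linarith)]
    exact hb w hw) k hk
  refine hcb.trans ?_
  have hmax : 0 < max R 1 := lt_max_of_lt_right one_pos
  have hcmp : 2 * (1 - r) / 3 * max R 1 ≤ R - r := by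
    rcases max_cases R 1 with ⟨he, _⟩ | ⟨he, _⟩
    · rw [he]; nlinarith [sq_nonneg (r - 1)]
    · rw [he]; linarith
  have h4 : 4 / (R - r) ≤ 4 / (2 * (1 - r) / 3) / max R 1 := by
    rw [div_div]; exact div_le_div_of_nonneg_left (by norm_num) (by positivity) hcmp
  calc (4 / (R - r)) ^ (n+1) * M * θ ^ (n + 1 + d) / t ^ k
      ≤ (4 / (2 * (1 - r) / 3) / max R 1) ^ (n+1) * M * θ ^ (n + 1 + d) / t ^ k := by
        have : 0 ≤ 4 / (R - r) := by positivity
        gcongr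
    _ = M / (max R 1) ^ (n + 1) *
        ((4 / (2 * (1 - r) / 3)) ^ (n+1) * θ ^ (n + 1 + d) / t ^ k) := by
        rw [div_pow _ (max R 1)]; ring
    _ ≤ _ := by gcongr
end

section
/- Let f be holomorphic on the open unit disk, K the closed disk of radius r < 1, and N_K(n) the maximal number of zeros (with multiplicity) in K of f - p over all polynomials p of degree at most n. If N_K(n)/n → ∞ as n → ∞, then f is a polynomial. -/
open Metric Filter

lemma ov_max (ρ : ℝ) (hρ : 0 < ρ) (hρ1 : ρ < 1) (g : ℂ → ℂ)
    (hg : DifferentiableOn ℂ g (ball (0 : ℂ) 1)) (A : ℝ)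
    (hA : ∀ w : ℂ, ‖w‖ = ρ → ‖g w‖ ≤ A) (w : ℂ) (hw : ‖w‖ ≤ ρ) : ‖g w‖ ≤ A := by
  have hsub : closedBall (0 : ℂ) ρ ⊆ ball 0 1 := closedBall_subset_ball hρ1
  refine Complex.norm_le_of_forall_mem_frontier_norm_le (U := ball (0 : ℂ) ρ) isBounded_ball ?_ ?_ ?_
  · refine DifferentiableOn.diffContOnCl ?_
    rw [closure_ball _ hρ.ne']
    exact hg.mono hsub
  · intro z hz
    rw [frontier_ball _ hρ.ne'] at hz
    exact hA z (by simpa using hz)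
  · rw [closure_ball _ hρ.ne']
    simpa using hw

lemma ov_ident (R : ℝ) (z w : ℂ) :
    ‖(R : ℂ) ^ 2 - (starRingEnd ℂ) z * w‖ ^ 2 - R ^ 2 * ‖w - z‖ ^ 2
      = (R ^ 2 - ‖z‖ ^ 2) * (R ^ 2 - ‖w‖ ^ 2) := by
  rw [← Complex.normSq_eq_norm_sq, ← Complex.normSq_eq_norm_sq, ← Complex.normSq_eq_norm_sq,
    ← Complex.normSq_eq_norm_sq]
  simp only [Complex.normSq_apply, Complex.sub_re, Complex.sub_im, Complex.mul_re, Complex.mul_im,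
    Complex.conj_re, Complex.conj_im, pow_two, Complex.ofReal_re, Complex.ofReal_im]
  ring

lemma ov_factor (r s R : ℝ) (hr : 0 < r) (hs : 0 < s) (hrR : r < R) (hsR : s < R) :
    ∃ q : ℝ, 0 < q ∧ q < 1 ∧ ∀ z w : ℂ, ‖z‖ ≤ r → ‖w‖ ≤ s →
      R * ‖w - z‖ ≤ q * ‖(R : ℂ) ^ 2 - (starRingEnd ℂ) z * w‖ := by
  have hR : 0 < R := hr.trans hrR
  set c := (R ^ 2 - r ^ 2) * (R ^ 2 - s ^ 2) / (4 * R ^ 4) with hc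
  have h1 : 0 < R ^ 2 - r ^ 2 := by nlinarith
  have h2 : 0 < R ^ 2 - s ^ 2 := by nlinarith
  have hc0 : 0 < c := by positivity
  have hc1 : c < 1 := by
    rw [hc, div_lt_one (by positivity)]
    have : (R ^ 2 - r ^ 2) * (R ^ 2 - s ^ 2) ≤ R ^ 2 * R ^ 2 := by
      apply mul_le_mul <;> nlinarith
    have : 0 < R ^ 4 := by positivity
    nlinarith
  refine ⟨√(1 - c), Real.sqrt_pos.2 (by linarith), ?_, ?_⟩
  · rw [Real.sqrt_lt' one_pos]; linarith
  intro z w hz hw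
  have hid := ov_ident R z w
  set B := ‖(R : ℂ) ^ 2 - (starRingEnd ℂ) z * w‖ with hB
  have hB2 : B ≤ 2 * R ^ 2 := by
    calc B ≤ ‖(R : ℂ) ^ 2‖ + ‖(starRingEnd ℂ) z * w‖ := norm_sub_le _ _
      _ = R ^ 2 + ‖z‖ * ‖w‖ := by simp
      _ ≤ R ^ 2 + R * R := by
        have : ‖z‖ * ‖w‖ ≤ R * R := by
          apply mul_le_mul <;> first | linarith | positivity
        linarith
      _ = _ := by ring
  have hB0 : 0 ≤ B := norm_nonneg _
  have hcB : c * B ^ 2 ≤ (R ^ 2 - ‖z‖ ^ 2) * (R ^ 2 - ‖w‖ ^ 2) := by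
    have e1 : c * B ^ 2 ≤ c * (2 * R ^ 2) ^ 2 := by gcongr
    have e2 : c * (2 * R ^ 2) ^ 2 = (R ^ 2 - r ^ 2) * (R ^ 2 - s ^ 2) := by
      rw [hc]; field_simp; ring
    have e3 : (R ^ 2 - r ^ 2) * (R ^ 2 - s ^ 2) ≤ (R ^ 2 - ‖z‖ ^ 2) * (R ^ 2 - ‖w‖ ^ 2) := by
      have : ‖z‖ ^ 2 ≤ r ^ 2 := by gcongr
      have : ‖w‖ ^ 2 ≤ s ^ 2 := by gcongr
      apply mul_le_mul <;> linarith
    linarith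
  refine (pow_le_pow_iff_left₀ (by positivity) (by positivity) two_ne_zero).1 ?_
  rw [mul_pow, mul_pow, Real.sq_sqrt (by linarith)]
  linarith

lemma ov_schwarz (r s R : ℝ) (hr : 0 < r) (hs : 0 < s) (hrR : r < R) (hsR : s < R) (hR1 : R < 1) :
    ∃ q : ℝ, 0 < q ∧ q < 1 ∧ ∀ (N : ℕ) (z : Fin N → ℂ) (g h : ℂ → ℂ) (A : ℝ),
      (∀ i, z i ∈ closedBall (0 : ℂ) r) → DifferentiableOn ℂ h (ball (0 : ℂ) 1) →
      (∀ w ∈ ball (0 : ℂ) 1, g w = (∏ i, (w - z i)) * h w) →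
      (∀ w : ℂ, ‖w‖ ≤ R → ‖g w‖ ≤ A) → ∀ w : ℂ, ‖w‖ ≤ s → ‖g w‖ ≤ q ^ N * A := by
  have hR : 0 < R := hr.trans hrR
  obtain ⟨q, hq0, hq1, hq⟩ := ov_factor r s R hr hs hrR hsR
  refine ⟨q, hq0, hq1, ?_⟩
  intro N z g h A hz hh hg hA w hw
  have hz' : ∀ i, ‖z i‖ ≤ r := fun i => by simpa using hz i
  set b : Fin N → ℂ → ℂ := fun i w => (R : ℂ) ^ 2 - (starRingEnd ℂ) (z i) * w with hb
  have hH : ∀ w : ℂ, ‖w‖ ≤ R → ‖(∏ i, b i w) * h w‖ ≤ R ^ N * A := by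
    refine ov_max R hR hR1 (fun w => (∏ i, b i w) * h w) ?_ _ ?_
    · refine DifferentiableOn.mul ?_ hh
      apply Differentiable.differentiableOn
      simp only [hb]
      fun_prop
    · intro w hw
      have e : ∀ i, ‖b i w‖ = R * ‖w - z i‖ := by
        intro i
        have := ov_ident R (z i) w
        rw [hw] at this
        rw [← sq_eq_sq₀ (norm_nonneg _) (by positivity), mul_pow]
        simp only [hb]
        linarith
      have e2 := hA w hw.le
      rw [hg w (by simp [hw, hR1])] at e2
      rw [norm_mul, norm_prod] at e2 ⊢
      simp only [e, Finset.prod_mul_distrib, Finset.prod_const, Finset.card_univ, Fintype.card_fin]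
      rw [mul_assoc]
      gcongr
  have h1 := hH w (hw.trans hsR.le)
  rw [hg w (by simp; linarith)]
  rw [norm_mul, norm_prod] at h1 ⊢
  have h2 : R ^ N * ∏ i, ‖w - z i‖ ≤ q ^ N * ∏ i, ‖b i w‖ := by
    have : ∏ i, (R * ‖w - z i‖) ≤ ∏ i, (q * ‖b i w‖) :=
      Finset.prod_le_prod (fun i _ => by positivity) (fun i _ => hq _ _ (hz' i) hw)
    simpa [Finset.prod_mul_distrib] using this
  have h3 : R ^ N * ((∏ i, ‖w - z i‖) * ‖h w‖) ≤ R ^ N * (q ^ N * A) := by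
    calc R ^ N * ((∏ i, ‖w - z i‖) * ‖h w‖) = (R ^ N * ∏ i, ‖w - z i‖) * ‖h w‖ := by ring
      _ ≤ (q ^ N * ∏ i, ‖b i w‖) * ‖h w‖ := by gcongr
      _ = q ^ N * ((∏ i, ‖b i w‖) * ‖h w‖) := by ring
      _ ≤ q ^ N * (R ^ N * A) := by gcongr
      _ = _ := by ring
  exact le_of_mul_le_mul_left h3 (by positivity)

lemma ov_bernstein (s R : ℝ) (hs : 0 < s) (hsR : s < R) (n : ℕ) (P : Polynomial ℂ)
    (hP : P.degree ≤ (n : ℕ)) (A : ℝ) (hA : ∀ w : ℂ, ‖w‖ ≤ s → ‖P.eval w‖ ≤ A) (hR1 : R < 1)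
    (w : ℂ) (hw : ‖w‖ ≤ R) : ‖P.eval w‖ ≤ (R / s) ^ n * A := by
  have hR : 0 < R := hs.trans hsR
  refine ov_max R hR hR1 (fun w => P.eval w) P.differentiable.differentiableOn _ ?_ w hw
  clear hw w
  intro w hw
  have hnd : P.natDegree ≤ n := Polynomial.natDegree_le_iff_degree_le.2 hP
  have key : ∀ u : ℂ, u ≠ 0 → (P.reflect n).eval u⁻¹ * u ^ n = P.eval u := by
    intro u hu
    letI := invertibleOfNonzero hu
    have := Polynomial.eval₂_reflect_mul_pow (RingHom.id ℂ) u n P hnd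
    simpa [Polynomial.eval₂_id, Polynomial.eval₂_eq_eval_map, invOf_eq_inv] using this
  have hw0 : w ≠ 0 := by rintro rfl; simp at hw; linarith
  have hQ : ‖(P.reflect n).eval w⁻¹‖ ≤ A / s ^ n := by
    refine Complex.norm_le_of_forall_mem_frontier_norm_le (f := fun u => (P.reflect n).eval u)
      (U := ball (0 : ℂ) s⁻¹) isBounded_ball ?_ ?_ ?_
    · exact (P.reflect n).differentiable.diffContOnCl
    · intro u hu
      rw [frontier_ball _ (by positivity)] at hu
      have hu' : ‖u‖ = s⁻¹ := by simpa using hu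
      have hu0 : u ≠ 0 := by
        rintro rfl
        have : 0 < s⁻¹ := by positivity
        simp at hu'; linarith
      have := key u⁻¹ (inv_ne_zero hu0)
      rw [inv_inv] at this
      have hh := hA u⁻¹ (by simp [hu'])
      rw [← this, norm_mul, norm_pow, norm_inv, hu', inv_inv] at hh
      rw [le_div_iff₀ (by positivity)]
      exact hh
    · rw [closure_ball _ (by positivity)]
      simp only [mem_closedBall, dist_zero_right, norm_inv, hw]
      gcongr
  rw [← key w hw0, norm_mul, norm_pow, hw]
  calc _ ≤ A / s ^ n * R ^ n := by gcongr
    _ = _ := by rw [div_pow]; ring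

lemma ov_ev (N : ℕ → ℕ) (hN : Tendsto (fun n : ℕ => (N n : ℝ) / (n : ℝ)) atTop atTop)
    (q μ : ℝ) (hq0 : 0 < q) (hq1 : q < 1) (hμ : 1 ≤ μ) :
    ∀ᶠ n in atTop, μ ^ (n + 1) * q ^ N n ≤ (1 / 2) ^ n := by
  obtain ⟨k, hk⟩ := exists_pow_lt_of_lt_one (show (0 : ℝ) < 1 / (2 * μ ^ 2) by positivity) hq1
  filter_upwards [hN.eventually_ge_atTop (k : ℝ), eventually_ge_atTop 1] with n h1 h2
  have hn : (0 : ℝ) < n := by exact_mod_cast h2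
  rw [le_div_iff₀ hn] at h1
  have h3 : k * n ≤ N n := by exact_mod_cast h1
  have e1 : q ^ N n ≤ (1 / (2 * μ ^ 2)) ^ n := by
    calc q ^ N n ≤ q ^ (k * n) := pow_le_pow_of_le_one hq0.le hq1.le h3
      _ = (q ^ k) ^ n := pow_mul _ _ _
      _ ≤ _ := by gcongr
  have e2 : μ ^ (n + 1) ≤ (μ ^ 2) ^ n := by
    rw [← pow_mul]
    exact pow_le_pow_right₀ hμ (by omega)
  calc _ ≤ (μ ^ 2) ^ n * (1 / (2 * μ ^ 2)) ^ n := by gcongr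
    _ = _ := by
      rw [← mul_pow]; congr 1; field_simp

lemma ov_seq (x : ℕ → ℝ) (n0 : ℕ) (hn0 : 1 ≤ n0) (hx : ∀ n, 0 ≤ x n)
    (h : ∀ n ≥ n0, x n ≤ x (n + 1) + (1 / 2) ^ n * (x n + x (n + 1)))
    (hlim : Tendsto x atTop (nhds 0)) : x n0 ≤ 0 := by
  set y : ℕ → ℝ := fun n => x n * Real.exp (-8 * (1 / 2) ^ n) with hy
  have step : ∀ n ≥ n0, y n ≤ y (n + 1) := by
    intro n hn
    have hd0 : (0 : ℝ) < (1 / 2) ^ n := by positivity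
    have hd1 : ((1 : ℝ) / 2) ^ n ≤ 1 / 2 := by
      calc ((1 : ℝ) / 2) ^ n ≤ (1 / 2) ^ 1 :=
            pow_le_pow_of_le_one (by norm_num) (by norm_num) (by omega)
        _ = _ := by norm_num
    have hh := h n hn
    simp only [hy]
    rw [pow_succ]
    set d := ((1 : ℝ) / 2) ^ n
    have e1 : (1 + d) ≤ Real.exp (4 * d) * (1 - d) := by
      have := Real.add_one_le_exp (4 * d)
      nlinarith
    have e2 : x n ≤ Real.exp (4 * d) * x (n + 1) := by
      have : (1 - d) * x n ≤ (1 - d) * (Real.exp (4 * d) * x (n + 1)) := by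
        have := mul_le_mul_of_nonneg_right e1 (hx (n + 1))
        nlinarith
      exact le_of_mul_le_mul_left this (by linarith)
    calc x n * Real.exp (-8 * d) ≤ Real.exp (4 * d) * x (n + 1) * Real.exp (-8 * d) := by gcongr
      _ = x (n + 1) * (Real.exp (4 * d) * Real.exp (-8 * d)) := by ring
      _ = _ := by rw [← Real.exp_add]; congr 2; ring
  have mono : ∀ n ≥ n0, y n0 ≤ y n := by
    intro n hn
    induction n, hn using Nat.le_induction with
    | base => exact le_rfl
    | succ n hn ih => exact ih.trans (step n hn)
  have hle : ∀ᶠ n in atTop, y n0 ≤ x n := by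
    filter_upwards [eventually_ge_atTop n0] with n hn
    refine (mono n hn).trans ?_
    simp only [hy]
    refine mul_le_of_le_one_right (hx n) ?_
    rw [Real.exp_le_one_iff]
    have : (0 : ℝ) < (1 / 2) ^ n := by positivity
    linarith
  have : y n0 ≤ 0 := ge_of_tendsto hlim hle
  simp only [hy] at this
  exact nonpos_of_mul_nonpos_left this (Real.exp_pos _)

lemma ov_sup (g : ℂ → ℂ) (hg : DifferentiableOn ℂ g (ball (0 : ℂ) 1)) (R : ℝ) (hR : 0 < R)
    (hR1 : R < 1) : ∃ A : ℝ, (∀ w : ℂ, ‖w‖ ≤ R → ‖g w‖ ≤ A) ∧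
      (∀ B : ℝ, (∀ w : ℂ, ‖w‖ ≤ R → ‖g w‖ ≤ B) → A ≤ B) ∧ 0 ≤ A := by
  have hc : ContinuousOn (fun w => ‖g w‖) (closedBall (0 : ℂ) R) :=
    (hg.continuousOn.mono (closedBall_subset_ball hR1)).norm
  obtain ⟨w0, hw0, hmax⟩ := (isCompact_closedBall (0 : ℂ) R).exists_isMaxOn
    ⟨0, by simp [hR.le]⟩ hc
  refine ⟨‖g w0‖, fun w hw => hmax (by simpa using hw), fun B hB => hB w0 (by simpa using hw0),
    norm_nonneg _⟩

/-- Overinterpolation by polynomials: let `f` be holomorphic on the unit disk and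
`0 < r < 1`. Suppose there is `N : ℕ → ℕ` with `N(n)/n → ∞` such that for each `n`
there exists a polynomial `Pₙ` of degree at most `n` for which `f - Pₙ` has at least
`N(n)` zeros, counted with multiplicity, in the closed disk of radius `r`. Then `f` is
a polynomial. -/
theorem stmt_10 (f : ℂ → ℂ) (r : ℝ) (hr0 : 0 < r) (hr1 : r < 1)
    (hf : DifferentiableOn ℂ f (ball (0 : ℂ) 1))
    (N : ℕ → ℕ)
    (hN : Tendsto (fun n : ℕ => (N n : ℝ) / (n : ℝ)) atTop atTop)
    (hint : ∀ n : ℕ, ∃ P : Polynomial ℂ, P.degree ≤ (n : ℕ) ∧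
      ∃ z : Fin (N n) → ℂ, (∀ i, z i ∈ closedBall (0 : ℂ) r) ∧
        ∃ h : ℂ → ℂ, DifferentiableOn ℂ h (ball (0 : ℂ) 1) ∧
          ∀ w ∈ ball (0 : ℂ) 1, f w - P.eval w = (∏ i, (w - z i)) * h w) :
    ∃ p : Polynomial ℂ, ∀ w ∈ ball (0 : ℂ) 1, f w = p.eval w := by
  obtain ⟨R, hrR, hR1⟩ := exists_between hr1
  obtain ⟨T, hRT, hT1⟩ := exists_between hR1
  have hR : 0 < R := hr0.trans hrR
  have hT : 0 < T := hR.trans hRT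
  choose P hP z hz h hh hfac using hint
  have hg : ∀ n, DifferentiableOn ℂ (fun w => f w - (P n).eval w) (ball (0 : ℂ) 1) :=
    fun n => hf.sub (P n).differentiable.differentiableOn
  choose x hx1 hx2 hx0 using fun n => ov_sup _ (hg n) R hR hR1
  obtain ⟨F, hF, -, hF0⟩ := ov_sup f hf T hT hT1
  -- decay
  have hlim : Tendsto x atTop (nhds 0) := by
    obtain ⟨q, hq0, hq1, hq⟩ := ov_schwarz r R T hr0 hR (hrR.trans hRT) hRT hT1
    set μ := T / R with hμ
    have hμ1 : 1 ≤ μ := by rw [hμ, one_le_div hR]; exact hRT.le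
    have hev := ov_ev N hN q μ hq0 hq1 hμ1
    have hb : ∀ᶠ n in atTop, x n ≤ 4 * F * (1 / 2) ^ n := by
      filter_upwards [hev, eventually_ge_atTop 1] with n hn hn1
      have hd1 : ((1 : ℝ) / 2) ^ n ≤ 1 / 2 := by
        calc ((1 : ℝ) / 2) ^ n ≤ (1 / 2) ^ 1 :=
              pow_le_pow_of_le_one (by norm_num) (by norm_num) (by omega)
          _ = _ := by norm_num
      have hPR : ∀ w : ℂ, ‖w‖ ≤ R → ‖(P n).eval w‖ ≤ F + x n := by
        intro w hw
        have e : (P n).eval w = f w - (f w - (P n).eval w) := by ring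
        rw [e]
        exact (norm_sub_le _ _).trans (add_le_add (hF w (hw.trans hRT.le)) (hx1 n w hw))
      have hPT := ov_bernstein R T hR hRT n (P n) (hP n) _ hPR hT1
      have hgT : ∀ w : ℂ, ‖w‖ ≤ T → ‖f w - (P n).eval w‖ ≤ F + μ ^ n * (F + x n) := fun w hw =>
        (norm_sub_le _ _).trans (add_le_add (hF w hw) (hPT w hw))
      have := hx2 n _ (hq (N n) (z n) _ (h n) _ (hz n) (hh n) (hfac n) hgT)
      have hqn : 0 < q ^ N n := by positivity
      have a1 : q ^ N n * μ ^ n ≤ (1 / 2) ^ n := by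
        refine le_trans ?_ hn
        rw [mul_comm]
        gcongr
        omega
      have a2 : q ^ N n ≤ (1 / 2) ^ n := by
        refine le_trans ?_ a1
        exact le_mul_of_one_le_right hqn.le (one_le_pow₀ hμ1)
      have b1 := mul_le_mul_of_nonneg_right a2 hF0
      have b2 := mul_le_mul_of_nonneg_right a1 (add_nonneg hF0 (hx0 n))
      have b3 := mul_le_mul_of_nonneg_right hd1 (hx0 n)
      nlinarith
    refine squeeze_zero' (Eventually.of_forall hx0) hb ?_
    have := (tendsto_pow_atTop_nhds_zero_of_lt_one (r := (1 / 2 : ℝ)) (by norm_num)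
      (by norm_num)).const_mul (4 * F)
    simpa using this
  -- comparison of consecutive errors
  obtain ⟨q, hq0, hq1, hq⟩ := ov_schwarz r r R hr0 hr0 hrR hrR hR1
  set μ := R / r with hμ
  have hμ1 : 1 ≤ μ := by rw [hμ, one_le_div hr0]; exact hrR.le
  obtain ⟨n1, hn1⟩ := eventually_atTop.1 (ov_ev N hN q μ hq0 hq1 hμ1)
  set n0 := max n1 1 with hn0
  have hcmp : ∀ n ≥ n0, x n ≤ x (n + 1) + (1 / 2) ^ n * (x n + x (n + 1)) := by
    intro n hn
    have hn' : n1 ≤ n := (le_max_left _ _).trans hn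
    have a1 := hn1 n hn'
    have a2 : μ ^ (n + 1) * q ^ N (n + 1) ≤ (1 / 2) ^ n := by
      calc _ ≤ μ ^ (n + 1 + 1) * q ^ N (n + 1) := by
            gcongr
            omega
        _ ≤ (1 / 2) ^ (n + 1) := hn1 (n + 1) (by omega)
        _ ≤ _ := pow_le_pow_of_le_one (by norm_num) (by norm_num) (by omega)
    have c1 := hq (N n) (z n) _ (h n) _ (hz n) (hh n) (hfac n) (hx1 n)
    have c2 := hq (N (n + 1)) (z (n + 1)) _ (h (n + 1)) _ (hz (n + 1)) (hh (n + 1))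
      (hfac (n + 1)) (hx1 (n + 1))
    have hD : ∀ w : ℂ, ‖w‖ ≤ r → ‖(P (n + 1) - P n).eval w‖ ≤
        q ^ N n * x n + q ^ N (n + 1) * x (n + 1) := by
      intro w hw
      have e : (P (n + 1) - P n).eval w
          = (f w - (P n).eval w) - (f w - (P (n + 1)).eval w) := by
        rw [Polynomial.eval_sub]; ring
      rw [e]
      exact (norm_sub_le _ _).trans (add_le_add (c1 w hw) (c2 w hw))
    have hdeg : (P (n + 1) - P n).degree ≤ ((n + 1 : ℕ) : WithBot ℕ) := by
      refine (Polynomial.degree_sub_le _ _).trans (max_le (hP (n + 1)) ((hP n).trans ?_))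
      exact_mod_cast Nat.le_succ n
    have hDR := ov_bernstein r R hr0 hrR (n + 1) _ hdeg _ hD hR1
    refine hx2 n _ fun w hw => ?_
    have e : f w - (P n).eval w
        = (f w - (P (n + 1)).eval w) + (P (n + 1) - P n).eval w := by
      rw [Polynomial.eval_sub]; ring
    rw [e]
    refine (norm_add_le _ _).trans (add_le_add (hx1 (n + 1) w hw) ((hDR w hw).trans ?_))
    have b1 := mul_le_mul_of_nonneg_right a1 (hx0 n)
    have b2 := mul_le_mul_of_nonneg_right a2 (hx0 (n + 1))
    calc _ = μ ^ (n + 1) * q ^ N n * x n + μ ^ (n + 1) * q ^ N (n + 1) * x (n + 1) := by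
          rw [← hμ]; ring
      _ ≤ _ := by linarith
  have hz0 := ov_seq x n0 (le_max_right _ _) hx0 hcmp hlim
  refine ⟨P n0, ?_⟩
  have hA1 : AnalyticOnNhd ℂ f (ball (0 : ℂ) 1) := hf.analyticOnNhd isOpen_ball
  have hA2 : AnalyticOnNhd ℂ (fun w => (P n0).eval w) (ball (0 : ℂ) 1) :=
    (P n0).differentiable.differentiableOn.analyticOnNhd isOpen_ball
  refine hA1.eqOn_of_preconnected_of_eventuallyEq hA2 (convex_ball _ _).isPreconnected
    (z₀ := 0) (by simp) ?_
  filter_upwards [ball_mem_nhds (0 : ℂ) hR] with w hw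
  have hw' : ‖w‖ ≤ R := by
    have : ‖w‖ < R := by simpa using hw
    exact this.le
  have := (hx1 n0 w hw').trans hz0
  exact sub_eq_zero.1 (norm_le_zero_iff.1 this)
end

section
/- Let f be holomorphic on the unit disk, 0 < r < 1, and suppose for each n there exist polynomials P_n of degree ≤ n and Q_n(z) = α_n z - 1 (or Q_n(z) = z) with Q_n f - P_n having at least N(n) zeros in the closed disk of radius r, where N(n)/n → ∞. If f extends holomorphically to the disk of radius s (1 ≤ s ≤ ∞) and liminf_n |α_n| > 1/s, then f is a polynomial. -/
open Metric Filter Polynomial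

lemma maxmod {g : ℂ → ℂ} (hg : DifferentiableOn ℂ g (ball (0:ℂ) 1)) {ρ M : ℝ} (h0 : 0 < ρ)
    (h1 : ρ < 1) (hM : ∀ w : ℂ, ‖w‖ = ρ → ‖g w‖ ≤ M) (w : ℂ) (hw : ‖w‖ ≤ ρ) : ‖g w‖ ≤ M := by
  have hcl : closure (ball (0:ℂ) ρ) = closedBall 0 ρ := closure_ball _ h0.ne'
  apply Complex.norm_le_of_forall_mem_frontier_norm_le (U := ball (0:ℂ) ρ) isBounded_ball
  · apply DifferentiableOn.diffContOnCl
    rw [hcl]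
    exact hg.mono (closedBall_subset_ball h1)
  · intro z hz
    rw [frontier_ball _ h0.ne'] at hz
    exact hM z (by simpa using hz)
  · rw [hcl]; simpa using hw

lemma pbound {r ρ : ℝ} (hr : 0 < r) (hρ : r < ρ) (h1 : ρ < 1) (n : ℕ) :
    ∀ (q h : ℂ → ℂ) (P : ℂ[X]) (z : Fin n → ℂ) (M : ℝ),
      DifferentiableOn ℂ h (ball (0:ℂ) 1) → (∀ w : ℂ, ‖w‖ ≤ ρ → ‖q w‖ ≤ M) →
      P.degree < n → (∀ i, ‖z i‖ ≤ r) →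
      (∀ w ∈ ball (0:ℂ) 1, q w - P.eval w = (∏ i, (w - z i)) * h w) →
      ∀ w : ℂ, ‖w‖ ≤ ρ → ‖P.eval w‖ ≤ (1 + 4 / (ρ - r)) ^ n * M := by
  have hd : 0 < ρ - r := by linarith
  induction n with
  | zero =>
    intro q h P z M hh hq hP hz heq w hw
    have : P = 0 := by
      rw [← Polynomial.degree_eq_bot]
      simpa using hP
    have := (norm_nonneg _).trans (hq w hw)
    subst P
    simpa using this
  | succ n ih =>
    intro q h P z M hh hq hP hz heq w hw
    have hz0 : ‖z 0‖ ≤ r := hz 0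
    have hb : q (z 0) = P.eval (z 0) := by
      have := heq (z 0) (by simp; linarith)
      rw [Fin.prod_univ_succ] at this
      simp at this
      exact sub_eq_zero.mp this
    have hM0 : 0 ≤ M := (norm_nonneg _).trans (hq w hw)
    set P1 := P /ₘ (X - C (z 0)) with hP1
    have hPe : ∀ w, P.eval w = (w - z 0) * P1.eval w + P.eval (z 0) := by
      intro w
      have := congrArg (Polynomial.eval w) (Polynomial.modByMonic_add_div P (X - C (z 0)))
      rw [Polynomial.modByMonic_X_sub_C_eq_C_eval] at this
      simp at this
      rw [← this]; ring
    have hdeg : P1.degree < n := by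
      rw [hP1]
      by_cases hP0 : P.degree < 1
      · have : P /ₘ (X - C (z 0)) = 0 := by
          rw [Polynomial.divByMonic_eq_zero_iff (monic_X_sub_C _)]
          simpa using hP0
        rw [this]; simp
      · push Not at hP0
        have := Polynomial.degree_add_divByMonic (monic_X_sub_C (z 0)) (p := P) (by simpa using hP0)
        rw [degree_X_sub_C] at this
        rw [← this] at hP
        by_cases h00 : P /ₘ (X - C (z 0)) = 0
        · rw [h00]; simp
        rw [Polynomial.degree_eq_natDegree h00] at hP ⊢
        norm_cast at hP ⊢
        omega
    set q1 : ℂ → ℂ := fun w => P1.eval w + (∏ i : Fin n, (w - z i.succ)) * h w with hq1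
    have hq1d : DifferentiableOn ℂ q1 (ball (0:ℂ) 1) := by
      apply DifferentiableOn.add P1.differentiable.differentiableOn
      apply DifferentiableOn.mul _ hh
      fun_prop
    have hq1e : ∀ w ∈ ball (0:ℂ) 1, (w - z 0) * q1 w = q w - q (z 0) := by
      intro w hw
      have h2 := heq w hw
      rw [Fin.prod_univ_succ] at h2
      rw [hb, hq1]
      linear_combination (-1 : ℂ) * h2 - hPe w
    have hq1b : ∀ w : ℂ, ‖w‖ ≤ ρ → ‖q1 w‖ ≤ 2 * M / (ρ - r) := by
      apply maxmod hq1d (by linarith) h1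
      intro w hw
      have h2 := congrArg norm (hq1e w (by simp; linarith))
      rw [norm_mul] at h2
      have h3 : ‖q w - q (z 0)‖ ≤ M + M :=
        (norm_sub_le _ _).trans (add_le_add (hq w hw.le) (hq _ (by linarith)))
      have h4 : ρ - r ≤ ‖w - z 0‖ := by
        have := norm_sub_norm_le w (z 0)
        linarith
      rw [le_div_iff₀ hd]
      nlinarith [norm_nonneg (q1 w)]
    have h5 := ih q1 h P1 (fun i => z i.succ) _ hh hq1b hdeg (fun i => hz _)
      (by intro w _; simp [hq1]) w hw
    rw [hPe w]
    have h6 : ‖w - z 0‖ ≤ 2 := (norm_sub_le _ _).trans (by linarith)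
    have h7 : ‖P.eval (z 0)‖ ≤ M := by rw [← hb]; exact hq _ (by linarith)
    have hC : 1 ≤ (1 + 4 / (ρ - r)) ^ n := one_le_pow₀ (by
      have : 0 < 4 / (ρ - r) := by positivity
      linarith)
    calc _ ≤ ‖w - z 0‖ * ‖P1.eval w‖ + ‖P.eval (z 0)‖ := by
            rw [← norm_mul]; exact norm_add_le _ _
      _ ≤ 2 * ((1 + 4 / (ρ - r)) ^ n * (2 * M / (ρ - r))) + M := by
            gcongr
      _ ≤ 2 * ((1 + 4 / (ρ - r)) ^ n * (2 * M / (ρ - r))) + (1 + 4 / (ρ - r)) ^ n * M := by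
            gcongr; nlinarith
      _ = _ := by rw [pow_succ]; ring

lemma blaschke_s11 {r ρ ρ₀ : ℝ} (hr : 0 < r) (hρ : r < ρ) (h1 : ρ < 1) (h00 : 0 < ρ₀) (h0r : ρ₀ ≤ ρ)
    (N : ℕ) (g h : ℂ → ℂ) (z : Fin N → ℂ) (M : ℝ)
    (hh : DifferentiableOn ℂ h (ball (0:ℂ) 1)) (hg : ∀ w : ℂ, ‖w‖ ≤ ρ → ‖g w‖ ≤ M)
    (hz : ∀ i, ‖z i‖ ≤ r)
    (heq : ∀ w ∈ ball (0:ℂ) 1, g w = (∏ i, (w - z i)) * h w)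
    (w : ℂ) (hw : ‖w‖ ≤ ρ₀) : ‖g w‖ ≤ M * (ρ * (ρ₀ + r) / (ρ ^ 2 - r * ρ₀)) ^ N := by
  have hρ0 : 0 < ρ := by linarith
  have hden : 0 < ρ ^ 2 - r * ρ₀ := by nlinarith
  set G : ℂ → ℂ := fun w => (∏ i, (((ρ:ℂ) ^ 2 - (starRingEnd ℂ) (z i) * w) / ρ)) * h w with hG
  have hGd : DifferentiableOn ℂ G (ball (0:ℂ) 1) := by
    apply DifferentiableOn.mul _ hh
    fun_prop
  have hGb : ∀ w : ℂ, ‖w‖ ≤ ρ → ‖G w‖ ≤ M := by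
    apply maxmod hGd hρ0 h1
    intro w hw
    have h2 : ‖G w‖ = ‖g w‖ := by
      rw [heq w (by simp; linarith), hG]
      simp only [norm_mul, norm_prod]
      congr 1
      apply Finset.prod_congr rfl
      intro i _
      have h3 : (ρ:ℂ) ^ 2 = w * (starRingEnd ℂ) w := by
        rw [Complex.mul_conj, Complex.normSq_eq_norm_sq, hw]; push_cast; rfl
      have h4 : (ρ:ℂ) ^ 2 - (starRingEnd ℂ) (z i) * w = w * (starRingEnd ℂ) (w - z i) := by
        rw [h3, map_sub]; ring
      rw [h4, norm_div, norm_mul, RCLike.norm_conj, hw, Complex.norm_real, Real.norm_of_nonneg hρ0.le]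
      field_simp
    rw [h2]; exact hg w hw.le
  have hfac : ∀ i, ‖w - z i‖ ≤ (ρ * (ρ₀ + r) / (ρ ^ 2 - r * ρ₀)) *
      ‖((ρ:ℂ) ^ 2 - (starRingEnd ℂ) (z i) * w) / ρ‖ := by
    intro i
    have h3 : ‖w - z i‖ ≤ ρ₀ + r := (norm_sub_le _ _).trans (add_le_add hw (hz i))
    have h4 : ρ ^ 2 - r * ρ₀ ≤ ‖(ρ:ℂ) ^ 2 - (starRingEnd ℂ) (z i) * w‖ := by
      have h5 := norm_sub_norm_le ((ρ:ℂ) ^ 2) ((starRingEnd ℂ) (z i) * w)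
      rw [norm_pow, norm_mul, RCLike.norm_conj, Complex.norm_real, Real.norm_of_nonneg hρ0.le] at h5
      have : ‖z i‖ * ‖w‖ ≤ r * ρ₀ := mul_le_mul (hz i) hw (norm_nonneg _) hr.le
      linarith
    rw [norm_div, Complex.norm_real, Real.norm_of_nonneg hρ0.le]
    refine h3.trans ?_
    rw [div_mul_div_comm, le_div_iff₀ (by positivity)]
    have := mul_le_mul_of_nonneg_left h4 (show 0 ≤ ρ * (ρ₀ + r) by positivity)
    linarith
  rw [heq w (by simp; linarith), norm_mul, norm_prod]
  calc _ ≤ (∏ i, ((ρ * (ρ₀ + r) / (ρ ^ 2 - r * ρ₀)) *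
      ‖((ρ:ℂ) ^ 2 - (starRingEnd ℂ) (z i) * w) / ρ‖)) * ‖h w‖ := by
        gcongr with i _
        exact hfac i
    _ = (ρ * (ρ₀ + r) / (ρ ^ 2 - r * ρ₀)) ^ N * ‖G w‖ := by
        rw [Finset.prod_mul_distrib, hG, norm_mul, norm_prod, Finset.prod_const, Finset.card_univ, Fintype.card_fin, mul_assoc]
    _ ≤ _ := by
        rw [mul_comm]
        gcongr
        exact hGb w (by linarith)

lemma coeffbound (v : ℕ → ℂ) (g : ℂ → ℂ) (hv : ∀ w ∈ ball (0:ℂ) 1, HasSum (fun k => v k * w ^ k) (g w))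
    {ρ₀ M : ℝ} (h0 : 0 < ρ₀) (h1 : ρ₀ < 1) (hM : ∀ w : ℂ, ‖w‖ ≤ ρ₀ → ‖g w‖ ≤ M) (k : ℕ) :
    ‖v k‖ ≤ M / ρ₀ ^ k := by
  have hp : HasFPowerSeriesOnBall g (FormalMultilinearSeries.ofScalars ℂ v) 0 1 := by
    refine ⟨?_, by simp, ?_⟩
    · apply ENNReal.le_of_forall_nnreal_lt
      intro x hx
      apply FormalMultilinearSeries.le_radius_of_tendsto (l := 0)
      have := (hv (x:ℂ) (by simpa using hx)).summable.tendsto_atTop_zero.norm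
      simpa [FormalMultilinearSeries.ofScalars_norm] using this
    · intro y hy
      have := hv y (by simpa [← ofReal_norm, edist_dist] using hy)
      simpa [FormalMultilinearSeries.ofScalars_apply_eq, mul_comm] using this
  have hd : DifferentiableOn ℂ g (ball (0:ℂ) 1) := by
    have := hp.differentiableOn
    rwa [← ENNReal.ofReal_one, Metric.eball_ofReal] at this
  have h3 := hp.factorial_smul (1:ℂ) k
  have h4 := Complex.norm_iteratedDeriv_le_of_forall_mem_sphere_norm_le (f := g) (c := 0) k h0 (C := M)
    (by
      apply DifferentiableOn.diffContOnCl
      rw [closure_ball _ h0.ne']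
      exact hd.mono (closedBall_subset_ball h1))
    (fun z hz => hM z (by simpa using (mem_sphere.mp hz).le))
  rw [iteratedDeriv_eq_iteratedFDeriv] at h4
  rw [← h3] at h4
  simp at h4
  have : (0:ℝ) < k.factorial := by exact_mod_cast k.factorial_pos
  rw [mul_div_assoc] at h4
  exact le_of_mul_le_mul_left h4 this

lemma hsc {a b : ℕ → ℂ} {x y : ℂ} (h : HasSum a x) (hab : ∀ k, b k = a k) (hxy : y = x) :
    HasSum b y := by
  have : b = a := funext hab
  rw [this, hxy]; exact h

lemma stepB {r ρ : ℝ} (hr : 0 < r) (hρ : r < ρ) (h1 : ρ < 1) :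
    ∃ C θ ρ₀ : ℝ, 1 ≤ C ∧ 0 < θ ∧ θ < 1 ∧ 0 < ρ₀ ∧ ρ₀ < 1 ∧
    ∀ (u : ℕ → ℂ) (f h : ℂ → ℂ) (β : ℂ) (t S : ℝ) (P : ℂ[X]) (n N : ℕ) (z : Fin N → ℂ),
      (∀ w ∈ ball (0:ℂ) 1, HasSum (fun k => u k * w ^ k) (f w)) → ‖β‖ ≤ t →
      P.degree ≤ n → n < N → (∀ i, ‖z i‖ ≤ r) → DifferentiableOn ℂ h (ball (0:ℂ) 1) →
      Summable (fun k => ‖u k‖ * ρ ^ k) → ∑' k, ‖u k‖ * ρ ^ k ≤ S →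
      (∀ w ∈ ball (0:ℂ) 1, (w - β) * f w - P.eval w = (∏ i, (w - z i)) * h w) →
      ∀ k, n ≤ k → ‖u k - β * u (k+1)‖ ≤ (1 + t) * S * (1 + C ^ (n+1)) * θ ^ N / ρ₀ ^ (k+1) := by
  have hρ0 : 0 < ρ := by linarith
  have hd : 0 < ρ - r := by linarith
  set ρ₀ := ρ * (ρ - r) / (2 * (ρ + r)) with hρ₀
  have h00 : 0 < ρ₀ := by positivity
  have h0e : ρ₀ * (2 * (ρ + r)) = ρ * (ρ - r) := by rw [hρ₀]; field_simp
  have h0r : ρ₀ ≤ ρ := by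
    by_contra hc
    push Not at hc
    nlinarith
  have hden : 0 < ρ ^ 2 - r * ρ₀ := by nlinarith
  refine ⟨1 + 4 / (ρ - r), ρ * (ρ₀ + r) / (ρ ^ 2 - r * ρ₀), ρ₀, ?_, by positivity, ?_, h00,
    by linarith, ?_⟩
  · have : 0 < 4 / (ρ - r) := by positivity
    linarith
  · rw [div_lt_one hden]
    nlinarith
  intro u f h β t S P n N z hu hβ hP hnN hz hh hsum hS heq k hk
  have hfb : ∀ w : ℂ, ‖w‖ ≤ ρ → ‖f w‖ ≤ S := by
    intro w hw
    have h2 := hu w (by simp; linarith)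
    rw [← h2.tsum_eq]
    refine le_trans ?_ hS
    apply tsum_of_norm_bounded hsum.hasSum
    intro i
    rw [norm_mul, norm_pow]
    gcongr
  have ht : 0 ≤ t := (norm_nonneg _).trans hβ
  have hqb : ∀ w : ℂ, ‖w‖ ≤ ρ → ‖(w - β) * f w‖ ≤ (1 + t) * S := by
    intro w hw
    rw [norm_mul]
    have h3 : ‖w - β‖ ≤ 1 + t := (norm_sub_le _ _).trans (by linarith)
    exact mul_le_mul h3 (hfb w hw) (norm_nonneg _) (by linarith)
  have hPb : ∀ w : ℂ, ‖w‖ ≤ ρ → ‖P.eval w‖ ≤ (1 + 4 / (ρ - r)) ^ (n+1) * ((1 + t) * S) := by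
    obtain ⟨e, he⟩ := Nat.exists_eq_add_of_le hnN
    change N = n + 1 + e at he
    subst he
    apply pbound hr hρ h1 (n+1) (fun w => (w - β) * f w)
      (fun w => (∏ i : Fin e, (w - z (Fin.natAdd (n+1) i))) * h w) P
      (fun i => z (Fin.castAdd e i)) _ _ hqb
    · refine lt_of_le_of_lt hP ?_
      exact_mod_cast Nat.lt_succ_self n
    · exact fun i => hz _
    · intro w hw
      rw [heq w hw, Fin.prod_univ_add, mul_assoc]
    · apply DifferentiableOn.mul _ hh
      fun_prop
  have hgb := blaschke_s11 hr hρ h1 h00 h0r N (fun w => (w - β) * f w - P.eval w) h z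
    ((1 + t) * S + (1 + 4 / (ρ - r)) ^ (n+1) * ((1 + t) * S)) hh
    (fun w hw => (norm_sub_le _ _).trans (add_le_add (hqb w hw) (hPb w hw))) hz heq
  have hv : ∀ w ∈ ball (0:ℂ) 1, HasSum (fun k =>
      ((if k = 0 then 0 else u (k-1)) - β * u k - P.coeff k) * w ^ k)
      ((w - β) * f w - P.eval w) := by
    intro w hw
    have a1 := hu w hw
    have a2 : HasSum (fun k => (if k = 0 then 0 else u (k-1)) * w ^ k) (w * f w) := by
      rw [← hasSum_nat_add_iff' 1]
      simp
      refine hsc (a1.mul_left w) (fun k => ?_) rfl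
      ring
    have a3 : HasSum (fun k => P.coeff k * w ^ k) (P.eval w) := by
      rw [Polynomial.eval_eq_sum_range]
      apply hasSum_sum_of_ne_finset_zero
      intro b hb
      rw [Polynomial.coeff_eq_zero_of_natDegree_lt (by simpa [Nat.lt_succ_iff] using hb)]
      simp
    refine hsc ((a2.sub (a1.mul_left β)).sub a3) (fun k => ?_) ?_
    · ring
    · ring
  have := coeffbound _ _ hv h00 (by linarith) hgb (k+1)
  have hc : P.coeff (k+1) = 0 := Polynomial.coeff_eq_zero_of_degree_lt
    (lt_of_le_of_lt hP (by exact_mod_cast Nat.lt_succ_of_le hk))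
  simp only [hc, Nat.add_sub_cancel, Nat.succ_ne_zero, if_false, sub_zero] at this
  refine this.trans (le_of_eq ?_)
  ring

lemma stepB' {r ρ : ℝ} (hr : 0 < r) (hρ : r < ρ) (h1 : ρ < 1) :
    ∃ C θ ρ₀ : ℝ, 1 ≤ C ∧ 0 < θ ∧ θ < 1 ∧ 0 < ρ₀ ∧ ρ₀ < 1 ∧
    ∀ (u : ℕ → ℂ) (f h : ℂ → ℂ) (β : ℂ) (t R : ℝ) (P : ℂ[X]) (n N : ℕ) (z : Fin N → ℂ),
      (∀ w ∈ ball (0:ℂ) 1, HasSum (fun k => u k * w ^ k) (f w)) → ‖β‖ ≤ t →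
      P.degree ≤ n → n < N → (∀ i, ‖z i‖ ≤ r) → DifferentiableOn ℂ h (ball (0:ℂ) 1) → ρ ≤ R →
      Summable (fun k => ‖u k‖ * R ^ k) →
      (∀ w ∈ ball (0:ℂ) 1, (w - β) * f w - P.eval w = (∏ i, (w - z i)) * h w) →
      ∀ k, n ≤ k → ‖u k - β * u (k+1)‖ ≤
        (1 + t) * ((∑' k, ‖u k‖ * R ^ k) / R ^ n) * (1 + C ^ (n+1)) * θ ^ N / ρ₀ ^ (k+1) := by
  obtain ⟨C, θ, ρ₀, hC, hθ, hθ1, h0, h01, H⟩ := stepB hr hρ h1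
  refine ⟨C, θ, ρ₀, hC, hθ, hθ1, h0, h01, ?_⟩
  intro u f h β t R P n N z hu hβ hP hnN hz hh hR hsum heq k hk
  have hρ0 : 0 < ρ := by linarith
  have hR0 : 0 < R := by linarith
  set T : ℂ[X] := ∑ i ∈ Finset.range n, Polynomial.C (u i) * X ^ i with hT
  have hTe : ∀ w, T.eval w = ∑ i ∈ Finset.range n, u i * w ^ i := by
    intro w; simp [hT, Polynomial.eval_finsetSum]
  have hTd : T.degree < n := by
    rw [← Polynomial.mem_degreeLT, hT]
    apply Submodule.sum_mem
    intro i hi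
    rw [Polynomial.mem_degreeLT]
    refine lt_of_le_of_lt (Polynomial.degree_C_mul_X_pow_le i (u i)) ?_
    exact_mod_cast Finset.mem_range.mp hi
  have hle : ∀ k, ‖(if k < n then 0 else u k)‖ * ρ ^ k ≤ ‖u k‖ * R ^ k / R ^ n := by
    intro k
    split_ifs with hkn
    · simp; positivity
    · push Not at hkn
      obtain ⟨e, rfl⟩ := Nat.exists_eq_add_of_le hkn
      have e1 : ‖u (n+e)‖ * R ^ (n+e) / R ^ n = ‖u (n+e)‖ * R ^ e := by
        rw [pow_add]; field_simp
      rw [e1, pow_add]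
      gcongr
      calc ρ ^ n * ρ ^ e ≤ 1 * R ^ e := by
            gcongr
            exact pow_le_one₀ hρ0.le h1.le
        _ = _ := one_mul _
  have hs' : Summable (fun k => ‖(if k < n then 0 else u k)‖ * ρ ^ k) :=
    Summable.of_nonneg_of_le (fun k => by positivity) hle (hsum.div_const _)
  have := H (fun k => if k < n then 0 else u k) (fun w => f w - T.eval w) h β t
    ((∑' k, ‖u k‖ * R ^ k) / R ^ n) (P - (X - Polynomial.C β) * T) n N z ?_ hβ ?_ hnN hz hh hs' ?_ ?_ k hk
  · simpa [not_lt.mpr hk, show ¬ (k + 1 < n) by omega] using this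
  · intro w hw
    rw [hTe]
    have a3 : HasSum (fun k => if k < n then u k * w ^ k else 0) (∑ i ∈ Finset.range n, u i * w ^ i) := by
      have : ∑ i ∈ Finset.range n, u i * w ^ i = ∑ i ∈ Finset.range n, (if i < n then u i * w ^ i else 0) := by
        apply Finset.sum_congr rfl
        intro i hi
        rw [if_pos (Finset.mem_range.mp hi)]
      rw [this]
      apply hasSum_sum_of_ne_finset_zero
      intro b hb
      rw [if_neg (by simpa using hb)]
    refine hsc ((hu w hw).sub a3) (fun k => ?_) rfl
    split_ifs <;> simp
  · refine (Polynomial.degree_sub_le _ _).trans (max_le hP ?_)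
    rw [Polynomial.degree_mul, Polynomial.degree_X_sub_C]
    by_cases hT0 : T = 0
    · rw [hT0]; simp
    rw [Polynomial.degree_eq_natDegree hT0] at hTd ⊢
    norm_cast at hTd ⊢
    omega
  · rw [← tsum_div_const]
    exact hs'.tsum_le_tsum hle (hsum.div_const _)
  · intro w hw
    simp only [eval_sub, eval_mul, eval_X, eval_C]
    rw [← heq w hw]; ring

set_option maxHeartbeats 1600000 in
lemma stepC {r ρ t t' : ℝ} (hr : 0 < r) (hρ : r < ρ) (h1 : ρ < 1) (ht : 0 < t) (htt : t < t')
    (hρt : ρ ≤ t') (u : ℕ → ℂ) (f : ℂ → ℂ)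
    (hu : ∀ w ∈ ball (0:ℂ) 1, HasSum (fun k => u k * w ^ k) (f w))
    (N : ℕ → ℕ) (hN : Tendsto (fun n : ℕ => (N n : ℝ) / (n : ℝ)) atTop atTop)
    (hint : ∀ᶠ n : ℕ in atTop, ∃ β : ℂ, ‖β‖ ≤ t ∧ ∃ P : Polynomial ℂ, P.degree ≤ (n : ℕ) ∧
      ∃ z : Fin (N n) → ℂ, (∀ i, ‖z i‖ ≤ r) ∧
        ∃ h : ℂ → ℂ, DifferentiableOn ℂ h (ball (0 : ℂ) 1) ∧
          ∀ w ∈ ball (0 : ℂ) 1, (w - β) * f w - P.eval w = (∏ i, (w - z i)) * h w)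
    (A : ℝ) (hA : 0 < A) :
    ∃ d : ℕ, ∀ n ≥ d, ∀ R ≥ t', Summable (fun k => ‖u k‖ * R ^ k) →
      ‖u n‖ * (A * R) ^ n ≤ ∑' k, ‖u k‖ * R ^ k := by
  obtain ⟨C, θ, ρ₀, hC, hθ, hθ1, h0, h01, H⟩ := stepB' hr hρ h1
  have ht' : 0 < t' := by linarith
  set T := max t 1 with hTdef
  have hT1 : 1 ≤ T := le_max_right _ _
  have htT : t ≤ T := le_max_left _ _
  set D := 2 * T / ρ₀ with hD
  have hD0 : 0 < D := by positivity
  obtain ⟨p, hp⟩ : ∃ p : ℕ, θ ^ p < 1 / 2 / D := exists_pow_lt_of_lt_one (by positivity) hθ1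
  have hp' : θ ^ (p+1) * D ≤ 1 / 2 := by
    have : θ ^ (p+1) ≤ θ ^ p := pow_le_pow_of_le_one hθ.le hθ1.le (Nat.le_succ p)
    have h2 := (lt_div_iff₀ hD0).mp hp
    nlinarith
  set l := max (t / t') (1/2) with hl
  have hl0 : 0 < l := lt_of_lt_of_le (by norm_num) (le_max_right _ _)
  have hl1 : l < 1 := max_lt (by rw [div_lt_one ht']; exact htt) (by norm_num)
  set G := 1 + (1 + t) * (2 * C) / ρ₀ with hG
  have hG1 : 1 ≤ G := by
    have : 0 ≤ (1 + t) * (2 * C) / ρ₀ := by positivity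
    linarith
  obtain ⟨L, hL⟩ : ∃ L : ℕ, l ^ L < 1 / (2 * G ^ 2 * A) := exists_pow_lt_of_lt_one (by positivity) hl1
  have hNe := hN.eventually_ge_atTop (((L + 1) * (p + 1) + 1 : ℕ) : ℝ)
  obtain ⟨d, hd⟩ := eventually_atTop.mp (hint.and (hNe.and (eventually_ge_atTop 1)))
  refine ⟨d, ?_⟩
  intro n hn R hR hsum
  obtain ⟨⟨β, hβ, P, hP, z, hz, h, hh, heq⟩, hNn, hn1⟩ := hd n hn
  have hn0 : (0:ℝ) < n := by exact_mod_cast hn1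
  rw [le_div_iff₀ hn0] at hNn
  have hNn' : ((L + 1) * (p + 1) + 1) * n ≤ N n := by exact_mod_cast hNn
  have hnN : n < N n := by
    have : n ≤ (L+1) * (p+1) * n := Nat.le_mul_of_pos_left _ (by positivity)
    linarith
  have hR0 : 0 < R := by linarith
  have Hk := H u f h β t R P n (N n) z hu hβ hP hnN hz hh (by linarith) hsum heq
  set S := ∑' k, ‖u k‖ * R ^ k with hS
  have hS0 : 0 ≤ S := tsum_nonneg (fun k => by positivity)
  set m := N n / (p + 1) with hm
  have hm1 : L * n ≤ m := by
    rw [hm, Nat.le_div_iff_mul_le (by omega)]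
    nlinarith
  have hm2 : (p + 1) * m ≤ N n := Nat.mul_div_le _ _
  set E := (1 + t) * (S / R ^ n) * (1 + C ^ (n+1)) * θ ^ (N n) / ρ₀ ^ (n+m) with hE
  have hE0 : 0 ≤ E := by positivity
  have hind : ∀ j ≤ m, ‖u n‖ ≤ t ^ j * ‖u (n+j)‖ + j * T ^ j * E := by
    intro j
    induction j with
    | zero => intro _; simp
    | succ j ih =>
      intro hj
      have i1 := ih (by omega)
      have i2 : ‖u (n+j) - β * u (n+j+1)‖ ≤ E := by
        refine (Hk (n+j) (by omega)).trans ?_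
        rw [hE]
        apply div_le_div_of_nonneg_left (by positivity) (by positivity)
        exact pow_le_pow_of_le_one h0.le h01.le (by omega)
      have i3 : ‖u (n+j)‖ ≤ t * ‖u (n+j+1)‖ + E := by
        calc ‖u (n+j)‖ = ‖β * u (n+j+1) + (u (n+j) - β * u (n+j+1))‖ := by congr 1; ring
          _ ≤ ‖β * u (n+j+1)‖ + ‖u (n+j) - β * u (n+j+1)‖ := norm_add_le _ _
          _ ≤ _ := by rw [norm_mul]; gcongr
      have i4 : t ^ j ≤ T ^ (j+1) :=
        (pow_le_pow_left₀ ht.le htT j).trans (pow_le_pow_right₀ hT1 (by omega))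
      have i5 : T ^ j ≤ T ^ (j+1) := pow_le_pow_right₀ hT1 (by omega)
      calc ‖u n‖ ≤ t ^ j * ‖u (n+j)‖ + j * T ^ j * E := i1
        _ ≤ t ^ j * (t * ‖u (n+j+1)‖ + E) + j * T ^ j * E := by gcongr
        _ = t ^ (j+1) * ‖u (n+j+1)‖ + (t ^ j * E + j * T ^ j * E) := by ring
        _ ≤ t ^ (j+1) * ‖u (n+j+1)‖ + (T ^ (j+1) * E + j * T ^ (j+1) * E) := by gcongr
        _ = _ := by push_cast; rw [← add_assoc n j 1]; ring
  have hfin := hind m le_rfl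
  have f1 : t ^ m * ‖u (n+m)‖ * R ^ n ≤ S * l ^ m := by
    have g1 : ‖u (n+m)‖ * R ^ (n+m) ≤ S :=
      hsum.le_tsum (n+m) (fun k _ => by positivity)
    have g2 : t / R ≤ l := (div_le_div_of_nonneg_left ht.le ht' hR).trans (le_max_left _ _)
    calc t ^ m * ‖u (n+m)‖ * R ^ n = (‖u (n+m)‖ * R ^ (n+m)) * (t / R) ^ m := by
          rw [div_pow, pow_add]; field_simp
      _ ≤ S * l ^ m := by gcongr
  have f2 : m * T ^ m * E * R ^ n ≤ S * l ^ m * G ^ (n+1) := by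
    have g1 : (m:ℝ) ≤ 2 ^ m := by exact_mod_cast (Nat.lt_two_pow_self).le
    have g2 : θ ^ (N n) * D ^ m ≤ l ^ m := by
      calc θ ^ (N n) * D ^ m ≤ θ ^ ((p+1) * m) * D ^ m := by
            gcongr ?_ * _
            exact pow_le_pow_of_le_one hθ.le hθ1.le hm2
        _ = (θ ^ (p+1) * D) ^ m := by rw [pow_mul, mul_pow]
        _ ≤ l ^ m := by
            gcongr
            exact hp'.trans (le_max_right _ _)
    have g3 : (1 + t) * (1 + C ^ (n+1)) / ρ₀ ^ n ≤ G ^ (n+1) := by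
      have k1 : (1 + t) ≤ (1 + t) ^ (n+1) := le_self_pow₀ (by linarith) (by omega)
      have k2 : (2:ℝ) ≤ 2 ^ (n+1) := le_self_pow₀ (by norm_num) (by omega)
      have k3 : 1 ≤ C ^ (n+1) := one_le_pow₀ hC
      have k4 : 1 + C ^ (n+1) ≤ (2 * C) ^ (n+1) := by
        rw [mul_pow]; nlinarith
      have k5 : ρ₀ ^ (n+1) ≤ ρ₀ ^ n := pow_le_pow_of_le_one h0.le h01.le (by omega)
      calc (1 + t) * (1 + C ^ (n+1)) / ρ₀ ^ n ≤ (1 + t) ^ (n+1) * (2 * C) ^ (n+1) / ρ₀ ^ (n+1) := by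
            gcongr
        _ = ((1 + t) * (2 * C) / ρ₀) ^ (n+1) := by rw [div_pow, ← mul_pow (1 + t)]
        _ ≤ G ^ (n+1) := by
            gcongr
            rw [hG]; linarith
    calc m * T ^ m * E * R ^ n ≤ 2 ^ m * T ^ m * E * R ^ n := by gcongr
      _ = S * (θ ^ (N n) * D ^ m) * ((1 + t) * (1 + C ^ (n+1)) / ρ₀ ^ n) := by
          rw [hE, hD, div_pow, mul_pow, pow_add ρ₀]; field_simp
      _ ≤ _ := by gcongr
  have f3 : ‖u n‖ * R ^ n ≤ S * l ^ m * (2 * G ^ 2) ^ n := by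
    have g1 : 1 ≤ G ^ (n+1) := one_le_pow₀ hG1
    have g2 : 1 + G ^ (n+1) ≤ (2 * G ^ 2) ^ n := by
      have k2 : (2:ℝ) ≤ 2 ^ n := le_self_pow₀ (by norm_num) (by omega)
      have k3 : G ^ (n+1) ≤ (G ^ 2) ^ n := by
        rw [← pow_mul]; exact pow_le_pow_right₀ hG1 (by omega)
      rw [mul_pow]; nlinarith
    calc ‖u n‖ * R ^ n ≤ (t ^ m * ‖u (n+m)‖ + m * T ^ m * E) * R ^ n := by gcongr
      _ = t ^ m * ‖u (n+m)‖ * R ^ n + m * T ^ m * E * R ^ n := by ring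
      _ ≤ S * l ^ m + S * l ^ m * G ^ (n+1) := add_le_add f1 f2
      _ = S * l ^ m * (1 + G ^ (n+1)) := by ring
      _ ≤ _ := by gcongr
  have f4 : l ^ m ≤ (1 / (2 * G ^ 2 * A)) ^ n := by
    calc l ^ m ≤ l ^ (L * n) := pow_le_pow_of_le_one hl0.le hl1.le hm1
      _ = (l ^ L) ^ n := pow_mul _ _ _
      _ ≤ _ := by gcongr
  have hGp : 0 < G := by linarith
  calc ‖u n‖ * (A * R) ^ n = ‖u n‖ * R ^ n * A ^ n := by rw [mul_pow]; ring
    _ ≤ S * (1 / (2 * G ^ 2 * A)) ^ n * (2 * G ^ 2) ^ n * A ^ n := by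
        refine mul_le_mul_of_nonneg_right (f3.trans ?_) (by positivity)
        gcongr
    _ = S * ((1 / (2 * G ^ 2 * A)) * (2 * G ^ 2) * A) ^ n := by
        rw [mul_pow _ A, mul_pow _ (2 * G ^ 2)]; simp only [mul_assoc]
    _ = S := by
        have : (1 / (2 * G ^ 2 * A)) * (2 * G ^ 2) * A = 1 := by field_simp
        rw [this]; simp

lemma stepD (v : ℕ → ℝ) (hv : ∀ k, 0 ≤ v k) (hs : ∀ R : ℝ, 0 < R → Summable (fun k => v k * R ^ k))
    (t' : ℝ) (d : ℕ) (hd : 2 ≤ d)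
    (H : ∀ n ≥ d, ∀ R ≥ t', 0 < R → v n * (8 * R) ^ n ≤ ∑' k, v k * R ^ k) :
    ∀ j ≥ d, v j = 0 := by
  intro j hj
  by_contra hne
  have hvj : 0 < v j := lt_of_le_of_ne (hv j) (Ne.symm hne)
  set K := ∑ k ∈ Finset.range d, v k with hK
  set R := max (max t' 1) (K / v j) with hR
  have hR1 : 1 ≤ R := (le_max_right _ _).trans (le_max_left _ _)
  have hRt : t' ≤ R := (le_max_left _ _).trans (le_max_left _ _)
  have hRK : K ≤ R * v j := by
    rw [← div_le_iff₀ hvj]; exact le_max_right _ _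
  have hR0 : 0 < R := by linarith
  have hsR := hs R hR0
  set S := ∑' k, v k * R ^ k with hS
  have hS0 : 0 ≤ S := tsum_nonneg (fun k => mul_nonneg (hv k) (by positivity))
  set T := ∑' k, v (k + d) * R ^ (k + d) with hT
  have hsT : Summable (fun k => v (k + d) * R ^ (k + d)) := (summable_nat_add_iff d).mpr hsR
  have hST : ∑ k ∈ Finset.range d, v k * R ^ k + T = S := hsR.sum_add_tsum_nat_add d
  have hjT : v j * R ^ j ≤ T := by
    have := hsT.le_tsum (j - d) (fun k _ => mul_nonneg (hv _) (by positivity))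
    simpa [Nat.sub_add_cancel hj] using this
  have hhead : ∑ k ∈ Finset.range d, v k * R ^ k ≤ T := by
    calc ∑ k ∈ Finset.range d, v k * R ^ k ≤ ∑ k ∈ Finset.range d, v k * R ^ (j-1) := by
          apply Finset.sum_le_sum
          intro k hk
          have := Finset.mem_range.mp hk
          exact mul_le_mul_of_nonneg_left (pow_le_pow_right₀ hR1 (by omega)) (hv k)
      _ = K * R ^ (j-1) := by rw [hK, Finset.sum_mul]
      _ ≤ (R * v j) * R ^ (j-1) := by gcongr
      _ = v j * R ^ j := by
          obtain ⟨i, rfl⟩ : ∃ i, j = i + 1 := ⟨j - 1, by omega⟩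
          simp [pow_succ]; ring
      _ ≤ T := hjT
  have hT0 : 0 < T := lt_of_lt_of_le (by positivity) hjT
  have hup : ∀ k, 16 * (v (k + d) * R ^ (k + d)) ≤ S * (1/2) ^ (k + d) := by
    intro k
    have h1 := H (k + d) (by omega) R hRt hR0
    have h2 : (16:ℝ) ≤ 4 ^ (k+d) := by
      calc (16:ℝ) = 4 ^ 2 := by norm_num
        _ ≤ _ := pow_le_pow_right₀ (by norm_num) (by omega)
    have h3 : (8 * R) ^ (k+d) = 2 ^ (k+d) * 4 ^ (k+d) * R ^ (k+d) := by
      rw [← mul_pow, ← mul_pow]; norm_num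
    have h4 : 0 ≤ v (k+d) * R ^ (k+d) := mul_nonneg (hv _) (by positivity)
    rw [one_div, inv_pow, ← div_eq_mul_inv, le_div_iff₀ (by positivity)]
    calc 16 * (v (k + d) * R ^ (k + d)) * 2 ^ (k+d)
        ≤ 4 ^ (k+d) * (v (k + d) * R ^ (k + d)) * 2 ^ (k+d) := by gcongr
      _ = v (k+d) * (8 * R) ^ (k+d) := by rw [h3]; ring
      _ ≤ S := h1
  have hg : Summable (fun k : ℕ => S * (1/2:ℝ) ^ k) := summable_geometric_two.mul_left S
  have hfin : 16 * T ≤ S * 2 := by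
    rw [hT, ← tsum_mul_left, ← tsum_geometric_two, ← tsum_mul_left]
    apply (hsT.mul_left 16).tsum_le_tsum _ hg
    intro k
    refine (hup k).trans ?_
    gcongr ?_ * ?_
    exact pow_le_pow_of_le_one (by norm_num) (by norm_num) (by omega)
  linarith

theorem stmt_11 (f : ℂ → ℂ) (r : ℝ) (hr0 : 0 < r) (hr1 : r < 1)
    (s : ENNReal) (hs : 1 ≤ s)
    (hf : DifferentiableOn ℂ f {z : ℂ | (‖z‖₊ : ENNReal) < s})
    (N : ℕ → ℕ)
    (hN : Tendsto (fun n : ℕ => (N n : ℝ) / (n : ℝ)) atTop atTop)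
    (Q : ℕ → Polynomial ℂ)
    (hQform : ∀ n, (∃ a : ℂ, Q n = C a * X - 1) ∨ Q n = X)
    (hliminf : ∃ c : ℝ, (s⁻¹).toReal < c ∧
      ∀ᶠ n in atTop, ∀ a : ℂ, Q n = C a * X - 1 → c ≤ ‖a‖)
    (hint : ∀ n : ℕ, ∃ P : Polynomial ℂ, P.degree ≤ (n : ℕ) ∧
      ∃ z : Fin (N n) → ℂ, (∀ i, z i ∈ closedBall (0 : ℂ) r) ∧
        ∃ h : ℂ → ℂ, DifferentiableOn ℂ h (ball (0 : ℂ) 1) ∧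
          ∀ w ∈ ball (0 : ℂ) 1,
            (Q n).eval w * f w - P.eval w = (∏ i, (w - z i)) * h w) :
    ∃ p : Polynomial ℂ, ∀ z : ℂ, (‖z‖₊ : ENNReal) < s → f z = p.eval z := by
  obtain ⟨c, hc, hce⟩ := hliminf
  have hc0 : 0 < c := lt_of_le_of_lt ENNReal.toReal_nonneg hc
  have hs0 : s ≠ 0 := (lt_of_lt_of_le one_pos hs).ne'
  have hcs : ENNReal.ofReal c⁻¹ < s := by
    rw [ENNReal.ofReal_inv_of_pos hc0, ENNReal.inv_lt_iff_inv_lt]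
    rw [ENNReal.lt_ofReal_iff_toReal_lt (by simpa using hs0)]
    exact hc
  set ρ := (1 + r) / 2 with hρ
  have hρ0 : r < ρ := by rw [hρ]; linarith
  have hρ1 : ρ < 1 := by rw [hρ]; linarith
  have hρs : ENNReal.ofReal ρ < s :=
    lt_of_lt_of_le (by rw [ENNReal.ofReal_lt_one]; exact hρ1) hs
  set t := max c⁻¹ ρ with ht
  have hts : ENNReal.ofReal t < s := by
    rw [ht, ENNReal.ofReal_max]; exact max_lt hcs hρs
  have ht0 : 0 < t := lt_of_lt_of_le (by positivity) (le_max_left _ _)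
  -- a real number strictly between
  have hbet : ∀ x : ℝ, 0 ≤ x → ENNReal.ofReal x < s → ∃ y : ℝ, x < y ∧ ENNReal.ofReal y < s := by
    intro x hx hxs
    obtain ⟨y, h1, h2⟩ := ENNReal.lt_iff_exists_nnreal_btwn.mp hxs
    refine ⟨y, ?_, by simpa using h2⟩
    rw [← ENNReal.ofReal_coe_nnreal] at h1
    exact (ENNReal.ofReal_lt_ofReal_iff_of_nonneg hx).mp h1
  obtain ⟨t', htt, ht's⟩ := hbet t ht0.le hts
  set u : ℕ → ℂ := fun k => (k.factorial : ℂ)⁻¹ * iteratedDeriv k f 0 with hu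
  have hser : ∀ z : ℂ, (‖z‖₊ : ENNReal) < s → HasSum (fun k => u k * z ^ k) (f z) := by
    intro z hz
    have e1 : ENNReal.ofReal ‖z‖ < s := by rw [ofReal_norm]; exact hz
    obtain ⟨y, hy, hys⟩ := hbet ‖z‖ (norm_nonneg _) e1
    have hd : DifferentiableOn ℂ f (ball (0:ℂ) y) := by
      apply hf.mono
      intro w hw
      have : ENNReal.ofReal ‖w‖ < s :=
        lt_of_le_of_lt (ENNReal.ofReal_le_ofReal (by simpa using (mem_ball.mp hw).le)) hys
      rw [ofReal_norm] at this; exact this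
    have := Complex.hasSum_taylorSeries_on_ball hd (z := z) (by simpa using hy)
    refine hsc this (fun k => ?_) rfl
    simp [hu]; ring
  have hu1 : ∀ w ∈ ball (0:ℂ) 1, HasSum (fun k => u k * w ^ k) (f w) := by
    intro w hw
    apply hser w
    refine lt_of_lt_of_le ?_ hs
    have : ‖w‖ < 1 := by simpa using hw
    exact_mod_cast this
  have hint' : ∀ᶠ n : ℕ in atTop, ∃ β : ℂ, ‖β‖ ≤ t ∧ ∃ P : Polynomial ℂ, P.degree ≤ (n : ℕ) ∧
      ∃ z : Fin (N n) → ℂ, (∀ i, ‖z i‖ ≤ r) ∧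
        ∃ h : ℂ → ℂ, DifferentiableOn ℂ h (ball (0 : ℂ) 1) ∧
          ∀ w ∈ ball (0 : ℂ) 1, (w - β) * f w - P.eval w = (∏ i, (w - z i)) * h w := by
    filter_upwards [hce] with n hn
    obtain ⟨P, hP, z, hz, h, hh, heq⟩ := hint n
    rcases hQform n with ⟨a, ha⟩ | hX
    · have hca := hn a ha
      have ha0 : a ≠ 0 := by
        intro h0
        rw [h0] at hca
        simp at hca
        linarith
      refine ⟨a⁻¹, ?_, Polynomial.C a⁻¹ * P, ?_, z, by simpa using hz, fun w => a⁻¹ * h w,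
        hh.const_mul _, ?_⟩
      · rw [norm_inv]
        exact (inv_anti₀ hc0 hca).trans (le_max_left _ _)
      · rw [Polynomial.degree_C_mul (inv_ne_zero ha0)]; exact hP
      · intro w hw
        have := heq w hw
        rw [ha] at this
        simp at this ⊢
        rw [mul_left_comm, ← this]
        field_simp
    · refine ⟨0, by simpa using ht0.le, P, hP, z, by simpa using hz, h, hh, ?_⟩
      intro w hw
      have := heq w hw
      rw [hX] at this
      simpa using this
  have ht'0 : 0 < t' := by linarith
  have HC := stepC hr0 hρ0 hρ1 ht0 htt ((le_max_right _ _).trans htt.le) u f hu1 N hN hint'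
  have hst' : Summable (fun k => ‖u k‖ * t' ^ k) := by
    have := (hser (t':ℂ) (by
      have : ENNReal.ofReal ‖(t':ℂ)‖ < s := by
        rwa [Complex.norm_real, Real.norm_of_nonneg ht'0.le]
      rw [ofReal_norm] at this; exact this)).summable.norm
    simpa [abs_of_pos ht'0] using this
  have hsall : ∀ R : ℝ, 0 < R → Summable (fun k => ‖u k‖ * R ^ k) := by
    intro R hR
    obtain ⟨d, hd⟩ := HC (2 * R / t') (by positivity)
    rw [← summable_nat_add_iff d]
    set S := ∑' k, ‖u k‖ * t' ^ k with hS
    have hg : Summable (fun k : ℕ => S * (1/2:ℝ) ^ (k + d)) :=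
      (summable_nat_add_iff d).mpr (summable_geometric_two.mul_left S)
    refine Summable.of_nonneg_of_le (fun k => by positivity) (fun k => ?_) hg
    have h1 := hd (k + d) (by omega) t' le_rfl hst'
    have h2 : 2 * R / t' * t' = 2 * R := by field_simp
    rw [h2, mul_pow] at h1
    rw [one_div, inv_pow, ← div_eq_mul_inv, le_div_iff₀ (by positivity)]
    linarith
  obtain ⟨d, hd⟩ := HC 8 (by norm_num)
  have hz := stepD (fun k => ‖u k‖) (fun k => norm_nonneg _) hsall t' (max d 2) (le_max_right _ _)
    (fun n hn R hR hR0 => hd n ((le_max_left _ _).trans hn) R hR (hsall R hR0))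
  refine ⟨∑ k ∈ Finset.range (max d 2), Polynomial.C (u k) * X ^ k, fun z hzs => ?_⟩
  have h1 := hser z hzs
  have h2 : HasSum (fun k => u k * z ^ k) (∑ k ∈ Finset.range (max d 2), u k * z ^ k) := by
    apply hasSum_sum_of_ne_finset_zero
    intro b hb
    have : u b = 0 := by
      have := hz b (not_lt.mp (fun hlt => hb (Finset.mem_range.mpr hlt)))
      simpa using this
    rw [this]; simp
  rw [h1.unique h2]
  simp [Polynomial.eval_finsetSum]
end

section
/- Let f be holomorphic on the unit disk with radius of convergence ρ of its Taylor series at 0, and suppose for each n the function Q_n f - P_n has at least N(n) zeros in the closed disk of radius r < 1, where deg P_n ≤ n, Q_n(z) = α_n z - 1 or Q_n(z) = z, and N(n)/n → ∞. Then limsup_n |α_n| ≥ 1/ρ (with α_n = ∞ counted as |α_n| = ∞). -/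
open Metric Filter Polynomial

lemma aux_coeff_bound (F : ℂ → ℂ) (d : ℕ → ℂ) (s A : ℝ) (hs0 : 0 < s) (hs1 : s < 1)
    (hF : DifferentiableOn ℂ F (ball (0 : ℂ) 1))
    (hsum : ∀ w ∈ ball (0 : ℂ) 1, HasSum (fun k : ℕ => d k * w ^ k) (F w))
    (hA : ∀ w ∈ sphere (0 : ℂ) s, ‖F w‖ ≤ A) (k : ℕ) : ‖d k‖ ≤ A / s ^ k := by
  obtain ⟨p, hp⟩ : ∃ p : FormalMultilinearSeries ℂ ℂ ℂ, ∀ n, p.coeff n = d n :=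
    ⟨fun n => ContinuousMultilinearMap.mkPiRing ℂ (Fin n) (d n), fun n => by
      simp [FormalMultilinearSeries.coeff]⟩
  have h1 : HasFPowerSeriesAt F p 0 := by
    refine hasFPowerSeriesAt_iff.2 ?_
    filter_upwards [ball_mem_nhds (0 : ℂ) one_pos] with w hw
    have := hsum w hw
    simpa [hp, mul_comm] using this
  obtain ⟨R, hR⟩ := h1
  have h2 := hR.factorial_smul 1 k
  rw [← iteratedDeriv_eq_iteratedFDeriv] at h2
  have h3 := Complex.norm_iteratedDeriv_le_of_forall_mem_sphere_norm_le (f := F) (c := 0) k hs0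
    (DifferentiableOn.diffContOnCl (hF.mono (by
      rw [closure_ball _ hs0.ne']; exact closedBall_subset_ball hs1))) hA
  rw [← h2] at h3
  have hk : (0 : ℝ) < k.factorial := by exact_mod_cast k.factorial_pos
  have h4 : (p k fun _ => (1 : ℂ)) = d k := hp k
  rw [h4, nsmul_eq_mul, norm_mul, Complex.norm_natCast] at h3
  rw [mul_div_assoc] at h3
  exact le_of_mul_le_mul_left h3 hk

lemma aux_limsup (c : ℕ → ℂ) (b : ℝ) (hb : 0 < b)
    (h : ∀ᶠ n in atTop, ‖c (n + 1)‖ ≤ b * ‖c n‖ + (b / 2) ^ n) :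
    Filter.limsup (fun k : ℕ => ‖c k‖ ^ (1 / (k : ℝ))) atTop ≤ b := by
  obtain ⟨n0, hn0⟩ := eventually_atTop.1 h
  set K : ℝ := ‖c n0‖ / b ^ n0 + 2 / b * (1 / 2) ^ n0 with hK
  have key : ∀ n ≥ n0, ‖c n‖ ≤ b ^ n * (K - 2 / b * (1 / 2) ^ n) := by
    intro n hn
    induction n, hn using Nat.le_induction with
    | base => rw [hK]; field_simp; simp
    | succ n hn ih =>
      refine (hn0 n hn).trans ?_
      have : b * ‖c n‖ ≤ b * (b ^ n * (K - 2 / b * (1 / 2) ^ n)) := by gcongr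
      refine (add_le_add_left this _).trans (le_of_eq ?_)
      have e : (b / 2) ^ n = b ^ n * (1 / 2) ^ n := by rw [← mul_pow]; congr 1; ring
      rw [e, pow_succ, pow_succ]
      generalize ((1 : ℝ) / 2) ^ n = t
      field_simp
      ring
  have hKp : 0 < K := by positivity
  refine le_of_forall_gt_imp_ge_of_dense fun b' hb' => ?_
  refine limsup_le_of_le (isCoboundedUnder_le_of_le atTop (x := 0) (fun i => by positivity)) ?_
  have hb'0 : 0 < b' := hb.trans hb'
  have ht : Tendsto (fun n : ℕ => (b / b') ^ n * K) atTop (nhds (0 * K)) :=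
    (tendsto_pow_atTop_nhds_zero_of_lt_one (by positivity) ((div_lt_one hb'0).2 hb')).mul_const K
  rw [zero_mul] at ht
  filter_upwards [ht.eventually (gt_mem_nhds one_pos), eventually_ge_atTop n0,
    eventually_gt_atTop 0] with n h1 h2 h3
  have h4 : ‖c n‖ ≤ b' ^ n := by
    refine (key n h2).trans ?_
    have : b ^ n * (K - 2 / b * (1 / 2) ^ n) ≤ b ^ n * K := by
      gcongr
      have : 0 ≤ 2 / b * (1 / 2) ^ n := by positivity
      linarith
    refine this.trans ?_
    rw [div_pow, div_mul_eq_mul_div, div_lt_one (by positivity)] at h1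
    exact h1.le
  calc ‖c n‖ ^ (1 / (n : ℝ)) ≤ (b' ^ n) ^ (1 / (n : ℝ)) := by gcongr
    _ = b' := by rw [one_div]; exact Real.pow_rpow_inv_natCast hb'0.le h3.ne'

lemma aux_blaschke (R r : ℝ) (hr : 0 < r) (hR : r < R) (z w : ℂ) (hz : ‖z‖ ≤ r) (hw : ‖w‖ ≤ r) :
    R * ‖w - z‖ ≤ Real.sqrt (1 - (R ^ 2 - r ^ 2) ^ 2 / (4 * R ^ 4)) *
      ‖(R : ℂ) ^ 2 - (starRingEnd ℂ) z * w‖ := by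
  have hR0 : 0 < R := hr.trans hR
  have e1 : ‖(R : ℂ) ^ 2 - (starRingEnd ℂ) z * w‖ ^ 2 - R ^ 2 * ‖w - z‖ ^ 2
      = (R ^ 2 - ‖z‖ ^ 2) * (R ^ 2 - ‖w‖ ^ 2) := by
    simp only [Complex.sq_norm, Complex.normSq_apply]
    simp [pow_two]
    ring
  have hrR : r ^ 2 < R ^ 2 := by gcongr
  have hz2 : ‖z‖ ^ 2 ≤ r ^ 2 := by gcongr
  have hw2 : ‖w‖ ^ 2 ≤ r ^ 2 := by gcongr
  have e2 : ‖(R : ℂ) ^ 2 - (starRingEnd ℂ) z * w‖ ≤ 2 * R ^ 2 := by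
    refine (norm_sub_le _ _).trans ?_
    rw [norm_mul, RCLike.norm_conj, norm_pow, Complex.norm_real, Real.norm_eq_abs, sq_abs]
    nlinarith [mul_le_mul hz hw (norm_nonneg _) hr.le]
  have e3 : (R ^ 2 - r ^ 2) ^ 2 ≤ (R ^ 2 - ‖z‖ ^ 2) * (R ^ 2 - ‖w‖ ^ 2) := by
    rw [pow_two (R ^ 2 - r ^ 2)]
    apply mul_le_mul <;> linarith
  set T := ‖(R : ℂ) ^ 2 - (starRingEnd ℂ) z * w‖ with hT
  have hT0 : 0 ≤ T := norm_nonneg _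
  have e4 : T ^ 2 ≤ 4 * R ^ 4 := by nlinarith
  have e5 : (R ^ 2 - r ^ 2) ^ 2 / (4 * R ^ 4) * T ^ 2 ≤ (R ^ 2 - r ^ 2) ^ 2 := by
    rw [div_mul_eq_mul_div, div_le_iff₀ (by positivity)]
    gcongr
  rw [← Real.sqrt_sq hT0, ← Real.sqrt_mul' _ (sq_nonneg T)]
  apply Real.le_sqrt_of_sq_le
  rw [mul_pow]
  linarith

lemma aux_schwarz (R r : ℝ) (hr : 0 < r) (hR : r < R) (hR1 : R < 1) (N : ℕ) (z : Fin N → ℂ)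
    (hz : ∀ i, z i ∈ closedBall (0 : ℂ) r) (g h : ℂ → ℂ)
    (hh : DifferentiableOn ℂ h (ball (0 : ℂ) 1))
    (hg : ∀ w ∈ ball (0 : ℂ) 1, g w = (∏ i, (w - z i)) * h w) (m : ℝ)
    (hm : ∀ w ∈ sphere (0 : ℂ) R, ‖g w‖ ≤ m) (w : ℂ) (hw : ‖w‖ ≤ r) :
    ‖g w‖ ≤ m * (Real.sqrt (1 - (R ^ 2 - r ^ 2) ^ 2 / (4 * R ^ 4))) ^ N := by
  have hR0 : 0 < R := hr.trans hR
  set κ := Real.sqrt (1 - (R ^ 2 - r ^ 2) ^ 2 / (4 * R ^ 4)) with hκ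
  have hκ0 : 0 ≤ κ := Real.sqrt_nonneg _
  let H : ℂ → ℂ := fun w => (∏ i, ((R : ℂ) ^ 2 - (starRingEnd ℂ) (z i) * w)) * h w
  have hH : DifferentiableOn ℂ H (ball (0 : ℂ) 1) := by
    refine DifferentiableOn.mul ?_ hh
    apply Differentiable.differentiableOn
    fun_prop
  have hb : ∀ w ∈ sphere (0 : ℂ) R, ‖H w‖ ≤ R ^ N * m := by
    intro w hw
    have hwR : ‖w‖ = R := by simpa using hw
    have hwb : w ∈ ball (0 : ℂ) 1 := by simpa [hwR] using hR1
    have : ‖H w‖ = R ^ N * ‖g w‖ := by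
      rw [hg w hwb]
      simp only [H, norm_mul, norm_prod]
      rw [← mul_assoc]
      congr 1
      have : R ^ N = ∏ i : Fin N, R := by simp
      rw [this, ← Finset.prod_mul_distrib]
      refine Finset.prod_congr rfl fun i _ => ?_
      have e : (R : ℂ) ^ 2 = (starRingEnd ℂ) w * w := by
        rw [mul_comm, Complex.mul_conj, Complex.normSq_eq_norm_sq, hwR]; simp
      rw [e, ← sub_mul, ← map_sub, norm_mul, RCLike.norm_conj, hwR, mul_comm]
    rw [this]
    gcongr
    exact hm w hw
  have hHw : ‖H w‖ ≤ R ^ N * m := by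
    refine Complex.norm_le_of_forall_mem_frontier_norm_le (U := ball (0 : ℂ) R) isBounded_ball
      (DifferentiableOn.diffContOnCl (hH.mono ?_)) ?_ ?_
    · rw [closure_ball _ hR0.ne']; exact closedBall_subset_ball hR1
    · rw [frontier_ball _ hR0.ne']; exact hb
    · rw [closure_ball _ hR0.ne']; simpa using hw.trans hR.le
  have hwb : w ∈ ball (0 : ℂ) 1 := by simpa using hw.trans_lt (hR.trans hR1)
  have h1 : R ^ N * ‖g w‖ ≤ κ ^ N * ‖H w‖ := by
    rw [hg w hwb]
    simp only [H, norm_mul, norm_prod]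
    rw [← mul_assoc, ← mul_assoc]
    refine mul_le_mul_of_nonneg_right ?_ (norm_nonneg _)
    have e1 : R ^ N = ∏ i : Fin N, R := by simp
    have e2 : κ ^ N = ∏ i : Fin N, κ := by simp
    rw [e1, e2, ← Finset.prod_mul_distrib, ← Finset.prod_mul_distrib]
    refine Finset.prod_le_prod (fun i _ => by positivity) fun i _ => ?_
    exact aux_blaschke R r hr hR (z i) w (by simpa using hz i) hw
  have h2 : R ^ N * ‖g w‖ ≤ R ^ N * (m * κ ^ N) := by
    refine h1.trans ?_
    calc κ ^ N * ‖H w‖ ≤ κ ^ N * (R ^ N * m) := by gcongr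
      _ = _ := by ring
  exact le_of_mul_le_mul_left h2 (by positivity)

lemma aux_poly_hasSum (P : Polynomial ℂ) (w : ℂ) :
    HasSum (fun k : ℕ => P.coeff k * w ^ k) (P.eval w) := by
  rw [Polynomial.eval_eq_sum_range]
  refine hasSum_sum_of_ne_finset_zero ?_
  intro k hk
  rw [Polynomial.coeff_eq_zero_of_natDegree_lt (by simpa using hk), zero_mul]

lemma aux_poly_bound (P : Polynomial ℂ) (n : ℕ) (hP : P.degree ≤ (n : ℕ)) (R r A : ℝ) (hr : 0 < r)
    (hR : r < R) (hr1 : r < 1) (hA : ∀ w : ℂ, ‖w‖ ≤ r → ‖P.eval w‖ ≤ A) (w : ℂ) (hw : ‖w‖ ≤ R) :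
    ‖P.eval w‖ ≤ A * (2 * R / r) ^ n := by
  have hA0 : 0 ≤ A := (norm_nonneg _).trans (hA 0 (by simpa using hr.le))
  have hc := aux_coeff_bound (fun w => P.eval w) P.coeff r A hr hr1
    P.differentiable.differentiableOn (fun w _ => aux_poly_hasSum P w)
    (fun w hw => hA w (by simpa using (le_of_eq (by simpa using hw : ‖w‖ = r))))
  have hnd : P.natDegree < n + 1 := Nat.lt_succ_of_le (Polynomial.natDegree_le_iff_degree_le.2 hP)
  rw [Polynomial.eval_eq_sum_range' hnd]
  have h1 : 1 ≤ R / r := by rw [one_le_div hr]; exact hR.le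
  calc ‖∑ i ∈ Finset.range (n + 1), P.coeff i * w ^ i‖
      ≤ ∑ i ∈ Finset.range (n + 1), A * (R / r) ^ n := by
        refine norm_sum_le_of_le _ fun i hi => ?_
        rw [norm_mul, norm_pow]
        calc ‖P.coeff i‖ * ‖w‖ ^ i ≤ A / r ^ i * R ^ i := by
              gcongr; exact hc i
          _ = A * (R / r) ^ i := by rw [div_pow]; ring
          _ ≤ _ := by
            have := Finset.mem_range.1 hi
            exact mul_le_mul_of_nonneg_left (pow_le_pow_right₀ h1 (by omega)) hA0
    _ = ((n : ℝ) + 1) * (A * (R / r) ^ n) := by simp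
    _ ≤ 2 ^ n * (A * (R / r) ^ n) := by
        gcongr
        exact_mod_cast (Nat.lt_two_pow_self : n < 2 ^ n)
    _ = _ := by rw [mul_div_assoc, mul_pow]; ring

lemma aux_step (f : ℂ → ℂ) (c : ℕ → ℂ) (R r M b : ℝ) (hr : 0 < r) (hR : r < R) (hR1 : R < 1)
    (hf : DifferentiableOn ℂ f (ball (0 : ℂ) 1))
    (hsum : ∀ w ∈ ball (0 : ℂ) 1, HasSum (fun k : ℕ => c k * w ^ k) (f w))
    (hM : ∀ w : ℂ, ‖w‖ ≤ R → ‖f w‖ ≤ M) (a : ℂ) (ha : ‖a‖ < b)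
    (n N : ℕ) (P : Polynomial ℂ) (hP : P.degree ≤ (n : ℕ)) (z : Fin N → ℂ)
    (hz : ∀ i, z i ∈ closedBall (0 : ℂ) r) (h : ℂ → ℂ)
    (hh : DifferentiableOn ℂ h (ball (0 : ℂ) 1))
    (hg : ∀ w ∈ ball (0 : ℂ) 1,
      (a * w - 1) * f w - P.eval w = (∏ i, (w - z i)) * h w)
    (κ : ℝ) (hκ : κ = Real.sqrt (1 - (R ^ 2 - r ^ 2) ^ 2 / (4 * R ^ 4)))
    (hsmall : (2 * R / r) ^ n * κ ^ N ≤ 1 / 2) :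
    ‖c (n + 1)‖ ≤ b * ‖c n‖ + 4 * ((b + 1) * M) * (2 * R / r) ^ n * κ ^ N / r ^ (n + 1) := by
  have hR0 : 0 < R := hr.trans hR
  have hκ0 : 0 ≤ κ := hκ ▸ Real.sqrt_nonneg _
  have hb0 : 0 ≤ b := (norm_nonneg a).trans ha.le
  set g : ℂ → ℂ := fun w => (a * w - 1) * f w - P.eval w with hgdef
  set E := (2 * R / r) ^ n with hE
  have hE1 : 1 ≤ E := one_le_pow₀ (by rw [one_le_div hr]; linarith)
  have hM0 : 0 ≤ M := (norm_nonneg _).trans (hM 0 (by simpa using hR0.le))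
  have hgd : DifferentiableOn ℂ g (ball (0 : ℂ) 1) := by
    refine DifferentiableOn.sub (DifferentiableOn.mul ?_ hf) P.differentiable.differentiableOn
    fun_prop
  have hQf : ∀ w : ℂ, ‖w‖ ≤ R → ‖(a * w - 1) * f w‖ ≤ (b + 1) * M := by
    intro w hw
    rw [norm_mul]
    have h1 : ‖a * w - 1‖ ≤ b + 1 := by
      refine (norm_sub_le _ _).trans ?_
      rw [norm_mul, norm_one]
      have : ‖a‖ * ‖w‖ ≤ b * 1 := by
        gcongr
        exact hw.trans hR1.le
      linarith
    have := hM w hw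
    gcongr
  set M' := (b + 1) * M with hM'
  have hM'0 : 0 ≤ M' := by positivity
  obtain ⟨z0, hz0, hmax⟩ := (isCompact_closedBall (0 : ℂ) R).exists_isMaxOn
    ⟨0, by simpa using hR0.le⟩
    ((hgd.continuousOn.mono (closedBall_subset_ball hR1)).norm)
  set m := ‖g z0‖ with hm
  have hgr : ∀ w : ℂ, ‖w‖ ≤ r → ‖g w‖ ≤ m * κ ^ N := by
    intro w hw
    rw [hκ]
    exact aux_schwarz R r hr hR hR1 N z hz g h hh hg m
      (fun w hw => hmax (sphere_subset_closedBall hw)) w hw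
  have hPz0 := aux_poly_bound P n hP R r (M' + m * κ ^ N) hr hR (hR.trans hR1) (by
    intro w hw
    have e : P.eval w = (a * w - 1) * f w - g w := by simp [hgdef]
    rw [e]
    exact (norm_sub_le _ _).trans (add_le_add (hQf w (hw.trans hR.le)) (hgr w hw))) z0
    (by simpa using hz0)
  have hm1 : m ≤ M' + (M' + m * κ ^ N) * E :=
    (norm_sub_le _ _).trans (add_le_add (hQf z0 (by simpa using hz0)) hPz0)
  have hm0 : 0 ≤ m := norm_nonneg _
  have hm2 : m ≤ 4 * M' * E := by nlinarith
  have hgr' : ∀ w ∈ sphere (0 : ℂ) r, ‖g w‖ ≤ 4 * M' * E * κ ^ N := by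
    intro w hw
    refine (hgr w (le_of_eq (by simpa using hw))).trans ?_
    gcongr
  have hd := aux_coeff_bound g
    (fun k => a * (if k = 0 then 0 else c (k - 1)) - c k - P.coeff k) r _ hr (hR.trans hR1) hgd
    (by
      intro w hw
      have s1 := hsum w hw
      have s2 : HasSum (fun k : ℕ => (a * (if k = 0 then 0 else c (k - 1))) * w ^ k)
          (a * w * f w) := by
        rw [← hasSum_nat_add_iff' 1]
        have := s1.mul_left (a * w)
        simp only [Nat.add_eq_zero_iff, one_ne_zero, and_false, if_false, Nat.add_sub_cancel,
          Finset.sum_range_one, if_true, mul_zero, zero_mul, sub_zero]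
        have e : (fun k : ℕ => a * c k * w ^ (k + 1)) = fun k => a * w * (c k * w ^ k) := by
          funext k; ring
        rw [e]; exact this
      have s3 := (s2.sub s1).sub (aux_poly_hasSum P w)
      have e1 : g w = a * w * f w - f w - P.eval w := by
        change (a * w - 1) * f w - P.eval w = _
        ring
      have e2 : (fun k : ℕ => (a * (if k = 0 then 0 else c (k - 1)) - c k - P.coeff k) * w ^ k)
          = fun k => (a * (if k = 0 then 0 else c (k - 1))) * w ^ k - c k * w ^ k
            - P.coeff k * w ^ k := by
        funext k; ring
      rw [e1]
      change HasSum (fun k : ℕ =>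
        (a * (if k = 0 then 0 else c (k - 1)) - c k - P.coeff k) * w ^ k) _
      rw [e2]
      exact s3) hgr' (n + 1)
  have hp0 : P.coeff (n + 1) = 0 := Polynomial.coeff_eq_zero_of_degree_lt
    (hP.trans_lt (by exact_mod_cast Nat.lt_succ_self n))
  simp only [hp0, Nat.succ_ne_zero, if_false, Nat.add_sub_cancel, sub_zero] at hd
  have e : c (n + 1) = a * c n - (a * c n - c (n + 1)) := by ring
  calc ‖c (n + 1)‖ = ‖a * c n - (a * c n - c (n + 1))‖ := by rw [← e]
    _ ≤ ‖a * c n‖ + ‖a * c n - c (n + 1)‖ := norm_sub_le _ _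
    _ ≤ b * ‖c n‖ + _ := by
      refine add_le_add ?_ hd
      rw [norm_mul]
      gcongr

lemma aux_kappa (N : ℕ → ℕ)
    (hN : Tendsto (fun n : ℕ => (N n : ℝ) / (n : ℝ)) atTop atTop) (κ : ℝ) (h0 : 0 ≤ κ)
    (h1 : κ < 1) (η : ℝ) (hη : 0 < η) : ∀ᶠ n in atTop, κ ^ (N n) ≤ η ^ n := by
  obtain ⟨T, hT⟩ := exists_pow_lt_of_lt_one hη h1
  filter_upwards [hN.eventually_ge_atTop (T : ℝ), eventually_gt_atTop 0] with n hn hn0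
  have hn0' : (0 : ℝ) < n := by exact_mod_cast hn0
  rw [le_div_iff₀ hn0'] at hn
  have : T * n ≤ N n := by exact_mod_cast hn
  calc κ ^ (N n) ≤ κ ^ (T * n) := pow_le_pow_of_le_one h0 h1.le this
    _ = (κ ^ T) ^ n := pow_mul _ _ _
    _ ≤ η ^ n := by gcongr

/-- Lemma 3.3: let `f(z) = ∑ c_k z^k` be holomorphic on the unit disk, with radius of
convergence `ρ`, so that `1/ρ = limsup ‖c_k‖^{1/k}`. Suppose for each `n` there are
`Pₙ` (deg ≤ n) and `Qₙ(z) = αₙ z - 1` or `Qₙ(z) = z` such that `Qₙ f - Pₙ` has at least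
`N(n)` zeros (with multiplicity) in the closed disk of radius `r < 1`, with
`N(n)/n → ∞`. Then `limsup |αₙ| ≥ 1/ρ` (with `αₙ = ∞` for `Qₙ = z`): for every
`b < 1/ρ`, frequently `Qₙ = z` or `|αₙ| ≥ b`. -/
theorem stmt_12 (f : ℂ → ℂ) (c : ℕ → ℂ) (r : ℝ) (hr0 : 0 < r) (hr1 : r < 1)
    (hf : DifferentiableOn ℂ f (ball (0 : ℂ) 1))
    (hsum : ∀ w ∈ ball (0 : ℂ) 1, HasSum (fun k : ℕ => c k * w ^ k) (f w))
    (N : ℕ → ℕ)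
    (hN : Tendsto (fun n : ℕ => (N n : ℝ) / (n : ℝ)) atTop atTop)
    (Q : ℕ → Polynomial ℂ)
    (hQform : ∀ n, (∃ a : ℂ, Q n = C a * X - 1) ∨ Q n = X)
    (hint : ∀ n : ℕ, ∃ P : Polynomial ℂ, P.degree ≤ (n : ℕ) ∧
      ∃ z : Fin (N n) → ℂ, (∀ i, z i ∈ closedBall (0 : ℂ) r) ∧
        ∃ h : ℂ → ℂ, DifferentiableOn ℂ h (ball (0 : ℂ) 1) ∧
          ∀ w ∈ ball (0 : ℂ) 1,
            (Q n).eval w * f w - P.eval w = (∏ i, (w - z i)) * h w) :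
    ∀ b : ℝ, b < Filter.limsup (fun k : ℕ => ‖c k‖ ^ (1 / (k : ℝ))) atTop →
      ∃ᶠ n in atTop, Q n = X ∨ ∃ a : ℂ, Q n = C a * X - 1 ∧ b ≤ ‖a‖ := by
  intro b hb
  by_contra hcon
  rw [not_frequently] at hcon
  have hev : ∀ᶠ n in atTop, ∃ a : ℂ, Q n = C a * X - 1 ∧ ‖a‖ < b := by
    filter_upwards [hcon] with n hn
    rcases hQform n with ⟨a, ha⟩ | hX
    · exact ⟨a, ha, not_le.1 fun hle => hn (Or.inr ⟨a, ha, hle⟩)⟩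
    · exact absurd (Or.inl hX) hn
  have hb0 : 0 < b := by
    obtain ⟨n, a, _, ha⟩ := hev.exists
    exact (norm_nonneg a).trans_lt ha
  refine absurd (aux_limsup c b hb0 ?_) (not_le.2 hb)
  obtain ⟨R, hR, hR1⟩ := exists_between hr1
  have hR0 : 0 < R := hr0.trans hR
  obtain ⟨M, hM⟩ := (isCompact_closedBall (0 : ℂ) R).exists_bound_of_continuousOn
    (hf.continuousOn.mono (closedBall_subset_ball hR1))
  obtain ⟨κ, hκ⟩ : ∃ κ, κ = Real.sqrt (1 - (R ^ 2 - r ^ 2) ^ 2 / (4 * R ^ 4)) := ⟨_, rfl⟩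
  have hκ0 : 0 ≤ κ := hκ ▸ Real.sqrt_nonneg _
  have hκ1 : κ < 1 := by
    rw [hκ, Real.sqrt_lt' one_pos]
    have : r ^ 2 < R ^ 2 := by gcongr
    have h3 : 0 < R ^ 2 - r ^ 2 := by linarith
    have : 0 < (R ^ 2 - r ^ 2) ^ 2 / (4 * R ^ 4) := by positivity
    linarith
  set E := 2 * R / r with hE
  have hE0 : 0 < E := by positivity
  have k1 := aux_kappa N hN κ hκ0 hκ1 (1 / (2 * E)) (by positivity)
  have k2 := aux_kappa N hN κ hκ0 hκ1 (b * r / (4 * E)) (by positivity)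
  have k3 : ∀ᶠ n : ℕ in atTop, 4 * ((b + 1) * M) / r ≤ 2 ^ n :=
    (tendsto_pow_atTop_atTop_of_one_lt (one_lt_two (α := ℝ))).eventually_ge_atTop _
  filter_upwards [hev, k1, k2, k3, eventually_gt_atTop 0] with n ⟨a, hQ, ha⟩ h1 h2 h3 hn
  obtain ⟨P, hP, z, hz, h, hh, hg⟩ := hint n
  have hsmall : E ^ n * κ ^ (N n) ≤ 1 / 2 := by
    calc E ^ n * κ ^ (N n) ≤ E ^ n * (1 / (2 * E)) ^ n := by gcongr
      _ = (1 / 2) ^ n := by rw [← mul_pow]; congr 1; field_simp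
      _ ≤ (1 / 2) ^ 1 := pow_le_pow_of_le_one (by norm_num) (by norm_num) hn
      _ = 1 / 2 := by norm_num
  have hstep := aux_step f c R r M b hr0 hR hR1 hf hsum (fun w hw => hM w (by simpa using hw)) a ha
    n (N n) P hP z hz h hh (fun w hw => by simpa [hQ] using hg w hw) κ hκ hsmall
  refine hstep.trans ?_
  gcongr
  have hM0 : 0 ≤ M := (norm_nonneg _).trans (hM 0 (by simpa using hR0.le))
  rw [← hE]
  calc 4 * ((b + 1) * M) * E ^ n * κ ^ (N n) / r ^ (n + 1)
      ≤ 4 * ((b + 1) * M) * E ^ n * (b * r / (4 * E)) ^ n / r ^ (n + 1) := by gcongr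
    _ = 4 * ((b + 1) * M) / r * (b / 4) ^ n := by
      have : b * r / (4 * E) = (b / 4) * r / E := by field_simp
      rw [this, div_pow ((b / 4) * r), mul_pow (b / 4), pow_succ]
      field_simp
    _ ≤ 2 ^ n * (b / 4) ^ n := by gcongr
    _ = (b / 2) ^ n := by rw [← mul_pow]; congr 1; ring
end

section
/- Let f be holomorphic on the unit disk, K the closed disk of radius r < 1, and N_K(n,1) the maximal number of zeros in K of f - R over rational functions R = P/Q with deg P ≤ n, deg Q ≤ 1. If N_K(n,1)/n → ∞, then either f is entire or f = P/Q for polynomials P, Q with deg Q = 1 and Q not dividing P. -/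
open Metric Filter

def SE (x : ℕ → ℝ) : Prop := ∀ η : ℝ, 0 < η → ∀ᶠ n in atTop, x n ≤ η ^ n

lemma SE.mul {x : ℕ → ℝ} (hx : SE x) (C D : ℝ) (hC : 0 ≤ C) (hD : 0 < D) :
    SE (fun n => C * D ^ n * x n) := by
  intro η hη
  have h2 : ∀ᶠ n : ℕ in atTop, C ≤ 2 ^ n :=
    (tendsto_pow_atTop_atTop_of_one_lt (by norm_num : (1:ℝ) < 2)).eventually_ge_atTop C
  filter_upwards [hx (η / (2 * D)) (by positivity), h2] with n h1 h2
  calc C * D ^ n * x n ≤ C * D ^ n * (η / (2 * D)) ^ n := by gcongr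
    _ ≤ 2 ^ n * D ^ n * (η / (2 * D)) ^ n := by gcongr
    _ = η ^ n := by
      rw [← mul_pow, ← mul_pow]; congr 1; field_simp

lemma SE.mono {x y : ℕ → ℝ} (hx : SE x) (h : ∀ᶠ n in atTop, y n ≤ x n) : SE y := by
  intro η hη
  filter_upwards [hx η hη, h] with n h1 h2
  linarith

lemma SE.add {x y : ℕ → ℝ} (hx : SE x) (hy : SE y) : SE (fun n => x n + y n) := by
  intro η hη
  filter_upwards [hx (η / 2) (by positivity), hy (η / 2) (by positivity),
    eventually_ge_atTop 1] with n h1 h2 hn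
  have : 2 * (η / 2) ^ n ≤ η ^ n := by
    rw [div_pow]
    have h3 : (2:ℝ) ≤ 2 ^ n := by
      calc (2:ℝ) = 2 ^ 1 := by norm_num
        _ ≤ 2 ^ n := by gcongr; norm_num
    rw [← mul_div_assoc, div_le_iff₀ (by positivity)]
    have := pow_pos hη n
    nlinarith
  linarith

lemma SE.succ {x : ℕ → ℝ} (hx : SE x) : SE (fun n => x (n + 1)) := by
  intro η hη
  have h1 := (tendsto_add_atTop_nat 1).eventually (hx (min η 1) (by positivity))
  filter_upwards [h1] with n h
  calc x (n + 1) ≤ (min η 1) ^ (n + 1) := h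
    _ ≤ (min η 1) ^ n := by
      apply pow_le_pow_of_le_one (by positivity) (min_le_right _ _) (by omega)
    _ ≤ η ^ n := by
      gcongr; exact min_le_left _ _

lemma SE.le_geom {x : ℕ → ℝ} (hx : SE x) (C η : ℝ) (hC : 0 < C) (hη : 0 < η) :
    ∀ᶠ n in atTop, x n ≤ C * η ^ n := by
  filter_upwards [hx.mul C⁻¹ 1 (by positivity) one_pos η hη] with n h
  rw [one_pow, mul_one, inv_mul_le_iff₀ hC] at h
  exact h

lemma SE.limit {s : ℕ → ℂ} (h : SE (fun n => ‖s (n + 1) - s n‖)) :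
    ∃ q, SE (fun n => ‖s n - q‖) := by
  have hd : ∀ n, dist (s n) (s n.succ) ≤ ‖s (n + 1) - s n‖ := by
    intro n; rw [dist_comm, dist_eq_norm]
  have hs : Summable (fun n => ‖s (n + 1) - s n‖) := by
    apply Summable.of_norm_bounded_eventually_nat
      (summable_geometric_of_lt_one (by norm_num) (by norm_num : (1/2:ℝ) < 1))
    filter_upwards [h (1/2) (by norm_num)] with n hn
    simpa using hn
  have hc : CauchySeq s := cauchySeq_of_dist_le_of_summable _ hd hs
  obtain ⟨q, hq⟩ := cauchySeq_tendsto_of_complete hc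
  refine ⟨q, ?_⟩
  have key : ∀ n, ‖s n - q‖ ≤ ∑' m, ‖s (n + m + 1) - s (n + m)‖ := by
    intro n
    rw [← dist_eq_norm]
    exact dist_le_tsum_of_dist_le_of_tendsto _ hd hs hq n
  have : SE (fun n => ∑' m, ‖s (n + m + 1) - s (n + m)‖) := by
    intro η hη
    set μ := min (η / 2) (1/2) with hμ
    have hμ0 : 0 < μ := by positivity
    have hμ1 : μ ≤ 1 / 2 := min_le_right _ _
    have hμ2 : μ ≤ η / 2 := min_le_left _ _
    obtain ⟨K, hK⟩ := eventually_atTop.1 (h μ hμ0)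
    filter_upwards [eventually_ge_atTop K, eventually_ge_atTop 1] with n hn hn1
    have hg : Summable (fun m : ℕ => μ ^ n * μ ^ m) :=
      (summable_geometric_of_lt_one hμ0.le (by linarith)).mul_left _
    have hle : ∀ m, ‖s (n + m + 1) - s (n + m)‖ ≤ μ ^ n * μ ^ m := by
      intro m; rw [← pow_add]; exact hK _ (by omega)
    have hs' : Summable (fun m => ‖s (n + m + 1) - s (n + m)‖) :=
      Summable.of_nonneg_of_le (fun _ => norm_nonneg _) hle hg
    calc _ ≤ ∑' m : ℕ, μ ^ n * μ ^ m := hs'.tsum_le_tsum hle hg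
      _ = μ ^ n * (1 - μ)⁻¹ := by
        rw [tsum_mul_left, tsum_geometric_of_lt_one hμ0.le (by linarith)]
      _ ≤ μ ^ n * 2 := by
        gcongr
        rw [inv_le_comm₀ (by linarith) (by norm_num)]; linarith
      _ ≤ (η / 2) ^ n * 2 ^ n := by
        gcongr
        calc (2:ℝ) = 2 ^ 1 := by norm_num
          _ ≤ 2 ^ n := by gcongr; norm_num
      _ = η ^ n := by rw [← mul_pow]; congr 1; ring
  exact this.mono (Eventually.of_forall key)

lemma exists_record {x : ℕ → ℝ} (hx : Tendsto x atTop (nhds 0)) (h : ∃ᶠ n in atTop, 0 < x n) :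
    ∃ᶠ n in atTop, 0 < x n ∧ ∀ k ≥ n, x k ≤ x n := by
  rw [frequently_atTop] at h ⊢
  intro N
  obtain ⟨k0, hk0, hpos⟩ := h N
  obtain ⟨K, hK⟩ := eventually_atTop.1 (hx.eventually_lt_const hpos)
  obtain ⟨n, hn, hmax⟩ := Finset.exists_max_image (Finset.Icc N (k0 + K)) x
    ⟨k0, by simp; omega⟩
  rw [Finset.mem_Icc] at hn
  have h0 : x k0 ≤ x n := hmax k0 (by simp; omega)
  refine ⟨n, hn.1, by linarith, fun k hk => ?_⟩
  by_cases hk' : k ≤ k0 + K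
  · exact hmax k (by simp; omega)
  · have := hK k (by omega); linarith

/-- start -/
lemma start_lem (a α β : ℕ → ℂ) (δ : ℕ → ℝ) (B ρ c : ℝ) (hρ : 0 < ρ) (hρ1 : ρ < 1)
    (hB : 0 ≤ B)
    (ha : ∀ k, ‖a k‖ ≤ B * ρ⁻¹ ^ k) (hδ : SE δ)
    (hα : ∀ n, ‖α n‖ ≤ 1) (hβ : ∀ n, ‖β n‖ ≤ 1) (hαβ : ∀ n, ‖α n‖ = 1 ∨ ‖β n‖ = 1)
    (h0 : ∀ᶠ n in atTop, ‖α n * a n + β n * a (n + 1)‖ ≤ δ n)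
    (h1 : ∀ᶠ n in atTop, ‖α n * a (n + 1) + β n * a (n + 2)‖ ≤ δ n)
    (hc : 0 < c) (hc1 : c ≤ 1) (hbig : ∃ᶠ n in atTop, c ^ n ≤ ‖a n‖) :
    ∃ᶠ n in atTop, (c ^ 2 * ρ / 16) ^ n ≤ ‖a n‖ ∧ c / 4 ≤ ‖α n‖ := by
  by_contra hcon
  rw [not_frequently] at hcon
  have hc16 : (0:ℝ) < c ^ 2 * ρ / 16 := by positivity
  have hE1 : ∀ᶠ n : ℕ in atTop, 4 * B / ρ ^ 2 / c ^ 2 < 16 ^ n :=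
    (tendsto_pow_atTop_atTop_of_one_lt (by norm_num : (1:ℝ) < 16)).eventually_gt_atTop _
  have hE2 : ∀ᶠ n : ℕ in atTop, 2 / c < 16 ^ n :=
    (tendsto_pow_atTop_atTop_of_one_lt (by norm_num : (1:ℝ) < 16)).eventually_gt_atTop _
  obtain ⟨K, hK⟩ := eventually_atTop.1 (hcon.and (h0.and (h1.and (hE1.and (hE2.and
    ((hδ _ hc16).and (hδ.le_geom (c / 2) c (by positivity) hc)))))))
  have step : ∀ m ≥ K, c ^ (m + 1) ≤ ‖a (m + 1)‖ → 2 / c * ‖a (m + 1)‖ ≤ ‖a m‖ := by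
    intro m hm hbm
    obtain ⟨k1, k2, k3, k4, k5, k6, k7⟩ := hK m hm
    have hcm : 0 < c ^ (m + 1) := by positivity
    have k7' : δ m ≤ ‖a (m + 1)‖ / 2 := by
      have : c / 2 * c ^ m = c ^ (m + 1) / 2 := by ring
      linarith
    have hpos : 0 < ‖a (m + 1)‖ := by linarith
    have t1 : ‖β m‖ * ‖a (m + 1)‖ ≤ ‖α m‖ * ‖a m‖ + δ m := by
      rw [← norm_mul, ← norm_mul]
      have := norm_sub_le (α m * a m + β m * a (m + 1)) (α m * a m)
      rw [add_sub_cancel_left] at this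
      linarith
    have t2 : ‖α m‖ * ‖a (m + 1)‖ ≤ ‖β m‖ * ‖a (m + 2)‖ + δ m := by
      rw [← norm_mul, ← norm_mul]
      have := norm_sub_le (α m * a (m+1) + β m * a (m + 2)) (β m * a (m + 2))
      rw [add_sub_cancel_right] at this
      linarith
    have ham : (c ^ 2 * ρ / 16) ^ m ≤ ‖a m‖ := by
      by_contra hlt
      push Not at hlt
      have s1 : ‖β m‖ * ‖a (m + 1)‖ ≤ 2 * (c ^ 2 * ρ / 16) ^ m := by
        have := mul_le_mul_of_nonneg_right (hα m) (norm_nonneg (a m))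
        linarith
      have e : (c ^ 2 * ρ / 16) ^ m = c ^ m * c ^ m * ρ ^ m / 16 ^ m := by
        rw [div_pow, mul_pow, ← pow_mul, mul_comm 2 m, pow_mul]; ring
      have hρm : ρ ^ m ≤ 1 := pow_le_one₀ hρ.le hρ1.le
      have hcm1 : c ^ m ≤ 1 := pow_le_one₀ hc.le hc1
      have s2 : 2 * (c ^ 2 * ρ / 16) ^ m < c ^ (m + 1) := by
        rw [e, ← mul_div_assoc, div_lt_iff₀ (by positivity)]
        rw [div_lt_iff₀ hc] at k5
        have hcm0 : 0 < c ^ m := by positivity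
        calc 2 * (c ^ m * c ^ m * ρ ^ m) ≤ 2 * (c ^ m * 1 * 1) := by gcongr
          _ = c ^ m * 2 := by ring
          _ < c ^ m * (16 ^ m * c) := by gcongr
          _ = _ := by ring
      have s3 : ‖β m‖ < 1 := by
        by_contra hh
        push Not at hh
        have := mul_le_mul_of_nonneg_right hh hpos.le
        linarith
      have s4 : ‖α m‖ = 1 := by
        rcases hαβ m with h | h
        · exact h
        · linarith
      rw [s4, one_mul] at t2
      have s5 : ‖a (m + 1)‖ / 2 ≤ ‖β m‖ * (B * ρ⁻¹ ^ (m + 2)) := by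
        have := mul_le_mul_of_nonneg_left (ha (m + 2)) (norm_nonneg (β m))
        linarith
      have s6 : ‖a (m + 1)‖ * ‖a (m + 1)‖ ≤ 4 * (c ^ 2 * ρ / 16) ^ m * (B * ρ⁻¹ ^ (m + 2)) := by
        have hb : 0 ≤ B * ρ⁻¹ ^ (m + 2) := by positivity
        have := mul_le_mul_of_nonneg_right s1 hb
        have := mul_le_mul_of_nonneg_left s5 hpos.le
        nlinarith
      have s7 : c ^ (m + 1) * c ^ (m + 1) ≤ ‖a (m + 1)‖ * ‖a (m + 1)‖ := by gcongr
      have s8 : 4 * (c ^ 2 * ρ / 16) ^ m * (B * ρ⁻¹ ^ (m + 2)) =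
          c ^ (m + 1) * c ^ (m + 1) * (4 * B / ρ ^ 2 / c ^ 2 / 16 ^ m) := by
        rw [e, inv_pow]
        field_simp
        ring
      have s9 : 4 * B / ρ ^ 2 / c ^ 2 / 16 ^ m < 1 := by
        rw [div_lt_one (by positivity)]; exact k4
      have := mul_lt_mul_of_pos_left s9 (by positivity : 0 < c ^ (m + 1) * c ^ (m + 1))
      linarith
    have hαs : ‖α m‖ < c / 4 := by
      by_contra hh; push Not at hh; exact k1 ⟨ham, hh⟩
    have hb1 : ‖β m‖ = 1 := by
      rcases hαβ m with h | h
      · linarith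
      · exact h
    rw [hb1, one_mul] at t1
    have := mul_le_mul_of_nonneg_right hαs.le (norm_nonneg (a m))
    rw [div_mul_eq_mul_div, div_le_iff₀ hc]
    linarith
  have desc : ∀ j, ∀ t : ℝ, 1 ≤ t → t * c ^ (K + j) ≤ ‖a (K + j)‖ → t * 2 ^ j * c ^ K ≤ ‖a K‖ := by
    intro j
    induction j with
    | zero => intro t _ h; simpa using h
    | succ j ih =>
      intro t ht h
      have hp : 0 < c ^ (K + j + 1) := by positivity
      have hp' : 0 < c ^ (K + j) := by positivity
      have h2 : c ^ (K + j + 1) ≤ ‖a (K + j + 1)‖ := by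
        have h' : t * c ^ (K + j + 1) ≤ ‖a (K + j + 1)‖ := h
        nlinarith
      have h3 := step (K + j) (by omega) h2
      have h4 : t * 2 * c ^ (K + j) ≤ ‖a (K + j)‖ := by
        refine le_trans ?_ h3
        have h' : t * c ^ (K + j + 1) ≤ ‖a (K + j + 1)‖ := h
        calc t * 2 * c ^ (K + j) = 2 / c * (t * c ^ (K + j + 1)) := by
              field_simp; ring
          _ ≤ _ := by gcongr
      have := ih (t * 2) (by linarith) h4
      calc t * 2 ^ (j + 1) * c ^ K = t * 2 * 2 ^ j * c ^ K := by ring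
        _ ≤ _ := this
  obtain ⟨J, hJ⟩ := eventually_atTop.1
    ((tendsto_pow_atTop_atTop_of_one_lt (by norm_num : (1:ℝ) < 2)).eventually_gt_atTop
      (‖a K‖ / c ^ K))
  obtain ⟨n, hn, hn2⟩ := (frequently_atTop.1 hbig) (K + J)
  obtain ⟨j, rfl⟩ := Nat.exists_eq_add_of_le (show K ≤ n by omega)
  have h3 := desc j 1 le_rfl (by simpa using hn2)
  have h4 := hJ j (by omega)
  rw [div_lt_iff₀ (by positivity)] at h4
  linarith

lemma prop_lem (a α β : ℕ → ℂ) (δ : ℕ → ℝ) (α0 c1 : ℝ)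
    (hα0 : 0 < α0) (hc1 : 0 < c1) (hcα : c1 ≤ α0 / 2) (hδ : SE δ)
    (hα : ∀ n, ‖α n‖ ≤ 1) (hβ : ∀ n, ‖β n‖ ≤ 1) (hαβ : ∀ n, ‖α n‖ = 1 ∨ ‖β n‖ = 1)
    (h0 : ∀ᶠ n in atTop, ‖α n * a n + β n * a (n + 1)‖ ≤ δ n)
    (h1 : ∀ᶠ n in atTop, ‖α n * a (n + 1) + β n * a (n + 2)‖ ≤ δ n)
    (hst : ∃ᶠ n in atTop, c1 ^ n ≤ ‖a n‖ ∧ 2 * α0 ≤ ‖α n‖) :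
    ∀ᶠ n in atTop, c1 ^ n ≤ ‖a n‖ ∧ α0 ≤ ‖α n‖ ∧
      ‖α n * β (n + 1) - α (n + 1) * β n‖ * c1 ^ (n + 1) ≤ δ n + δ (n + 1) := by
  have hα01 : α0 ≤ 1 := by
    obtain ⟨n, hn⟩ := hst.exists
    linarith [hα n]
  have hsum : SE (fun n => δ n + δ (n + 1)) := hδ.add hδ.succ
  obtain ⟨K, hK⟩ := eventually_atTop.1 (h0.and (h1.and
    ((hδ.le_geom (α0 / 2) c1 (by positivity) hc1).and
      (hsum.le_geom (α0 / 2 * c1) (c1 / 2) (by positivity) (by positivity)))))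
  obtain ⟨n0, hn0, hs1, hs2⟩ := frequently_atTop.1 hst K
  have hDa : ∀ k ≥ K, ‖α k * β (k + 1) - α (k + 1) * β k‖ * ‖a (k + 1)‖ ≤ δ k + δ (k + 1) := by
    intro k hk
    obtain ⟨k1, k2, k3, k4⟩ := hK k hk
    obtain ⟨l1, l2, l3, l4⟩ := hK (k + 1) (by omega)
    have e : (α k * β (k + 1) - α (k + 1) * β k) * a (k + 1) =
        β (k + 1) * (α k * a (k + 1) + β k * a (k + 2)) -
        β k * (α (k + 1) * a (k + 1) + β (k + 1) * a (k + 1 + 1)) := by ring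
    rw [← norm_mul, e]
    refine (norm_sub_le _ _).trans ?_
    rw [norm_mul, norm_mul]
    have := mul_le_mul_of_nonneg_right (hβ (k+1)) (norm_nonneg (α k * a (k + 1) + β k * a (k + 2)))
    have := mul_le_mul_of_nonneg_right (hβ k)
      (norm_nonneg (α (k + 1) * a (k + 1) + β (k + 1) * a (k + 1 + 1)))
    linarith
  have hnext : ∀ k ≥ K, c1 ^ k ≤ ‖a k‖ → α0 ≤ ‖α k‖ → c1 ^ (k + 1) ≤ ‖a (k + 1)‖ := by
    intro k hk hak hαk
    obtain ⟨k1, k2, k3, k4⟩ := hK k hk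
    have t1 : ‖α k‖ * ‖a k‖ ≤ ‖β k‖ * ‖a (k + 1)‖ + δ k := by
      rw [← norm_mul, ← norm_mul]
      have := norm_sub_le (α k * a k + β k * a (k + 1)) (β k * a (k + 1))
      rw [add_sub_cancel_right] at this
      linarith
    have t2 := mul_le_mul_of_nonneg_right (hβ k) (norm_nonneg (a (k + 1)))
    have t3 : α0 * c1 ^ k ≤ ‖α k‖ * ‖a k‖ := by gcongr
    have t4 : c1 ^ (k + 1) ≤ α0 / 2 * c1 ^ k := by rw [pow_succ']; gcongr
    linarith
  have hD : ∀ k ≥ K, c1 ^ k ≤ ‖a k‖ → α0 ≤ ‖α k‖ →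
      ‖α k * β (k + 1) - α (k + 1) * β k‖ * c1 ^ (k + 1) ≤ δ k + δ (k + 1) := by
    intro k hk hak hαk
    refine le_trans ?_ (hDa k hk)
    have := hnext k hk hak hαk
    gcongr
  have ind : ∀ j, c1 ^ (n0 + j) ≤ ‖a (n0 + j)‖ ∧ α0 * (1 + (1/2) ^ j) ≤ ‖α (n0 + j)‖ := by
    intro j
    induction j with
    | zero => simp only [add_zero, pow_zero]; exact ⟨hs1, by linarith⟩
    | succ j ih =>
      obtain ⟨i1, i2⟩ := ih
      have hp : (0:ℝ) < (1/2) ^ j := by positivity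
      have i3 : α0 ≤ ‖α (n0 + j)‖ := by nlinarith
      refine ⟨hnext (n0 + j) (by omega) i1 i3, ?_⟩
      have d1 := hD (n0 + j) (by omega) i1 i3
      have d2 := (hK (n0 + j) (by omega)).2.2.2
      set k := n0 + j with hk
      set Dk := ‖α k * β (k + 1) - α (k + 1) * β k‖ with hDk
      have d3 : Dk ≤ α0 / 2 * (1/2) ^ k := by
        have : α0 / 2 * c1 * (c1 / 2) ^ k = (α0 / 2 * (1/2) ^ k) * c1 ^ (k + 1) := by
          rw [div_pow, div_pow, one_pow, pow_succ]; ring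
        have h := d1.trans d2
        rw [this] at h
        exact le_of_mul_le_mul_right h (by positivity)
      have d4 : ((1:ℝ)/2) ^ k ≤ (1/2) ^ j :=
        pow_le_pow_of_le_one (by norm_num) (by norm_num) (by omega)
      have d5 : ‖α k‖ - Dk ≤ ‖α (k + 1)‖ := by
        rcases hαβ (k + 1) with h | h
        · rw [h]; linarith [hα k, norm_nonneg (α k * β (k + 1) - α (k + 1) * β k)]
        · have t := norm_add_le (α k * β (k + 1) - α (k + 1) * β k) (α (k + 1) * β k)
          rw [sub_add_cancel, norm_mul, h, norm_mul] at t
          have := mul_le_mul_of_nonneg_left (hβ k) (norm_nonneg (α (k + 1)))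
          linarith
      have d6 : α0 * (1 + (1/2) ^ (j + 1)) = α0 * (1 + (1/2) ^ j) - α0 / 2 * (1/2) ^ j := by
        rw [pow_succ]; ring
      have d7 : α0 / 2 * (1/2) ^ k ≤ α0 / 2 * (1/2) ^ j := by gcongr
      show α0 * (1 + (1/2) ^ (j + 1)) ≤ ‖α (k + 1)‖
      linarith
  filter_upwards [eventually_ge_atTop n0] with n hn
  obtain ⟨j, rfl⟩ := Nat.exists_eq_add_of_le hn
  obtain ⟨i1, i2⟩ := ind j
  have hp : (0:ℝ) < (1/2) ^ j := by positivity
  have i3 : α0 ≤ ‖α (n0 + j)‖ := by nlinarith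
  exact ⟨i1, i3, hD _ (by omega) i1 i3⟩

set_option maxHeartbeats 1000000 in
lemma seq_lem (a α β : ℕ → ℂ) (ε : ℕ → ℝ) (B ρ r : ℝ) (hρ : 0 < ρ) (hρ1 : ρ < 1)
    (hr : 0 < r) (hr1 : r < 1) (hB : 0 ≤ B)
    (ha : ∀ k, ‖a k‖ ≤ B * ρ⁻¹ ^ k) (hε : SE ε) (hε0 : ∀ n, 0 ≤ ε n)
    (hα : ∀ n, ‖α n‖ ≤ 1) (hβ : ∀ n, ‖β n‖ ≤ 1) (hαβ : ∀ n, ‖α n‖ = 1 ∨ ‖β n‖ = 1)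
    (H : ∀ᶠ n in atTop, ∀ S : ℝ, (∀ j ≥ n, ‖α n * a j + β n * a (j + 1)‖ * ρ ^ j ≤ S) →
      ∀ k ≥ n, ‖α n * a k + β n * a (k + 1)‖ * r ^ k ≤ ε n * S)
    (hne : ¬ SE (fun n => ‖a n‖)) :
    ∃ q : ℂ, ∃ K, ∀ k ≥ K, a k + q * a (k + 1) = 0 := by
  have ha' : ∀ k, ‖a k‖ * ρ ^ k ≤ B := by
    intro k
    have := ha k
    rw [inv_pow, ← div_eq_mul_inv, le_div_iff₀ (by positivity)] at this
    exact this
  have ha'' : ∀ k, ‖a (k + 1)‖ * ρ ^ k ≤ B / ρ := by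
    intro k
    rw [le_div_iff₀ hρ]
    have := ha' (k + 1)
    rw [pow_succ] at this
    linarith
  -- δ
  set δ : ℕ → ℝ := fun n => (B + B / ρ) / r * r⁻¹ ^ n * ε n with hδdef
  have hδ : SE δ := hε.mul _ _ (by positivity) (by positivity)
  have Hb : ∀ᶠ n in atTop, ∀ k ≥ n, ‖α n * a k + β n * a (k + 1)‖ * r ^ k ≤ ε n * (B + B / ρ) := by
    filter_upwards [H] with n hn
    apply hn
    intro j _
    have t := norm_add_le (α n * a j) (β n * a (j + 1))
    rw [norm_mul, norm_mul] at t
    have t1 := mul_le_mul_of_nonneg_right (hα n) (norm_nonneg (a j))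
    have t2 := mul_le_mul_of_nonneg_right (hβ n) (norm_nonneg (a (j + 1)))
    have t3 : ‖α n * a j + β n * a (j + 1)‖ ≤ ‖a j‖ + ‖a (j + 1)‖ := by linarith
    have := mul_le_mul_of_nonneg_right t3 (pow_nonneg hρ.le j)
    linarith [ha' j, ha'' j]
  have hrn : ∀ n : ℕ, r ^ (n + 1) ≤ r ^ n := fun n =>
    pow_le_pow_of_le_one hr.le hr1.le (by omega)
  have hδe : ∀ n x, x * r ^ (n + 1) ≤ ε n * (B + B / ρ) → x ≤ δ n := by
    intro n x h
    rw [← le_div_iff₀ (by positivity)] at h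
    refine h.trans (le_of_eq ?_)
    rw [hδdef]; simp only [inv_pow]; rw [pow_succ]; field_simp
  have h0 : ∀ᶠ n in atTop, ‖α n * a n + β n * a (n + 1)‖ ≤ δ n := by
    filter_upwards [Hb] with n hn
    apply hδe
    refine le_trans ?_ (hn n le_rfl)
    have := hrn n
    gcongr
  have h1 : ∀ᶠ n in atTop, ‖α n * a (n + 1) + β n * a (n + 2)‖ ≤ δ n := by
    filter_upwards [Hb] with n hn
    exact hδe _ _ (hn (n + 1) (by omega))
  -- start
  have hbig : ∃ c : ℝ, 0 < c ∧ c ≤ 1 ∧ ∃ᶠ n in atTop, c ^ n ≤ ‖a n‖ := by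
    simp only [SE] at hne
    push Not at hne
    obtain ⟨η, hη, h⟩ := hne
    refine ⟨min η 1, by positivity, min_le_right _ _, h.mono fun n hn => ?_⟩
    refine le_trans ?_ hn.le
    gcongr
    exact min_le_left _ _
  obtain ⟨c, hc, hc1, hbig⟩ := hbig
  have hst := start_lem a α β δ B ρ c hρ hρ1 hB ha hδ hα hβ hαβ h0 h1 hc hc1 hbig
  set c1 := c ^ 2 * ρ / 16 with hc1def
  have hc1pos : 0 < c1 := by positivity
  set α0 := c / 8 with hα0def
  have hα0 : 0 < α0 := by positivity
  have hP := prop_lem a α β δ α0 c1 hα0 hc1pos (by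
      have : c ^ 2 * ρ ≤ c := by nlinarith [mul_pos hc hρ]
      rw [hc1def, hα0def]; linarith) hδ hα hβ hαβ h0 h1
    (hst.mono fun n hn => ⟨hn.1, by rw [hα0def]; linarith [hn.2]⟩)
  -- limit
  set s : ℕ → ℂ := fun n => β n / α n with hs
  have hsd : SE (fun n => ‖s (n + 1) - s n‖) := by
    refine ((hδ.add hδ.succ).mul ((α0 ^ 2 * c1)⁻¹) c1⁻¹ (by positivity) (by positivity)).mono ?_
    filter_upwards [hP, (tendsto_add_atTop_nat 1).eventually hP] with n hn hn'
    have a1 : α n ≠ 0 := norm_pos_iff.1 (by linarith [hn.2.1])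
    have a2 : α (n + 1) ≠ 0 := norm_pos_iff.1 (by linarith [hn'.2.1])
    have e : s (n + 1) - s n = (α n * β (n + 1) - α (n + 1) * β n) / (α n * α (n + 1)) := by
      rw [hs]; field_simp; 
    rw [e, norm_div, norm_mul (α n)]
    rw [div_le_iff₀ (by positivity)]
    have t1 : α0 ^ 2 ≤ ‖α n‖ * ‖α (n + 1)‖ := by
      rw [pow_two]; exact mul_le_mul hn.2.1 hn'.2.1 hα0.le (norm_nonneg _)
    have t2 := hn.2.2
    rw [← le_div_iff₀ (by positivity)] at t2
    have t0 : 0 ≤ δ n + δ (n + 1) := by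
      have := hε0 n
      have := hε0 (n + 1)
      rw [hδdef]; positivity
    refine t2.trans ?_
    calc (δ n + δ (n + 1)) / c1 ^ (n + 1)
        = (α0 ^ 2 * c1)⁻¹ * c1⁻¹ ^ n * (δ n + δ (n + 1)) * α0 ^ 2 := by
          rw [inv_pow, pow_succ]; field_simp
      _ ≤ _ := by gcongr
  obtain ⟨q, hq⟩ := hsd.limit
  refine ⟨q, ?_⟩
  set v : ℕ → ℂ := fun k => a k + q * a (k + 1) with hv
  by_contra hcon
  push Not at hcon
  have hvSE : SE (fun k => ‖v k‖) := by
    refine ((hδ.mul α0⁻¹ 1 (by positivity) one_pos).add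
      (hq.mul (B / ρ) ρ⁻¹ (by positivity) (by positivity))).mono ?_
    filter_upwards [hP, h0] with n hn hn0
    have a1 : α n ≠ 0 := norm_pos_iff.1 (by linarith [hn.2.1])
    have e : v n = (α n * a n + β n * a (n + 1)) / α n - (s n - q) * a (n + 1) := by
      rw [hv, hs]; field_simp; ring
    rw [e]
    refine (norm_sub_le _ _).trans ?_
    rw [norm_div, norm_mul]
    have t1 : ‖α n * a n + β n * a (n + 1)‖ / ‖α n‖ ≤ α0⁻¹ * 1 ^ n * δ n := by
      rw [one_pow, mul_one, inv_mul_eq_div]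
      have := hn.2.1
      exact div_le_div₀ ((norm_nonneg _).trans hn0) hn0 hα0 this
    have t2 : ‖s n - q‖ * ‖a (n + 1)‖ ≤ B / ρ * ρ⁻¹ ^ n * ‖s n - q‖ := by
      have : ‖a (n + 1)‖ ≤ B / ρ * ρ⁻¹ ^ n := by
        rw [inv_pow, ← div_eq_mul_inv, le_div_iff₀ (by positivity)]
        exact ha'' n
      rw [mul_comm]
      gcongr
    linarith
  set M : ℝ := 2 * (‖q‖ + 1) with hM
  have hM2 : 2 ≤ M := by rw [hM]; linarith [norm_nonneg q]
  have hM0 : 0 < M := by linarith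
  have hvM : Tendsto (fun k => ‖v k‖ * M ^ k) atTop (nhds 0) := by
    have h2 := hvSE.mul 1 M zero_le_one hM0 (1/2) (by norm_num)
    refine squeeze_zero' (Eventually.of_forall fun k => by positivity) ?_
      (tendsto_pow_atTop_nhds_zero_of_lt_one (by norm_num) (by norm_num : (1/2:ℝ) < 1))
    filter_upwards [h2] with k hk
    rw [one_mul, mul_comm] at hk
    exact hk
  have hrec := exists_record hvM (by
    rw [frequently_atTop]
    intro K
    obtain ⟨k, hk, hk2⟩ := hcon K
    refine ⟨k, hk, ?_⟩
    have : 0 < ‖v k‖ := norm_pos_iff.2 hk2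
    positivity)
  set τ : ℕ → ℝ := fun n => 1 / (α0 * r) * r⁻¹ ^ n * ε n with hτ
  have hτSE : SE τ := hε.mul _ _ (by positivity) (by positivity)
  set C := 4 * (1 + ‖q‖) * (B / ρ) * 2 + B / ρ + 1 with hC
  have hC0 : 0 < C := by positivity
  have ev1 := hτSE.le_geom (1 / (4 * (1 + ‖q‖))) 1 (by positivity) one_pos
  have ev2 := hτSE.le_geom (c1 / 2 / C) c1 (by positivity) hc1pos
  have ev3 := hq 1 one_pos
  obtain ⟨n, ⟨hvn, hrecn⟩, hPn, hPn1, hHn, e1, e2, e3⟩ :=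
    (hrec.and_eventually (hP.and (((tendsto_add_atTop_nat 1).eventually hP).and
      (H.and (ev1.and (ev2.and ev3)))))).exists
  have hvn0 : 0 < ‖v n‖ := by
    by_contra hh
    have : ‖v n‖ = 0 := le_antisymm (not_lt.1 hh) (norm_nonneg _)
    rw [this] at hvn; simp at hvn
  set θ := s n - q with hθ
  rw [one_pow] at e3
  have a1 : α n ≠ 0 := norm_pos_iff.1 (by linarith [hPn.2.1])
  have hu : ∀ k, α n * a k + β n * a (k + 1) = α n * (v k + θ * a (k + 1)) := by
    intro k
    rw [hθ, hv, hs]; field_simp; ring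
  have hvj : ∀ j ≥ n, ‖v j‖ * ρ ^ j ≤ ‖v n‖ := by
    intro j hj
    have t := hrecn j hj
    obtain ⟨i, rfl⟩ := Nat.exists_eq_add_of_le hj
    have t' : ‖v (n + i)‖ * M ^ i ≤ ‖v n‖ := by
      simp only [pow_add] at t
      have hMn : 0 < M ^ n := by positivity
      refine le_of_mul_le_mul_right ?_ hMn
      linarith
    have hρ' : ρ ^ (n + i) ≤ 1 := pow_le_one₀ hρ.le hρ1.le
    have hM' : 1 ≤ M ^ i := one_le_pow₀ (by linarith)
    calc ‖v (n + i)‖ * ρ ^ (n + i) ≤ ‖v (n + i)‖ * M ^ i := by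
          gcongr; linarith
      _ ≤ _ := t'
  set S := ‖v n‖ + ‖θ‖ * (B / ρ) with hS
  have hS0 : 0 ≤ S := by positivity
  have hX := hHn S (by
    intro j hj
    rw [hu, norm_mul]
    have t1 : ‖α n‖ * ‖v j + θ * a (j + 1)‖ ≤ ‖v j‖ + ‖θ‖ * ‖a (j + 1)‖ := by
      have := mul_le_mul_of_nonneg_right (hα n) (norm_nonneg (v j + θ * a (j + 1)))
      have h := norm_add_le (v j) (θ * a (j + 1))
      rw [norm_mul] at h
      linarith
    have t2 := mul_le_mul_of_nonneg_right t1 (pow_nonneg hρ.le j)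
    have t3 := mul_le_mul_of_nonneg_left (ha'' j) (norm_nonneg θ)
    have := hvj j hj
    rw [hS]; nlinarith)
  have hτ0 : 0 ≤ τ n := by
    have := hε0 n
    rw [hτ]; positivity
  have hY : ∀ k, n ≤ k → k ≤ n + 1 → ‖v k + θ * a (k + 1)‖ ≤ τ n * S := by
    intro k hk hk'
    have t := hX k hk
    rw [hu, norm_mul] at t
    have hrk : r ^ (n + 1) ≤ r ^ k := pow_le_pow_of_le_one hr.le hr1.le hk'
    have t1 : ‖v k + θ * a (k + 1)‖ * (α0 * r ^ (n + 1)) ≤ ε n * S := by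
      refine le_trans ?_ t
      calc ‖v k + θ * a (k + 1)‖ * (α0 * r ^ (n + 1))
          ≤ ‖v k + θ * a (k + 1)‖ * (‖α n‖ * r ^ k) := by
            have := hPn.2.1
            gcongr
        _ = _ := by ring
    rw [← le_div_iff₀ (by positivity)] at t1
    refine t1.trans (le_of_eq ?_)
    rw [hτ]; simp only [inv_pow]; rw [pow_succ]; field_simp
  have y0 := hY n le_rfl (by omega)
  have y1 := hY (n + 1) (by omega) le_rfl
  have hv1 : ‖v (n + 1)‖ * M ≤ ‖v n‖ := by
    have t := hrecn (n + 1) (by omega)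
    simp only [pow_succ] at t
    have hMn : 0 < M ^ n := by positivity
    refine le_of_mul_le_mul_right ?_ hMn
    linarith
  have z1 : ‖v n‖ ≤ 2 * (1 + ‖q‖) * (τ n * S) := by
    have e : v n = (v n + θ * a (n + 1)) + q * (v (n + 1) + θ * a (n + 1 + 1))
        - (q + θ) * v (n + 1) := by
      simp only [hv]; ring
    have t1 : ‖v n‖ ≤ ‖v n + θ * a (n + 1)‖ + ‖q‖ * ‖v (n + 1) + θ * a (n + 1 + 1)‖
        + (‖q‖ + ‖θ‖) * ‖v (n + 1)‖ := by
      conv_lhs => rw [e]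
      refine (norm_sub_le _ _).trans ?_
      refine add_le_add ((norm_add_le _ _).trans ?_) ?_
      · rw [norm_mul q]
      · rw [norm_mul]
        have := norm_add_le q θ
        gcongr
    have t2 := mul_le_mul_of_nonneg_left y1 (norm_nonneg q)
    have t3 : (‖q‖ + ‖θ‖) * ‖v (n + 1)‖ ≤ (‖q‖ + 1) * ‖v (n + 1)‖ := by gcongr
    rw [hM] at hv1
    linarith
  have hb : 0 ≤ B / ρ := by positivity
  rw [one_pow, mul_one, le_div_iff₀ (by positivity)] at e1
  have z2 : ‖v n‖ ≤ 4 * (1 + ‖q‖) * (B / ρ) * τ n * ‖θ‖ := by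
    have := mul_le_mul_of_nonneg_right e1 hvn0.le
    rw [hS] at z1
    linarith
  have z3 : ‖θ‖ * ‖a (n + 1)‖ ≤ ‖v n‖ + τ n * S := by
    rw [← norm_mul]
    have := norm_sub_le (v n + θ * a (n + 1)) (v n)
    rw [add_sub_cancel_left] at this
    linarith
  have hτ1 : τ n ≤ 1 := by nlinarith [norm_nonneg q]
  have z4 : ‖θ‖ * ‖a (n + 1)‖ ≤ C * τ n * ‖θ‖ := by
    have := mul_le_mul_of_nonneg_right hτ1 hvn0.le
    have := mul_nonneg hτ0 (norm_nonneg θ)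
    rw [hS] at z3
    rw [hC]
    linarith
  have z5 : C * τ n ≤ c1 ^ (n + 1) / 2 := by
    have := mul_le_mul_of_nonneg_left e2 hC0.le
    refine this.trans (le_of_eq ?_)
    rw [pow_succ]; field_simp
  have hcn : 0 < c1 ^ (n + 1) := by positivity
  have z6 : ‖θ‖ = 0 := by
    by_contra hh
    have hpos : 0 < ‖θ‖ := lt_of_le_of_ne (norm_nonneg _) (Ne.symm hh)
    have t1 := mul_le_mul_of_nonneg_left hPn1.1 hpos.le
    have t2 := mul_le_mul_of_nonneg_right z5 hpos.le
    nlinarith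
  rw [z6, mul_zero] at z2
  linarith

lemma hasSum_cc {u v : ℕ → ℂ} {x y : ℂ} (h : HasSum u x) (e : ∀ k, v k = u k) (e' : y = x) :
    HasSum v y := by
  have : v = u := funext e
  rw [this, e']; exact h

lemma coeff_bound (F : ℂ → ℂ) (c : ℕ → ℂ) (r C : ℝ) (hr : 0 < r) (hr1 : r < 1)
    (hF : DifferentiableOn ℂ F (ball (0 : ℂ) 1))
    (hs : ∀ w ∈ ball (0 : ℂ) 1, HasSum (fun k => c k * w ^ k) (F w))
    (hC : ∀ z ∈ sphere (0 : ℂ) r, ‖F z‖ ≤ C) (k : ℕ) : ‖c k‖ * r ^ k ≤ C := by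
  have hp : HasFPowerSeriesOnBall F (FormalMultilinearSeries.ofScalars ℂ c) 0
      ((1/2 : NNReal) : ENNReal) := by
    constructor
    · apply FormalMultilinearSeries.le_radius_of_summable
      have h := (hs (1/2) (by simp; norm_num)).summable.norm
      simpa [norm_mul] using h
    · simp
    · intro y hy
      have hy' : ‖y‖ < 1 := by
        rw [Metric.eball_coe, mem_ball_zero_iff] at hy
        refine hy.trans ?_
        norm_num
      have h := hs y (by simpa using hy')
      simpa [FormalMultilinearSeries.ofScalars_apply_eq, mul_comm] using h
  have h1 := hp.factorial_smul (1 : ℂ) k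
  rw [← iteratedDeriv_eq_iteratedFDeriv] at h1
  have h2 := Complex.norm_iteratedDeriv_le_of_forall_mem_sphere_norm_le k hr
    ((hF.mono (by
      rw [closure_ball _ hr.ne']; exact closedBall_subset_ball hr1)).diffContOnCl) hC
  rw [← h1] at h2
  have h3 : (FormalMultilinearSeries.ofScalars ℂ c k) (fun _ => (1:ℂ)) = c k := by
    simp
  rw [h3, nsmul_eq_mul, norm_mul, Complex.norm_natCast, mul_div_assoc] at h2
  have h4 := le_of_mul_le_mul_left h2 (by positivity)
  rwa [le_div_iff₀ (by positivity)] at h4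

lemma blaschke_factor (r R : ℝ) (hr : 0 < r) (hR : r < R) (z w : ℂ) (hz : ‖z‖ ≤ r) (hw : ‖w‖ ≤ r) :
    R * ‖w - z‖ ≤ Real.sqrt (1 - ((R ^ 2 - r ^ 2) / (2 * R ^ 2)) ^ 2) *
      ‖(R : ℂ) ^ 2 - (starRingEnd ℂ) z * w‖ := by
  have hR0 : 0 < R := by linarith
  have e : ‖(R : ℂ) ^ 2 - (starRingEnd ℂ) z * w‖ ^ 2 - R ^ 2 * ‖w - z‖ ^ 2 =
      (R ^ 2 - ‖z‖ ^ 2) * (R ^ 2 - ‖w‖ ^ 2) := by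
    simp only [← Complex.normSq_eq_norm_sq, Complex.normSq_apply]
    simp [pow_two]
    ring
  set d := ‖(R : ℂ) ^ 2 - (starRingEnd ℂ) z * w‖ with hd
  have hd1 : d ≤ 2 * R ^ 2 := by
    refine (norm_sub_le _ _).trans ?_
    rw [norm_mul, norm_pow, Complex.norm_conj, Complex.norm_real, Real.norm_of_nonneg hR0.le]
    have : ‖z‖ * ‖w‖ ≤ R * R := by
      apply mul_le_mul <;> first | linarith | positivity
    nlinarith
  set t := (R ^ 2 - r ^ 2) / (2 * R ^ 2) with ht
  have ht0 : 0 ≤ t := by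
    rw [ht]; apply div_nonneg _ (by positivity); nlinarith
  have ht1 : t * d ≤ R ^ 2 - r ^ 2 := by
    calc t * d ≤ t * (2 * R ^ 2) := by gcongr
      _ = _ := by rw [ht]; field_simp
  have hz2 : ‖z‖ ^ 2 ≤ r ^ 2 := by gcongr
  have hw2 : ‖w‖ ^ 2 ≤ r ^ 2 := by gcongr
  have hrR : 0 ≤ R ^ 2 - r ^ 2 := by nlinarith
  have h1 : (t * d) ^ 2 ≤ (R ^ 2 - ‖z‖ ^ 2) * (R ^ 2 - ‖w‖ ^ 2) := by
    rw [pow_two]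
    apply mul_le_mul <;> first | linarith | positivity
  have h2 : (R * ‖w - z‖) ^ 2 ≤ (1 - t ^ 2) * d ^ 2 := by nlinarith
  have h3 := Real.sqrt_le_sqrt h2
  rw [Real.sqrt_sq (by positivity), Real.sqrt_mul' _ (by positivity),
    Real.sqrt_sq (by positivity)] at h3
  exact h3

lemma blaschke_eq (R : ℝ) (hR0 : 0 < R) (z w : ℂ) (hw : ‖w‖ = R) :
    R * ‖w - z‖ = ‖(R : ℂ) ^ 2 - (starRingEnd ℂ) z * w‖ := by
  have e : ‖(R : ℂ) ^ 2 - (starRingEnd ℂ) z * w‖ ^ 2 - R ^ 2 * ‖w - z‖ ^ 2 =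
      (R ^ 2 - ‖z‖ ^ 2) * (R ^ 2 - ‖w‖ ^ 2) := by
    simp only [← Complex.normSq_eq_norm_sq, Complex.normSq_apply]
    simp [pow_two]
    ring
  rw [hw] at e
  rw [← pow_left_inj₀ (by positivity) (by positivity) two_ne_zero]
  nlinarith

lemma blaschke_s13 (r R A : ℝ) (hr : 0 < r) (hR : r < R) (hR1 : R < 1) (N : ℕ) (z : Fin N → ℂ)
    (hz : ∀ i, z i ∈ closedBall (0 : ℂ) r) (F h : ℂ → ℂ)
    (hh : DifferentiableOn ℂ h (ball (0 : ℂ) 1))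
    (hF : ∀ w ∈ ball (0 : ℂ) 1, F w = (∏ i, (w - z i)) * h w)
    (hA : ∀ w ∈ sphere (0 : ℂ) R, ‖F w‖ ≤ A) (w : ℂ) (hw : w ∈ closedBall (0 : ℂ) r) :
    ‖F w‖ ≤ Real.sqrt (1 - ((R ^ 2 - r ^ 2) / (2 * R ^ 2)) ^ 2) ^ N * A := by
  have hR0 : 0 < R := by linarith
  set q := Real.sqrt (1 - ((R ^ 2 - r ^ 2) / (2 * R ^ 2)) ^ 2) with hq
  set g : ℂ → ℂ := fun w => (∏ i, ((R : ℂ) ^ 2 - (starRingEnd ℂ) (z i) * w)) * h w with hg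
  have hgd : DifferentiableOn ℂ g (ball (0 : ℂ) 1) := by
    apply DifferentiableOn.mul _ hh
    apply Differentiable.differentiableOn
    fun_prop
  have hw1 : w ∈ closure (ball (0 : ℂ) R) := by
    rw [closure_ball _ hR0.ne']
    exact closedBall_subset_closedBall hR.le hw
  have hsub : closedBall (0:ℂ) R ⊆ ball 0 1 := closedBall_subset_ball hR1
  have hgb : ‖g w‖ ≤ R ^ N * A := by
    apply Complex.norm_le_of_forall_mem_frontier_norm_le (U := ball (0:ℂ) R) isBounded_ball _ _ hw1
    · apply DifferentiableOn.diffContOnCl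
      rw [closure_ball _ hR0.ne']
      exact hgd.mono hsub
    · intro t ht
      rw [frontier_ball _ hR0.ne'] at ht
      have h1 := hA t ht
      rw [hF t (hsub (sphere_subset_closedBall ht)), norm_mul, norm_prod] at h1
      rw [mem_sphere_zero_iff_norm] at ht
      rw [hg]
      simp only
      rw [norm_mul, norm_prod]
      have : ∀ i, ‖(R : ℂ) ^ 2 - (starRingEnd ℂ) (z i) * t‖ = R * ‖t - z i‖ := fun i =>
        (blaschke_eq R hR0 (z i) t ht).symm
      simp only [this]
      rw [Finset.prod_mul_distrib]
      simp only [Finset.prod_const, Finset.card_univ, Fintype.card_fin]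
      rw [mul_assoc]
      gcongr
  rw [hF w (closedBall_subset_ball (hR.trans hR1) hw), norm_mul, norm_prod]
  have hp : R ^ N * ∏ i, ‖w - z i‖ ≤ q ^ N * ∏ i, ‖(R : ℂ) ^ 2 - (starRingEnd ℂ) (z i) * w‖ := by
    have : ∏ i, (R * ‖w - z i‖) ≤ ∏ i, (q * ‖(R : ℂ) ^ 2 - (starRingEnd ℂ) (z i) * w‖) := by
      apply Finset.prod_le_prod
      · intro i _; positivity
      · intro i _
        exact blaschke_factor r R hr hR (z i) w (by simpa using hz i) (by simpa using hw)
    rw [Finset.prod_mul_distrib, Finset.prod_mul_distrib] at this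
    simpa using this
  rw [hg] at hgb
  simp only [norm_mul, norm_prod] at hgb
  have hRN : 0 < R ^ N := by positivity
  have hqN : 0 ≤ q ^ N := by positivity
  refine le_of_mul_le_mul_left ?_ hRN
  have h1 := mul_le_mul_of_nonneg_right hp (norm_nonneg (h w))
  have h2 := mul_le_mul_of_nonneg_left hgb hqN
  linarith

lemma core (f : ℂ → ℂ) (a : ℕ → ℂ) (r R ρ : ℝ) (hr : 0 < r) (hR : r < R) (hρ : R < ρ) (hρ1 : ρ < 1)
    (hf : DifferentiableOn ℂ f (ball (0 : ℂ) 1))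
    (hs : ∀ w ∈ ball (0 : ℂ) 1, HasSum (fun k => a k * w ^ k) (f w))
    (α β : ℂ) (n N : ℕ) (P : Polynomial ℂ) (hP : P.degree ≤ (n : ℕ)) (z : Fin N → ℂ)
    (hz : ∀ i, z i ∈ closedBall (0 : ℂ) r) (h : ℂ → ℂ)
    (hh : DifferentiableOn ℂ h (ball (0 : ℂ) 1))
    (hF : ∀ w ∈ ball (0 : ℂ) 1, (α * w + β) * f w - P.eval w = (∏ i, (w - z i)) * h w)
    (q : ℝ) (hq : q = Real.sqrt (1 - ((R ^ 2 - r ^ 2) / (2 * R ^ 2)) ^ 2))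
    (hsmall : q ^ N * ((n + 1) * (R / r) ^ n) ≤ 1 / 2)
    (S : ℝ) (hS : ∀ j ≥ n, ‖α * a j + β * a (j + 1)‖ * ρ ^ j ≤ S) (k : ℕ) (hk : n ≤ k) :
    ‖α * a k + β * a (k + 1)‖ * r ^ k ≤ (2 / (1 - R / ρ) / r * q ^ N) * S := by
  have hR0 : 0 < R := by linarith
  have hρ0 : 0 < ρ := by linarith
  have hR1 : R < 1 := by linarith
  have hr1 : r < 1 := by linarith
  set F : ℂ → ℂ := fun w => (α * w + β) * f w - P.eval w with hFdef
  have hFd : DifferentiableOn ℂ F (ball (0 : ℂ) 1) := by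
    apply DifferentiableOn.sub
    · apply DifferentiableOn.mul _ hf
      apply Differentiable.differentiableOn
      fun_prop
    · exact P.differentiable.differentiableOn
  set u : ℕ → ℂ := fun k => (match k with | 0 => 0 | (j + 1) => α * a j) + β * a k with hu
  set c : ℕ → ℂ := fun k => u k - P.coeff k with hc
  have hFs : ∀ w ∈ ball (0 : ℂ) 1, HasSum (fun k => c k * w ^ k) (F w) := by
    intro w hw
    have h1 : HasSum (fun k => (match k with | 0 => 0 | (j + 1) => α * a j) * w ^ k)
        (α * w * f w) := by
      rw [← hasSum_nat_add_iff' 1]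
      simp only [Finset.range_one, Finset.sum_singleton, zero_mul, sub_zero]
      refine hasSum_cc ((hs w hw).mul_left (α * w)) (fun k => ?_) rfl
      ring
    have h2 : HasSum (fun k => β * a k * w ^ k) (β * f w) := by
      refine hasSum_cc ((hs w hw).mul_left β) (fun k => ?_) rfl
      ring
    have h3 : HasSum (fun k => P.coeff k * w ^ k) (P.eval w) := by
      rw [Polynomial.eval_eq_sum_range]
      apply hasSum_sum_of_ne_finset_zero
      intro b hb
      rw [Polynomial.coeff_eq_zero_of_natDegree_lt (by simpa using hb), zero_mul]
    refine hasSum_cc ((h1.add h2).sub h3) (fun k => ?_) ?_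
    · simp only [hc, hu]; ring
    · simp only [hFdef]; ring
  have hcu : ∀ j, n ≤ j → c (j + 1) = α * a j + β * a (j + 1) := by
    intro j hj
    have : P.coeff (j + 1) = 0 := Polynomial.coeff_eq_zero_of_degree_lt
      (lt_of_le_of_lt hP (by exact_mod_cast Nat.lt_succ_of_le hj))
    simp only [hc, hu, this, sub_zero]
  -- max on sphere r
  obtain ⟨w0, hw0, hmax⟩ := (isCompact_sphere (0:ℂ) r).exists_isMaxOn
    (NormedSpace.sphere_nonempty.2 hr.le)
    ((hFd.continuousOn.mono (sphere_subset_closedBall.trans (closedBall_subset_ball hr1))).norm)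
  set C := ‖F w0‖ with hCdef
  have hcb : ∀ k, ‖c k‖ * r ^ k ≤ C := coeff_bound F c r C hr hr1 hFd hFs (fun z hz => hmax hz)
  have hC0 : 0 ≤ C := norm_nonneg _
  have hS0 : 0 ≤ S := le_trans (by positivity) (hS n le_rfl)
  have hx : R / ρ < 1 := by rw [div_lt_one hρ0]; exact hρ
  have hx0 : 0 < R / ρ := by positivity
  have hx1 : 0 < 1 - R / ρ := by linarith
  have hgeo : Summable (fun j : ℕ => S * (R / ρ) ^ j) :=
    (summable_geometric_of_lt_one hx0.le hx).mul_left S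
  have hA : ∀ w ∈ sphere (0 : ℂ) R, ‖F w‖ ≤ C * ((n + 1) * (R / r) ^ n) + S / (1 - R / ρ) := by
    intro w hw
    have hwb : w ∈ ball (0:ℂ) 1 := closedBall_subset_ball hR1 (sphere_subset_closedBall hw)
    rw [mem_sphere_zero_iff_norm] at hw
    have hsum := hFs w hwb
    rw [← hasSum_nat_add_iff' (n + 1)] at hsum
    have e : F w = (F w - ∑ i ∈ Finset.range (n + 1), c i * w ^ i)
        + ∑ i ∈ Finset.range (n + 1), c i * w ^ i := by ring
    rw [e]
    have b1 : ‖∑ i ∈ Finset.range (n + 1), c i * w ^ i‖ ≤ C * ((n + 1) * (R / r) ^ n) := by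
      have : ∀ i ∈ Finset.range (n + 1), ‖c i * w ^ i‖ ≤ C * (R / r) ^ n := by
        intro i hi
        rw [norm_mul, norm_pow, hw]
        have h1 : ‖c i‖ ≤ C / r ^ i := by
          rw [le_div_iff₀ (by positivity)]; exact hcb i
        calc ‖c i‖ * R ^ i ≤ C / r ^ i * R ^ i := by gcongr
          _ = C * (R / r) ^ i := by rw [div_pow]; ring
          _ ≤ C * (R / r) ^ n := by
            gcongr
            · rw [le_div_iff₀ hr]; linarith
            · have := Finset.mem_range.1 hi; omega
      refine (norm_sum_le_of_le _ this).trans ?_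
      simp only [Finset.sum_const, Finset.card_range, nsmul_eq_mul]
      push_cast
      apply le_of_eq; ring
    have b2 : ‖F w - ∑ i ∈ Finset.range (n + 1), c i * w ^ i‖ ≤ S / (1 - R / ρ) := by
      rw [← hsum.tsum_eq]
      have hle : ∀ j, ‖c (j + (n + 1)) * w ^ (j + (n + 1))‖ ≤ S * (R / ρ) ^ j := by
        intro j
        rw [norm_mul, norm_pow, hw, ← add_assoc, hcu (j + n) (by omega)]
        have h1 := hS (j + n) (by omega)
        rw [← le_div_iff₀ (by positivity)] at h1
        calc _ ≤ S / ρ ^ (j + n) * R ^ (j + n + 1) := by gcongr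
          _ = S * (R / ρ) ^ j * ((R / ρ) ^ n * R) := by
            rw [div_pow, div_pow, pow_add, pow_succ, pow_add]; field_simp
          _ ≤ S * (R / ρ) ^ j * (1 * 1) := by
            gcongr
            exact pow_le_one₀ hx0.le hx.le
          _ = _ := by ring
      have hsm : HasSum (fun j : ℕ => S * (R / ρ) ^ j) (S / (1 - R / ρ)) := by
        rw [div_eq_mul_inv]
        exact (hasSum_geometric_of_lt_one hx0.le hx).mul_left S
      exact tsum_of_norm_bounded hsm hle
    have := norm_add_le (F w - ∑ i ∈ Finset.range (n + 1), c i * w ^ i)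
      (∑ i ∈ Finset.range (n + 1), c i * w ^ i)
    linarith
  have hB := blaschke_s13 r R _ hr hR hR1 N z hz F h hh hF hA w0 (sphere_subset_closedBall hw0)
  rw [← hq] at hB
  have hq0 : 0 ≤ q ^ N := by rw [hq]; positivity
  have h1 := mul_le_mul_of_nonneg_left hsmall hC0
  have h2 : C ≤ 2 * (q ^ N * (S / (1 - R / ρ))) := by
    have : ‖F w0‖ = C := rfl
    nlinarith
  have h3 := hcb (k + 1)
  rw [hcu k hk, pow_succ] at h3
  have h4 : ‖α * a k + β * a (k + 1)‖ * r ^ k ≤ C / r := by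
    rw [le_div_iff₀ hr]; linarith
  refine h4.trans ?_
  rw [div_le_iff₀ hr]
  refine h2.trans (le_of_eq ?_)
  field_simp

lemma SE_pow (q : ℝ) (hq0 : 0 ≤ q) (hq1 : q < 1) (N : ℕ → ℕ)
    (hN : Tendsto (fun n : ℕ => (N n : ℝ) / (n : ℝ)) atTop atTop) : SE (fun n => q ^ N n) := by
  intro η hη
  obtain ⟨L, hL⟩ := exists_pow_lt_of_lt_one hη hq1
  filter_upwards [hN.eventually_ge_atTop (L : ℝ), eventually_gt_atTop 0] with n hn hn0
  have hn0' : (0:ℝ) < n := by exact_mod_cast hn0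
  rw [le_div_iff₀ hn0'] at hn
  have hn' : L * n ≤ N n := by exact_mod_cast hn
  calc q ^ N n ≤ q ^ (L * n) := pow_le_pow_of_le_one hq0 hq1.le hn'
    _ = (q ^ L) ^ n := pow_mul _ _ _
    _ ≤ η ^ n := by gcongr

lemma SE_entire (f : ℂ → ℂ) (a : ℕ → ℂ)
    (hs : ∀ w ∈ ball (0 : ℂ) 1, HasSum (fun k => a k * w ^ k) (f w))
    (ha : SE (fun n => ‖a n‖)) :
    ∃ g : ℂ → ℂ, Differentiable ℂ g ∧ ∀ w ∈ ball (0 : ℂ) 1, f w = g w := by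
  refine ⟨fun w => ∑' k, a k * w ^ k, ?_, fun w hw => (hs w hw).tsum_eq.symm⟩
  intro w
  have hsum : Summable (fun k => ‖a k‖ * (‖w‖ + 1) ^ k) := by
    apply Summable.of_norm_bounded_eventually_nat
      (summable_geometric_of_lt_one (by norm_num) (by norm_num : (1/2:ℝ) < 1))
    filter_upwards [ha.mul 1 (‖w‖ + 1) zero_le_one (by positivity) (1/2) (by norm_num)] with n hn
    rw [Real.norm_of_nonneg (by positivity)]
    linarith
  have hd := Complex.differentiableOn_tsum_of_summable_norm (F := fun k w => a k * w ^ k)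
    (U := ball (0:ℂ) (‖w‖ + 1)) hsum
    (fun i => by apply Differentiable.differentiableOn; fun_prop) isOpen_ball
    (fun i x hx => by
      rw [mem_ball_zero_iff] at hx
      rw [norm_mul, norm_pow]
      gcongr)
  exact hd.differentiableAt (isOpen_ball.mem_nhds (by simp))

lemma normalize_lin (f : ℂ → ℂ) (r : ℝ) (n N : ℕ)
    (H : ∃ P Q : Polynomial ℂ, P.degree ≤ (n : ℕ) ∧
      Q.degree ≤ (1 : ℕ) ∧ Q ≠ 0 ∧
      ∃ z : Fin N → ℂ, (∀ i, z i ∈ closedBall (0 : ℂ) r) ∧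
        ∃ h : ℂ → ℂ, DifferentiableOn ℂ h (ball (0 : ℂ) 1) ∧
          ∀ w ∈ ball (0 : ℂ) 1, Q.eval w * f w - P.eval w = (∏ i, (w - z i)) * h w) :
    ∃ α β : ℂ, ‖α‖ ≤ 1 ∧ ‖β‖ ≤ 1 ∧ (‖α‖ = 1 ∨ ‖β‖ = 1) ∧
    ∃ P : Polynomial ℂ, P.degree ≤ (n : ℕ) ∧
      ∃ z : Fin N → ℂ, (∀ i, z i ∈ closedBall (0 : ℂ) r) ∧
        ∃ h : ℂ → ℂ, DifferentiableOn ℂ h (ball (0 : ℂ) 1) ∧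
          ∀ w ∈ ball (0 : ℂ) 1, (α * w + β) * f w - P.eval w = (∏ i, (w - z i)) * h w := by
  obtain ⟨P, Q, hP, hQ, hQ0, z, hz, h, hh, hF⟩ := H
  have hQe : Q = Polynomial.C (Q.coeff 1) * Polynomial.X + Polynomial.C (Q.coeff 0) :=
    Polynomial.eq_X_add_C_of_degree_le_one hQ
  set α := Q.coeff 1
  set β := Q.coeff 0
  obtain ⟨m, hm0, h1, h2, h3⟩ : ∃ m : ℂ, m ≠ 0 ∧ ‖α‖ ≤ ‖m‖ ∧ ‖β‖ ≤ ‖m‖ ∧ (α = m ∨ β = m) := by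
    rcases le_total ‖α‖ ‖β‖ with hle | hle
    · refine ⟨β, ?_, hle, le_rfl, Or.inr rfl⟩
      intro hb
      rw [hb, norm_zero] at hle
      have : α = 0 := norm_le_zero_iff.1 hle
      apply hQ0; rw [hQe, this, hb]; simp
    · refine ⟨α, ?_, le_rfl, hle, Or.inl rfl⟩
      intro hb
      rw [hb, norm_zero] at hle
      have : β = 0 := norm_le_zero_iff.1 hle
      apply hQ0; rw [hQe, this, hb]; simp
  have hmp : 0 < ‖m‖ := norm_pos_iff.2 hm0
  refine ⟨α / m, β / m, ?_, ?_, ?_, Polynomial.C m⁻¹ * P, ?_, z, hz, fun w => m⁻¹ * h w,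
    hh.const_mul _, ?_⟩
  · rw [norm_div, div_le_one hmp]; exact h1
  · rw [norm_div, div_le_one hmp]; exact h2
  · rcases h3 with h3 | h3
    · left; rw [h3, div_self hm0, norm_one]
    · right; rw [h3, div_self hm0, norm_one]
  · rw [Polynomial.degree_C_mul (inv_ne_zero hm0)]; exact hP
  · intro w hw
    have := hF w hw
    rw [hQe] at this
    simp only [Polynomial.eval_add, Polynomial.eval_mul, Polynomial.eval_C,
      Polynomial.eval_X] at this ⊢
    linear_combination m⁻¹ * this

lemma rational_case (f : ℂ → ℂ) (a : ℕ → ℂ)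
    (hf : DifferentiableOn ℂ f (ball (0 : ℂ) 1))
    (hs : ∀ w ∈ ball (0 : ℂ) 1, HasSum (fun k => a k * w ^ k) (f w))
    (q : ℂ) (K : ℕ) (hK : ∀ k ≥ K, a k + q * a (k + 1) = 0) :
    (∃ g : ℂ → ℂ, Differentiable ℂ g ∧ ∀ w ∈ ball (0 : ℂ) 1, f w = g w) ∨
    (∃ P Q : Polynomial ℂ, Q.degree = 1 ∧ ¬ Q ∣ P ∧
      ∀ w ∈ ball (0 : ℂ) 1, Q.eval w ≠ 0 → f w = P.eval w / Q.eval w) := by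
  set Q : Polynomial ℂ := Polynomial.X + Polynomial.C q with hQ
  set P : Polynomial ℂ := Polynomial.C (q * a 0) +
    ∑ k ∈ Finset.range K, Polynomial.C (a k + q * a (k + 1)) * Polynomial.X ^ (k + 1) with hP
  have hmain : ∀ w ∈ ball (0 : ℂ) 1, Q.eval w * f w = P.eval w := by
    intro w hw
    have h0 := hs w hw
    have h1 : HasSum (fun k => a (k + 1) * w ^ (k + 1)) (f w - a 0) := by
      rw [← hasSum_nat_add_iff' 1] at h0
      simpa using h0
    have h2 : HasSum (fun k => (a k + q * a (k + 1)) * w ^ (k + 1)) (w * f w + q * (f w - a 0)) := by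
      refine hasSum_cc ((h0.mul_left w).add (h1.mul_left q)) (fun k => ?_) rfl
      ring
    have h3 : HasSum (fun k => (a k + q * a (k + 1)) * w ^ (k + 1))
        (∑ k ∈ Finset.range K, (a k + q * a (k + 1)) * w ^ (k + 1)) := by
      apply hasSum_sum_of_ne_finset_zero
      intro b hb
      rw [hK b (by simpa using hb), zero_mul]
    have h4 := h2.unique h3
    simp only [hQ, hP, Polynomial.eval_add, Polynomial.eval_X, Polynomial.eval_C,
      Polynomial.eval_finsetSum, Polynomial.eval_mul, Polynomial.eval_pow]
    rw [← h4]; ring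
  by_cases hd : Q ∣ P
  · left
    obtain ⟨T, hT⟩ := hd
    refine ⟨fun w => T.eval w, T.differentiable, ?_⟩
    have hne : ∀ w ∈ ball (0:ℂ) 1, Q.eval w ≠ 0 → f w = T.eval w := by
      intro w hw hne
      have := hmain w hw
      rw [hT, Polynomial.eval_mul] at this
      exact mul_left_cancel₀ hne this
    intro w hw
    by_cases hw0 : Q.eval w = 0
    · have hwq : w = -q := by
        simp only [hQ, Polynomial.eval_add, Polynomial.eval_X, Polynomial.eval_C] at hw0
        exact eq_neg_of_add_eq_zero_left hw0
      have hfc : ContinuousAt f w := (hf.differentiableAt (isOpen_ball.mem_nhds hw)).continuousAt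
      have hTc : ContinuousAt (fun w => T.eval w) w := T.continuous.continuousAt
      have hev : f =ᶠ[nhdsWithin w {w}ᶜ] fun w => T.eval w := by
        filter_upwards [self_mem_nhdsWithin,
          mem_nhdsWithin_of_mem_nhds (isOpen_ball.mem_nhds hw)] with x hx hx'
        apply hne x hx'
        intro h
        simp only [hQ, Polynomial.eval_add, Polynomial.eval_X, Polynomial.eval_C] at h
        exact hx (by rw [Set.mem_singleton_iff, hwq]; exact eq_neg_of_add_eq_zero_left h)
      exact tendsto_nhds_unique (hfc.tendsto.mono_left nhdsWithin_le_nhds)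
        ((hTc.tendsto.mono_left nhdsWithin_le_nhds).congr' hev.symm)
    · exact hne w hw hw0
  · right
    refine ⟨P, Q, Polynomial.degree_X_add_C q, hd, fun w hw hne => ?_⟩
    rw [eq_div_iff hne, mul_comm]
    exact hmain w hw

/-- Overinterpolation by rational functions with linear denominators: let `f` be
holomorphic on the unit disk and `0 < r < 1`. Suppose there is `N : ℕ → ℕ` with
`N(n)/n → ∞` such that for each `n` there are polynomials `Pₙ` (deg ≤ n) and `Qₙ`
(deg ≤ 1, `Qₙ ≠ 0`) for which `Qₙ f - Pₙ` has at least `N(n)` zeros (with multiplicity)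
in the closed disk of radius `r`. Then either `f` extends to an entire function, or
`f = P/Q` with `deg Q = 1` and `Q ∤ P`. -/
theorem stmt_13 (f : ℂ → ℂ) (r : ℝ) (hr0 : 0 < r) (hr1 : r < 1)
    (hf : DifferentiableOn ℂ f (ball (0 : ℂ) 1))
    (N : ℕ → ℕ)
    (hN : Tendsto (fun n : ℕ => (N n : ℝ) / (n : ℝ)) atTop atTop)
    (hint : ∀ n : ℕ, ∃ P Q : Polynomial ℂ, P.degree ≤ (n : ℕ) ∧
      Q.degree ≤ (1 : ℕ) ∧ Q ≠ 0 ∧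
      ∃ z : Fin (N n) → ℂ, (∀ i, z i ∈ closedBall (0 : ℂ) r) ∧
        ∃ h : ℂ → ℂ, DifferentiableOn ℂ h (ball (0 : ℂ) 1) ∧
          ∀ w ∈ ball (0 : ℂ) 1, Q.eval w * f w - P.eval w = (∏ i, (w - z i)) * h w) :
    (∃ g : ℂ → ℂ, Differentiable ℂ g ∧ ∀ w ∈ ball (0 : ℂ) 1, f w = g w) ∨
    (∃ P Q : Polynomial ℂ, Q.degree = 1 ∧ ¬ Q ∣ P ∧
      ∀ w ∈ ball (0 : ℂ) 1, Q.eval w ≠ 0 → f w = P.eval w / Q.eval w) := by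
  set a : ℕ → ℂ := fun k => (k.factorial : ℂ)⁻¹ * iteratedDeriv k f 0 with ha
  have hs : ∀ w ∈ ball (0 : ℂ) 1, HasSum (fun k => a k * w ^ k) (f w) := by
    intro w hw
    refine hasSum_cc (Complex.hasSum_taylorSeries_on_ball hf hw) (fun k => ?_) rfl
    simp only [ha, sub_zero, smul_eq_mul]; ring
  by_cases hSE : SE (fun n => ‖a n‖)
  · exact Or.inl (SE_entire f a hs hSE)
  choose α β hα hβ hαβ P hP z hz h hh hF using fun n => normalize_lin f r n (N n) (hint n)
  set R := r + (1 - r) / 3 with hRdef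
  set ρ := r + 2 * (1 - r) / 3 with hρdef
  have hR : r < R := by rw [hRdef]; linarith
  have hρ : R < ρ := by rw [hRdef, hρdef]; linarith
  have hρ1 : ρ < 1 := by rw [hρdef]; linarith
  have hR0 : 0 < R := by linarith
  have hρ0 : 0 < ρ := by linarith
  obtain ⟨B, hB⟩ : ∃ B, ∀ k, ‖a k‖ * ρ ^ k ≤ B := by
    have hsum := (hs (ρ : ℂ) (by
      rw [mem_ball_zero_iff, Complex.norm_real, Real.norm_of_nonneg hρ0.le]; exact hρ1)).summable.norm
    refine ⟨∑' x, ‖a x * (ρ : ℂ) ^ x‖, fun k => ?_⟩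
    · have := hsum.le_tsum k (fun _ _ => norm_nonneg _)
      rw [norm_mul, norm_pow, Complex.norm_real, Real.norm_of_nonneg hρ0.le] at this
      exact this
  have hB0 : 0 ≤ B := le_trans (by positivity) (hB 0)
  set q := Real.sqrt (1 - ((R ^ 2 - r ^ 2) / (2 * R ^ 2)) ^ 2) with hq
  have hq0 : 0 ≤ q := Real.sqrt_nonneg _
  have hq1 : q < 1 := by
    rw [hq, Real.sqrt_lt' one_pos]
    have : 0 < (R ^ 2 - r ^ 2) / (2 * R ^ 2) := by
      apply div_pos _ (by positivity)
      nlinarith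
    have := pow_pos this 2
    linarith
  have hqN := SE_pow q hq0 hq1 N hN
  have hx : R / ρ < 1 := by rw [div_lt_one hρ0]; exact hρ
  have hx1 : 0 < 1 - R / ρ := by linarith
  have hev : ∀ᶠ n in atTop, q ^ N n * (((n : ℕ) + 1) * (R / r) ^ n) ≤ 1 / 2 := by
    filter_upwards [(hqN.mul 1 (2 * (R / r)) zero_le_one (by positivity)).le_geom (1/2) 1
      (by norm_num) one_pos] with n hn
    have h2 : ((n : ℝ) + 1) ≤ 2 ^ n := by exact_mod_cast Nat.lt_two_pow_self
    rw [mul_pow, one_mul, one_pow, mul_one] at hn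
    refine le_trans ?_ hn
    rw [mul_comm]
    gcongr
  obtain ⟨s, K, hK⟩ := seq_lem a α β (fun n => 2 / (1 - R / ρ) / r * q ^ N n) B ρ r hρ0 hρ1 hr0 hr1 hB0
    (fun k => by
      rw [inv_pow, ← div_eq_mul_inv, le_div_iff₀ (by positivity)]; exact hB k)
    (by simpa using hqN.mul (2 / (1 - R / ρ) / r) 1 (by positivity) one_pos)
    (fun n => by positivity) hα hβ hαβ
    (by
      filter_upwards [hev] with n hn S hS k hk
      exact core f a r R ρ hr0 hR hρ hρ1 hf hs (α n) (β n) n (N n) (P n) (hP n) (z n) (hz n)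
        (h n) (hh n) (hF n) q hq hn S hS k hk)
    hSE
  exact rational_case f a hf hs s K hK
end
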